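/- arXiv:0905.0830 — 2 statements merged into one kernel-verified Lean document; each statement's English description precedes it below -/
import Mathlib

section
/- Let 0 ≤ a < 1 and let p be a prime. The set of real numbers α such that liminf_{q→∞} q·(log q)^{2−a}·‖qα‖·|q|_p·(log(2/|q|_p))^a > 0 has full Hausdorff dimension. -/
open Filter

noncomputable def nint (y : ℝ) : ℝ := |y - round y|

noncomputable def pabs (p x : ℕ) : ℝ := (p : ℝ) ^ (-(padicValNat p x : ℤ))

open MeasureTheory Set

/-- `A` is a union of `p`-adic cells of level `L`. -/
def Simp (p L : ℕ) (A : Set ℝ) : Prop :=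
  ∀ x y : ℝ, ⌊(p : ℝ) ^ L * x⌋ = ⌊(p : ℝ) ^ L * y⌋ → x ∈ A → y ∈ A

/-- the `p`-adic cell of level `L` and index `t`. -/
def cell (p L : ℕ) (t : ℤ) : Set ℝ := {x : ℝ | ⌊(p : ℝ) ^ L * x⌋ = t}

/-- saturation of `B` by cells of level `L`. -/
def Sat (p L : ℕ) (B : Set ℝ) : Set ℝ := {x | ∃ y ∈ B, ⌊(p : ℝ) ^ L * x⌋ = ⌊(p : ℝ) ^ L * y⌋}

lemma sat_simp (p L : ℕ) (B : Set ℝ) : Simp p L (Sat p L B) := by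
  rintro x y h ⟨z, hz, h2⟩
  exact ⟨z, hz, h ▸ h2⟩

lemma subset_sat (p L : ℕ) (B : Set ℝ) : B ⊆ Sat p L B := fun x hx => ⟨x, hx, rfl⟩

lemma floor_mono_aux {p : ℕ} (hp : 2 ≤ p) {L L' : ℕ} (h : L ≤ L') {x y : ℝ}
    (hxy : ⌊(p : ℝ) ^ L' * x⌋ = ⌊(p : ℝ) ^ L' * y⌋) :
    ⌊(p : ℝ) ^ L * x⌋ ≤ ⌊(p : ℝ) ^ L * y⌋ := by
  obtain ⟨d, rfl⟩ := Nat.exists_eq_add_of_le h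
  have hp0 : (0 : ℝ) < (p : ℝ) ^ d := by positivity
  rw [Int.le_floor]
  have h1 := Int.floor_le ((p : ℝ) ^ L * x)
  set f := ⌊(p : ℝ) ^ L * x⌋
  have h2 : f * (p : ℤ) ^ d ≤ ⌊(p : ℝ) ^ (L + d) * x⌋ := by
    rw [Int.le_floor]; push_cast
    have := mul_le_mul_of_nonneg_right h1 hp0.le
    calc _ ≤ _ := this
      _ = _ := by ring
  rw [hxy, Int.le_floor] at h2
  push_cast at h2
  have h3 : (p : ℝ) ^ (L + d) * y = ((p : ℝ) ^ L * y) * (p : ℝ) ^ d := by ring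
  rw [h3] at h2
  exact le_of_mul_le_mul_right h2 hp0

lemma floor_eq_mono {p : ℕ} (hp : 2 ≤ p) {L L' : ℕ} (h : L ≤ L') {x y : ℝ}
    (hxy : ⌊(p : ℝ) ^ L' * x⌋ = ⌊(p : ℝ) ^ L' * y⌋) :
    ⌊(p : ℝ) ^ L * x⌋ = ⌊(p : ℝ) ^ L * y⌋ :=
  le_antisymm (floor_mono_aux hp h hxy) (floor_mono_aux hp h hxy.symm)

lemma Simp.mono {p : ℕ} (hp : 2 ≤ p) {L L' : ℕ} (h : L ≤ L') {A : Set ℝ} (hA : Simp p L A) :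
    Simp p L' A := fun x y hxy hx => hA x y (floor_eq_mono hp h hxy) hx

lemma Simp.diff {p L : ℕ} {A B : Set ℝ} (hA : Simp p L A) (hB : Simp p L B) :
    Simp p L (A \ B) := fun x y h hx => ⟨hA x y h hx.1, fun hy => hx.2 (hB y x h.symm hy)⟩

lemma Simp.inter {p L : ℕ} {A B : Set ℝ} (hA : Simp p L A) (hB : Simp p L B) :
    Simp p L (A ∩ B) := fun x y h hx => ⟨hA x y h hx.1, hB x y h hx.2⟩

lemma Simp.union {p L : ℕ} {A B : Set ℝ} (hA : Simp p L A) (hB : Simp p L B) :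
    Simp p L (A ∪ B) := fun x y h hx => hx.imp (hA x y h) (hB x y h)

lemma Simp.biUnion {p L : ℕ} {ι : Type*} {s : Set ι} {A : ι → Set ℝ}
    (hA : ∀ i ∈ s, Simp p L (A i)) : Simp p L (⋃ i ∈ s, A i) := by
  intro x y h hx
  simp only [mem_iUnion] at hx ⊢
  obtain ⟨i, hi, hx⟩ := hx
  exact ⟨i, hi, hA i hi x y h hx⟩

lemma meas_floor (p L : ℕ) : Measurable (fun x : ℝ => ⌊(p : ℝ) ^ L * x⌋) :=
  Int.measurable_floor.comp (measurable_const_mul _)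

lemma Simp.measurable {p L : ℕ} {A : Set ℝ} (hA : Simp p L A) : MeasurableSet A := by
  have : A = (fun x : ℝ => ⌊(p : ℝ) ^ L * x⌋) ⁻¹' ((fun x : ℝ => ⌊(p : ℝ) ^ L * x⌋) '' A) := by
    ext y; constructor
    · intro h; exact ⟨y, h, rfl⟩
    · rintro ⟨x, hx, h⟩; exact hA x y h hx
  rw [this]
  exact meas_floor p L (MeasurableSet.of_discrete)

lemma cell_meas (p L : ℕ) (t : ℤ) : MeasurableSet (cell p L t) :=
  meas_floor p L (measurableSet_singleton t)

lemma cell_eq {p : ℕ} (hp : 2 ≤ p) (L : ℕ) (t : ℤ) :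
    cell p L t = Ico ((t : ℝ) / (p : ℝ) ^ L) (((t : ℝ) + 1) / (p : ℝ) ^ L) := by
  have hp0 : (0 : ℝ) < (p : ℝ) ^ L := by positivity
  ext x
  simp only [cell, mem_ofPred_eq, mem_Ico, Int.floor_eq_iff]
  rw [div_le_iff₀ hp0, lt_div_iff₀ hp0, mul_comm x]

lemma cell_vol {p : ℕ} (hp : 2 ≤ p) (L : ℕ) (t : ℤ) :
    volume (cell p L t) = ENNReal.ofReal (1 / (p : ℝ) ^ L) := by
  rw [cell_eq hp, Real.volume_Ico]; congr 1; ring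

/-- decomposition of a simple set. -/
lemma vol_simp {p j : ℕ} {G : Set ℝ} (hG : Simp p j G) (D : Set ℝ) (hD : MeasurableSet D) :
    volume (D ∩ G) = ∑' t : ((fun x : ℝ => ⌊(p : ℝ) ^ j * x⌋) '' G), volume (D ∩ cell p j t) := by
  have : D ∩ G = ⋃ t : ((fun x : ℝ => ⌊(p : ℝ) ^ j * x⌋) '' G), (D ∩ cell p j t) := by
    ext x
    simp only [mem_inter_iff, mem_iUnion, cell, mem_ofPred_eq]
    constructor
    · rintro ⟨h1, h2⟩
      exact ⟨⟨_, x, h2, rfl⟩, h1, rfl⟩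
    · rintro ⟨⟨t, y, hy, ht⟩, h1, h2⟩
      refine ⟨h1, hG y x ?_ hy⟩
      simp only at ht h2
      rw [h2, ht]
  rw [this, measure_iUnion]
  · intro s t hst
    rw [Function.onFun, Set.disjoint_left]
    rintro x ⟨_, hx⟩ ⟨_, hy⟩
    exact hst (Subtype.ext (hx.symm.trans hy))
  · intro t; exact hD.inter (cell_meas _ _ _)

lemma vol_local_le {p j : ℕ} {G : Set ℝ} (hG : Simp p j G) (D : Set ℝ) (hD : MeasurableSet D)
    (hG1 : G ⊆ Ico 0 1) (κ : ℝ) (hκ : 0 ≤ κ)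
    (h : ∀ t : ℤ, volume (D ∩ cell p j t) ≤ ENNReal.ofReal κ * volume (cell p j t)) :
    volume.real (D ∩ G) ≤ κ * volume.real G := by
  have h1 : volume (D ∩ G) ≤ ENNReal.ofReal κ * volume G := by
    have e2 := vol_simp hG univ MeasurableSet.univ
    simp only [univ_inter] at e2
    rw [vol_simp hG D hD, e2, ← ENNReal.tsum_mul_left]
    exact ENNReal.tsum_le_tsum fun t => h t
  have hfin : volume G ≠ ⊤ := ((measure_mono hG1).trans_lt (by simp)).ne
  have := ENNReal.toReal_mono (ENNReal.mul_ne_top ENNReal.ofReal_ne_top hfin) h1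
  rwa [ENNReal.toReal_mul, ENNReal.toReal_ofReal hκ] at this

lemma vol_local_ge {p j : ℕ} {G : Set ℝ} (hG : Simp p j G) (D : Set ℝ) (hD : MeasurableSet D)
    (hG1 : G ⊆ Ico 0 1) (κ : ℝ) (hκ : 0 ≤ κ)
    (h : ∀ t : ℤ, ENNReal.ofReal κ * volume (cell p j t) ≤ volume (D ∩ cell p j t)) :
    κ * volume.real G ≤ volume.real (D ∩ G) := by
  have h1 : ENNReal.ofReal κ * volume G ≤ volume (D ∩ G) := by
    have e2 := vol_simp hG univ MeasurableSet.univ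
    simp only [univ_inter] at e2
    rw [vol_simp hG D hD, e2, ← ENNReal.tsum_mul_left]
    exact ENNReal.tsum_le_tsum fun t => h t
  have hfin : volume (D ∩ G) ≠ ⊤ :=
    ((measure_mono (inter_subset_right.trans hG1)).trans_lt (by simp)).ne
  have := ENNReal.toReal_mono hfin h1
  rwa [ENNReal.toReal_mul, ENNReal.toReal_ofReal hκ] at this

def HH (n : ℕ) : ℕ := 3 * (Nat.log 2 n + 1)
def LL (n : ℕ) : ℕ := n + HH n
def lN (p N : ℕ) : ℕ := Nat.clog p (N ^ 2)

lemma HH_mono {m n : ℕ} (h : m ≤ n) : HH m ≤ HH n := by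
  unfold HH; have := Nat.log_mono_right (b := 2) h; omega

lemma LL_mono {m n : ℕ} (h : m ≤ n) : LL m ≤ LL n := by
  unfold LL; have := HH_mono h; omega

lemma LL_sub (n : ℕ) (h : HH n ≤ n) : LL (n - HH n) ≤ n := by
  unfold LL; have := HH_mono (Nat.sub_le n (HH n)); omega

lemma lt_two_pow_log (N : ℕ) : N < 2 ^ (Nat.log 2 N + 1) := Nat.lt_pow_succ_log_self (by norm_num) N

lemma lN_le (p : ℕ) (hp : 2 ≤ p) (N : ℕ) : lN p N ≤ HH N := by
  unfold lN HH
  apply Nat.clog_le_of_le_pow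
  calc N ^ 2 ≤ (2 ^ (Nat.log 2 N + 1)) ^ 2 := Nat.pow_le_pow_left (lt_two_pow_log N).le 2
    _ = 2 ^ (2 * (Nat.log 2 N + 1)) := by rw [← pow_mul, mul_comm]
    _ ≤ 2 ^ (3 * (Nat.log 2 N + 1)) := Nat.pow_le_pow_right (by norm_num) (by omega)
    _ ≤ p ^ (3 * (Nat.log 2 N + 1)) := Nat.pow_le_pow_left hp _

lemma le_pow_lN (p : ℕ) (hp : 2 ≤ p) (N : ℕ) : N ^ 2 ≤ p ^ lN p N := Nat.le_pow_clog (by omega) _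

lemma pow_lN_le (p : ℕ) (hp : 2 ≤ p) (N : ℕ) (hN : 2 ≤ N) : p ^ lN p N ≤ p * N ^ 2 := by
  have h1 : 1 < N ^ 2 := by nlinarith
  have h := Nat.pow_pred_clog_lt_self (b := p) (by omega) h1
  have h2 : 0 < Nat.clog p (N ^ 2) := Nat.clog_pos (by omega) h1
  unfold lN
  obtain ⟨k, hk⟩ := Nat.exists_eq_succ_of_ne_zero h2.ne'
  rw [hk] at h ⊢
  simp only [Nat.pred_succ, Nat.succ_eq_add_one, Nat.add_sub_cancel] at h
  rw [Nat.succ_eq_add_one, pow_succ, mul_comm]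
  exact Nat.mul_le_mul_left _ h.le

lemma HH_small (K e : ℝ) (he : 0 < e) : ∀ᶠ N : ℕ in atTop, K * HH N ≤ e * Real.sqrt N := by
  wlog hK : 0 < K generalizing K
  · filter_upwards [this 1 one_pos] with N hN
    have h0 : (0:ℝ) ≤ HH N := by positivity
    nlinarith
  have h1 : ∀ᶠ x : ℝ in atTop, ‖Real.log x‖ ≤ (e / (12 * K)) * ‖x ^ (1/2 : ℝ)‖ :=
    (isLittleO_log_rpow_atTop (by norm_num : (0:ℝ) < 1/2)).bound (by positivity)
  have h2 : ∀ᶠ x : ℝ in atTop, (6 * K / e) ^ 2 ≤ x := eventually_ge_atTop _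
  filter_upwards [tendsto_natCast_atTop_atTop.eventually h1,
    tendsto_natCast_atTop_atTop.eventually h2, eventually_ge_atTop 1] with N h1 h2 hN
  have hN' : (1 : ℝ) ≤ N := by exact_mod_cast hN
  rw [← Real.sqrt_eq_rpow, Real.norm_of_nonneg (Real.log_nonneg hN'),
    Real.norm_of_nonneg (Real.sqrt_nonneg _)] at h1
  have h3 : 6 * K / e ≤ Real.sqrt N := Real.le_sqrt_of_sq_le h2
  have h4 : (Nat.log 2 N : ℝ) ≤ 2 * Real.log N := by
    have ha : ((2 : ℕ) : ℝ) ^ Nat.log 2 N ≤ N := by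
      exact_mod_cast Nat.pow_log_le_self 2 (by omega)
    have hb := Real.log_le_log (by positivity) ha
    rw [Real.log_pow] at hb
    have := Real.log_two_gt_d9
    push_cast at hb
    have hc : (0:ℝ) ≤ Nat.log 2 N := by positivity
    nlinarith
  unfold HH
  push_cast
  rw [div_le_iff₀ he] at h3
  have h5 : e / (12 * K) * Real.sqrt N * (12 * K) = e * Real.sqrt N := by field_simp
  nlinarith

lemma HH_half : ∀ᶠ N : ℕ in atTop, 2 * HH N + 2 ≤ N := by
  filter_upwards [HH_small 4 1 one_pos, eventually_ge_atTop 4] with N h hN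
  have h1 : Real.sqrt N ≤ N := by
    rw [Real.sqrt_le_left (by positivity)]
    have : (4 : ℝ) ≤ N := by exact_mod_cast hN
    nlinarith
  have h2 : (4 * HH N : ℝ) ≤ N := by linarith
  have h3 : 4 * HH N ≤ N := by exact_mod_cast h2
  have : 3 ≤ HH N := by unfold HH; omega
  omega

/-- The family of data for the construction. -/
structure St (p ns : ℕ) (B U : ℕ → Set ℝ) (C θ : ℝ) (E : Set ℝ) (l M : ℕ) : Prop where
  sub : E ⊆ Ico 0 1
  simp : Simp p l E
  hM : ns ≤ M
  hl : M ≤ l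
  pos : 0 < volume.real E
  half : volume.real E ≤ 2 * volume.real (E \ ⋃ i ∈ Ico M l, (B i ∪ U i))
  cov : ∀ n ≥ l, 8 * (n : ℝ) ^ 2 * (C * θ ^ n) ≤ volume.real E

lemma fin_of_sub {A : Set ℝ} (h : A ⊆ Ico 0 1) : volume A ≠ ⊤ :=
  ((measure_mono h).trans_lt (by simp)).ne

lemma growth {p ns : ℕ} (hp : 2 ≤ p) {B U : ℕ → Set ℝ} {C θ : ℝ} {E : Set ℝ} {l M : ℕ}
    (hns : 2 ≤ ns) (hH : ∀ n ≥ ns, 2 * HH n + 2 ≤ n)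
    (hB : ∀ n, Simp p (LL n) (B n)) (hU : ∀ n, Simp p (LL n) (U n))
    (hloc : ∀ n ≥ ns, ∀ j ≤ n, ∀ G, Simp p j G → G ⊆ Ico 0 1 →
      volume.real (B n ∩ G) ≤ 1 / (16 * n) * volume.real G)
    (hUm : ∀ n ≥ ns, volume.real (U n ∩ Ico 0 1) ≤ C * θ ^ n)
    (S : St p ns B U C θ E l M) :
    ∀ n, l ≤ n → ∀ i, l ≤ i → i ≤ n →
      ((i : ℝ) - 1) * volume.real (E \ ⋃ j ∈ Ico M i, (B j ∪ U j)) ^ 2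
      ≤ ((n : ℝ) - 1) * volume.real (E \ ⋃ j ∈ Ico M n, (B j ∪ U j)) ^ 2 := by
  have hl2 : 2 ≤ l := hns.trans (S.hM.trans S.hl)
  set A : ℕ → Set ℝ := fun n => E \ ⋃ j ∈ Ico M n, (B j ∪ U j) with hA
  have hAE : ∀ n, A n ⊆ E := fun n => sdiff_subset
  have hAI : ∀ n, A n ⊆ Ico 0 1 := fun n => (hAE n).trans S.sub
  have hAmono : ∀ i n, i ≤ n → A n ⊆ A i := by
    intro i n hin
    apply sdiff_subset_sdiff_right
    apply biUnion_subset_biUnion_left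
    exact Ico_subset_Ico_right hin
  have hAs : ∀ i n, l ≤ n → LL i ≤ n → Simp p n (A (i + 1)) := by
    intro i n hln hin
    apply Simp.diff (S.simp.mono hp hln)
    apply Simp.biUnion
    intro j hj
    have : LL j ≤ n := (LL_mono (by have := hj.2; omega)).trans hin
    exact ((hB j).mono hp this).union ((hU j).mono hp this)
  intro n hn
  induction n, hn using Nat.le_induction with
  | base =>
    intro i h1 h2
    obtain rfl : i = l := by omega
    exact le_rfl
  | succ n hn ih =>
    change ∀ i, l ≤ i → i ≤ n → ((i : ℝ) - 1) * volume.real (A i) ^ 2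
      ≤ ((n : ℝ) - 1) * volume.real (A n) ^ 2 at ih
    change ∀ i, l ≤ i → i ≤ n + 1 → ((i : ℝ) - 1) * volume.real (A i) ^ 2
      ≤ (((n + 1 : ℕ) : ℝ) - 1) * volume.real (A (n + 1)) ^ 2
    have key : ((n : ℝ) - 1) * volume.real (A n) ^ 2 ≤ (n : ℝ) * volume.real (A (n + 1)) ^ 2 := by
      have hnns : ns ≤ n := S.hM.trans (S.hl.trans hn)
      have hHn := hH n hnns
      have hn2 : (2 : ℝ) ≤ n := by exact_mod_cast hl2.trans hn
      have hl2' : (2 : ℝ) ≤ l := by exact_mod_cast hl2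
      set a := volume.real (A n) with ha
      have ha0 : 0 ≤ a := measureReal_nonneg
      have hal0 : 0 ≤ volume.real (A l) := measureReal_nonneg
      have hEl : volume.real E ≤ 2 * volume.real (A l) := S.half
      have hll := ih l le_rfl hn
      -- loss from U
      have hU1 : volume.real (U n ∩ A n) ≤ a / (4 * n) := by
        have h1 : volume.real (U n ∩ A n) ≤ C * θ ^ n :=
          (measureReal_mono (inter_subset_inter_right _ (hAI n))
            (fin_of_sub inter_subset_right)).trans (hUm n hnns)
        have h2 := S.cov n hn
        have h3 : volume.real (A l) ≤ n * a := by
          apply le_of_sq_le_sq _ (by positivity)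
          have e1 : volume.real (A l) ^ 2 ≤ ((l : ℝ) - 1) * volume.real (A l) ^ 2 := by
            nlinarith [sq_nonneg (volume.real (A l))]
          have e2 : ((n : ℝ) - 1) * a ^ 2 ≤ (n : ℝ) ^ 2 * a ^ 2 := by
            apply mul_le_mul_of_nonneg_right _ (sq_nonneg a)
            nlinarith
          rw [mul_pow]
          linarith
        have h4 : 8 * (n : ℝ) ^ 2 * (C * θ ^ n) ≤ 2 * (n * a) := by linarith
        have h5 : C * θ ^ n ≤ a / (4 * n) := by
          rw [le_div_iff₀ (by positivity)]
          have : (0:ℝ) < 2 * n := by positivity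
          nlinarith
        linarith
      have hB1 : volume.real (B n ∩ A n) ≤ a / (4 * n) := by
        by_cases hc : l ≤ n - HH n
        · have h3 : 3 ≤ HH n := by unfold HH; omega
          have h1 := hloc n hnns n le_rfl _ (hAs (n - HH n) n hn (LL_sub n (by omega))) (hAI _)
          have h2 : volume.real (B n ∩ A n) ≤ volume.real (B n ∩ A (n - HH n + 1)) :=
            measureReal_mono (inter_subset_inter_right _ (hAmono _ _ (by omega)))
              (fin_of_sub (inter_subset_right.trans (hAI _)))
          have h4 := ih (n - HH n + 1) (by omega) (by omega)
          have h5 : (n : ℝ) / 2 ≤ ((n - HH n + 1 : ℕ) : ℝ) - 1 := by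
            push_cast
            rw [Nat.cast_sub (by omega)]
            have : ((2 * HH n + 2 : ℕ) : ℝ) ≤ n := by exact_mod_cast hHn
            push_cast at this
            linarith
          have h6 : volume.real (A (n - HH n + 1)) ≤ 2 * a := by
            apply le_of_sq_le_sq _ (by positivity)
            nlinarith [sq_nonneg a, sq_nonneg (volume.real (A (n - HH n + 1)))]
          calc _ ≤ _ := h2
            _ ≤ _ := h1
            _ ≤ 1 / (16 * n) * (2 * a) := by gcongr
            _ ≤ a / (4 * n) := by
              rw [div_mul_eq_mul_div, div_le_div_iff₀ (by positivity) (by positivity)]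
              nlinarith [mul_nonneg ha0 (by positivity : (0:ℝ) ≤ n)]
        · have h1 := hloc n hnns n le_rfl _ (S.simp.mono hp hn) S.sub
          have h2 : volume.real (B n ∩ A n) ≤ volume.real (B n ∩ E) :=
            measureReal_mono (inter_subset_inter_right _ (hAE n))
              (fin_of_sub (inter_subset_right.trans S.sub))
          have h5 : (n : ℝ) - 1 ≤ 2 * ((l : ℝ) - 1) := by
            have : ((n + 1 : ℕ) : ℝ) ≤ ((2 * l : ℕ) : ℝ) := by
              norm_cast; omega
            push_cast at this
            linarith
          have h6 : volume.real (A l) ≤ 2 * a := by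
            apply le_of_sq_le_sq _ (by positivity)
            nlinarith [sq_nonneg a, sq_nonneg (volume.real (A l))]
          calc _ ≤ _ := h2
            _ ≤ _ := h1
            _ ≤ 1 / (16 * n) * (4 * a) := by gcongr; linarith
            _ ≤ a / (4 * n) := by
              rw [div_mul_eq_mul_div, div_le_div_iff₀ (by positivity) (by positivity)]
              nlinarith [mul_nonneg ha0 (by positivity : (0:ℝ) ≤ n)]
      have hsplit : a ≤ volume.real (A (n + 1)) + volume.real (B n ∩ A n)
          + volume.real (U n ∩ A n) := by
        have hsub : A n ⊆ A (n + 1) ∪ (B n ∩ A n) ∪ (U n ∩ A n) := by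
          intro x hx
          by_cases hxB : x ∈ B n
          · exact Or.inl (Or.inr ⟨hxB, hx⟩)
          by_cases hxU : x ∈ U n
          · exact Or.inr ⟨hxU, hx⟩
          refine Or.inl (Or.inl ⟨hx.1, ?_⟩)
          intro hmem
          simp only [mem_iUnion] at hmem
          obtain ⟨j, hj, hxj⟩ := hmem
          rcases Nat.lt_succ_iff_lt_or_eq.1 hj.2 with h | h
          · exact hx.2 (mem_biUnion (⟨hj.1, h⟩ : j ∈ Ico M n) hxj)
          · subst h; exact hxj.elim hxB hxU
        have hfin : volume (A (n + 1) ∪ (B n ∩ A n) ∪ (U n ∩ A n)) ≠ ⊤ := by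
          apply fin_of_sub
          exact union_subset (union_subset (hAI _) (inter_subset_right.trans (hAI _)))
            (inter_subset_right.trans (hAI _))
        calc a ≤ _ := measureReal_mono hsub hfin
          _ ≤ _ := measureReal_union_le _ _
          _ ≤ _ := by gcongr; exact measureReal_union_le _ _
      have hn0 : (0:ℝ) < n := by linarith
      have h7 : a * (1 - 1 / (2 * n)) ≤ volume.real (A (n + 1)) := by
        have : a / (4 * n) + a / (4 * n) = a * (1 / (2 * n)) := by field_simp; ring
        linarith
      have h8 : (0:ℝ) ≤ a * (1 - 1 / (2 * n)) := by
        apply mul_nonneg ha0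
        rw [sub_nonneg, div_le_one (by positivity)]; linarith
      have h9 : (a * (1 - 1 / (2 * n))) ^ 2 ≤ volume.real (A (n + 1)) ^ 2 := by gcongr
      have h10 : ((n : ℝ) - 1) * a ^ 2 ≤ n * (a * (1 - 1 / (2 * n))) ^ 2 := by
        have : n * (a * (1 - 1 / (2 * n))) ^ 2 = (n - 1 + 1 / (4 * n)) * a ^ 2 := by
          field_simp; ring
        rw [this]
        gcongr
        have : (0:ℝ) ≤ 1 / (4 * n) := by positivity
        linarith
      calc _ ≤ _ := h10
        _ ≤ _ := by gcongr
    intro i h1 h2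
    rcases Nat.le_succ_iff.1 h2 with h | h
    · refine (ih i h1 h).trans (key.trans (le_of_eq ?_))
      push_cast; ring
    · subst h; exact le_rfl

lemma ev_small (K : ℝ) (k : ℕ) {θ : ℝ} (h0 : 0 < θ) (h1 : θ < 1) {e : ℝ} (he : 0 < e) :
    ∃ I0 : ℕ, ∀ i ≥ I0, K * ((i : ℝ) ^ k * θ ^ i) ≤ e := by
  have h := (tendsto_pow_const_mul_const_pow_of_abs_lt_one k
    (r := θ) (by rw [abs_of_pos h0]; exact h1)).const_mul K
  rw [mul_zero] at h
  have h2 := (h.eventually (gt_mem_nhds he))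
  obtain ⟨I0, hI⟩ := eventually_atTop.1 h2
  exact ⟨I0, fun i hi => (hI i hi).le⟩

lemma transition {p ns : ℕ} (hp : 2 ≤ p) {B U F : ℕ → Set ℝ} {C θ : ℝ} {E : Set ℝ} {l M : ℕ}
    (hC : 0 ≤ C) (hθ : 0 < θ) (hθ1 : θ < 1)
    (hns : 2 ≤ ns) (hH : ∀ n ≥ ns, 2 * HH n + 2 ≤ n)
    (hB : ∀ n, Simp p (LL n) (B n)) (hU : ∀ n, Simp p (LL n) (U n))
    (hloc : ∀ n ≥ ns, ∀ j ≤ n, ∀ G, Simp p j G → G ⊆ Ico 0 1 →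
      volume.real (B n ∩ G) ≤ 1 / (16 * n) * volume.real G)
    (hUm : ∀ n ≥ ns, volume.real (U n ∩ Ico 0 1) ≤ C * θ ^ n)
    (hF : ∀ N, Simp p (N + lN p N) (F N))
    (hFind : ∀ N ≥ ns, ∀ G, Simp p (N - 1) G → G ⊆ Ico 0 1 →
      1 / (p : ℝ) ^ (lN p N + 1) * volume.real G ≤ volume.real (F N ∩ G))
    (hBF : ∀ n ≥ ns, ∀ N ≥ ns,
      volume.real (B n ∩ (F N ∩ Ico 0 1)) ≤ 1 / n * (1 / (p : ℝ) ^ (lN p N)))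
    (S : St p ns B U C θ E l M) (N0 : ℕ) :
    ∃ N ≥ N0, ∃ E' l' M', St p ns B U C θ E' l' M' ∧ E' ⊆ E ∧ E' ⊆ F N ∧ M < M' ∧
      ∀ i ∈ Ico M M', Disjoint E' (B i ∪ U i) := by
  have hl2 : 2 ≤ l := hns.trans (S.hM.trans S.hl)
  have hlns : ns ≤ l := S.hM.trans S.hl
  have hgr := growth hp hns hH hB hU hloc hUm S
  set e := volume.real E with he
  have he0 : 0 < e := S.pos
  obtain ⟨I0, hI0⟩ := ev_small (128 * (p : ℝ) ^ 2 * C) 5 hθ hθ1 he0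
  obtain ⟨N, hN1, hN2, hN3⟩ := ((HH_small (32 * p) e he0).and
    ((eventually_ge_atTop N0).and (eventually_ge_atTop (2 * I0 + 2 * l + 4)))).exists
  have hNns : ns ≤ N := by omega
  have hH1 := hH (N - 1) (by omega)
  have hH2 := hH N hNns
  have hHm : HH (N - 1) ≤ HH N := HH_mono (by omega)
  have hlN := lN_le p hp N
  set g := N - 1 - HH (N - 1) with hg
  have hgl : l ≤ g := by omega
  have hNg : N ≤ 2 * g := by omega
  set A : Set ℝ := E \ ⋃ j ∈ Ico M (g + 1), (B j ∪ U j) with hA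
  have hAE : A ⊆ E := sdiff_subset
  have hAI : A ⊆ Ico 0 1 := hAE.trans S.sub
  have hAs : Simp p (N - 1) A := by
    apply Simp.diff (S.simp.mono hp (by omega))
    apply Simp.biUnion
    intro j hj
    have : LL j ≤ N - 1 := (LL_mono (by have := hj.2; omega)).trans (LL_sub (N - 1) (by omega))
    exact ((hB j).mono hp this).union ((hU j).mono hp this)
  have ha := hgr (g + 1) (by omega) l le_rfl (by omega)
  set a := volume.real A with haa
  have ha0 : 0 ≤ a := measureReal_nonneg
  have hNpos : (0 : ℝ) < N := by have : 0 < N := by omega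
                                 exact_mod_cast this
  have hN1' : (1 : ℝ) ≤ N := by have : 1 ≤ N := by omega
                                exact_mod_cast this
  set s := Real.sqrt N with hs
  have hs2 : s ^ 2 = N := Real.sq_sqrt hNpos.le
  have hs0 : 0 < s := Real.sqrt_pos.2 hNpos
  have hsN : s ≤ N := by nlinarith
  have hal : e ≤ 2 * s * a := by
    have h1 : e ≤ 2 * volume.real (E \ ⋃ j ∈ Ico M l, (B j ∪ U j)) := S.half
    set b := volume.real (E \ ⋃ j ∈ Ico M l, (B j ∪ U j))
    have hb0 : 0 ≤ b := measureReal_nonneg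
    have h2 : b ≤ s * a := by
      apply le_of_sq_le_sq _ (by positivity)
      have hl2' : (2 : ℝ) ≤ l := by exact_mod_cast hl2
      have e1 : b ^ 2 ≤ ((l : ℝ) - 1) * b ^ 2 := by nlinarith [sq_nonneg b]
      have e2 : (((g + 1 : ℕ) : ℝ) - 1) * a ^ 2 ≤ (N : ℝ) * a ^ 2 := by
        apply mul_le_mul_of_nonneg_right _ (sq_nonneg a)
        have : ((g + 1 : ℕ) : ℝ) ≤ N := by exact_mod_cast (by omega : g + 1 ≤ N)
        linarith
      rw [mul_pow, hs2]
      linarith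
    linarith
  have hp0 : (0 : ℝ) < p := by positivity
  set P : ℝ := (p : ℝ) ^ lN p N with hP
  have hP0 : 0 < P := by positivity
  have hPN : P ≤ p * (N : ℝ) ^ 2 := by
    rw [hP]; exact_mod_cast pow_lN_le p hp N (by omega)
  set v := volume.real (F N ∩ A) with hv
  have hv1 : a ≤ v * (p * P) := by
    have := hFind N hNns A hAs hAI
    rw [pow_succ, div_mul_eq_mul_div, one_mul, div_le_iff₀ (by positivity)] at this
    calc a ≤ _ := this
      _ = _ := by rw [← hP]; ring
  have hv0 : 0 ≤ v := measureReal_nonneg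
  have hv2 : e ≤ 2 * s * (v * (p * P)) := hal.trans (by gcongr)
  have hv3 : e ≤ 2 * p ^ 2 * (N : ℝ) ^ 3 * v := by
    calc e ≤ _ := hv2
      _ ≤ 2 * N * (v * (p * (p * (N : ℝ) ^ 2))) := by gcongr
      _ = _ := by ring
  have hEI : F N ∩ A ⊆ Ico 0 1 := inter_subset_right.trans hAI
  -- cov-type bound
  have hcv : ∀ n, g + 1 ≤ n → 128 * (p : ℝ) ^ 2 * ((n : ℝ) ^ 5 * (C * θ ^ n)) ≤ e := by
    intro n hn
    have := hI0 n (by omega)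
    calc _ = _ := by ring
      _ ≤ _ := this
  have hU' : ∀ n, g + 1 ≤ n → n < N + lN p N → C * θ ^ n ≤ v / (4 * N) := by
    intro n hn hn2
    have h1 := (hcv n hn).trans hv3
    rw [le_div_iff₀ (by positivity)]
    have h2 : (N : ℝ) ≤ 2 * n := by exact_mod_cast (by omega : N ≤ 2 * n)
    have hn1 : (1 : ℝ) ≤ n := by exact_mod_cast (by omega : 1 ≤ n)
    have h3 : 8 * (p : ℝ) ^ 2 * N ^ 4 * (C * θ ^ n) ≤ 2 * p ^ 2 * (N : ℝ) ^ 3 * v := by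
      refine le_trans ?_ h1
      have hCt : 0 ≤ C * θ ^ n := by positivity
      calc _ ≤ 8 * (p : ℝ) ^ 2 * (2 * n) ^ 4 * (C * θ ^ n) := by gcongr
        _ = 128 * (p : ℝ) ^ 2 * ((n : ℝ) ^ 4 * (C * θ ^ n)) := by ring
        _ ≤ _ := by gcongr <;> norm_num
    have h4 : 2 * (p : ℝ) ^ 2 * N ^ 3 * (C * θ ^ n * (4 * N)) ≤ 2 * p ^ 2 * (N : ℝ) ^ 3 * v := by
      calc _ = _ := by ring
        _ ≤ _ := h3
    exact le_of_mul_le_mul_left h4 (by positivity)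
  have hB' : ∀ n, g + 1 ≤ n → volume.real (B n ∩ (F N ∩ A)) ≤ 2 / N * (1 / P) := by
    intro n hn
    have h2 : (N : ℝ) ≤ 2 * n := by exact_mod_cast (by omega : N ≤ 2 * n)
    have hn1 : (0 : ℝ) < n := by exact_mod_cast (by omega : 0 < n)
    calc _ ≤ volume.real (B n ∩ (F N ∩ Ico 0 1)) :=
          measureReal_mono (by gcongr) (fin_of_sub (inter_subset_right.trans inter_subset_right))
      _ ≤ _ := hBF n (by omega) N hNns
      _ ≤ _ := by
        refine mul_le_mul_of_nonneg_right ?_ (by positivity)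
        rw [div_le_div_iff₀ hn1 hNpos]; linarith
  refine ⟨N, hN2, F N ∩ A, N + lN p N, g + 1, ⟨hEI, ?_, by omega, by omega, ?_, ?_, ?_⟩,
    inter_subset_right.trans hAE, inter_subset_left, by have := S.hl; omega, ?_⟩
  · exact (hF N).inter (hAs.mono hp (by omega))
  · change 0 < v
    by_contra hc
    have : v = 0 := le_antisymm (not_lt.1 hc) hv0
    rw [this] at hv3; linarith
  · change v ≤ _
    set D := (F N ∩ A) \ ⋃ i ∈ Ico (g + 1) (N + lN p N), (B i ∪ U i)
    set T := Finset.Ico (g + 1) (N + lN p N) with hT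
    have hcard : (T.card : ℝ) ≤ 2 * HH N := by
      have : T.card ≤ 2 * HH N := by rw [hT, Nat.card_Ico]; omega
      exact_mod_cast this
    have hcardN : (T.card : ℝ) ≤ N := by
      refine hcard.trans ?_
      exact_mod_cast (by omega : 2 * HH N ≤ N)
    have hsub : F N ∩ A ⊆ D ∪ ((⋃ i ∈ T, (B i ∩ (F N ∩ A))) ∪ ⋃ i ∈ T, (U i ∩ (F N ∩ A))) := by
      intro x hx
      by_cases h : x ∈ ⋃ i ∈ Ico (g + 1) (N + lN p N), (B i ∪ U i)
      · simp only [mem_iUnion] at h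
        obtain ⟨i, hi, h⟩ := h
        have hiT : i ∈ T := Finset.mem_Ico.2 hi
        rcases h with h | h
        · exact Or.inr (Or.inl (mem_biUnion (t := fun i => B i ∩ (F N ∩ A)) hiT ⟨h, hx⟩))
        · exact Or.inr (Or.inr (mem_biUnion (t := fun i => U i ∩ (F N ∩ A)) hiT ⟨h, hx⟩))
      · exact Or.inl ⟨hx, h⟩
    have hfin : volume (D ∪ ((⋃ i ∈ T, (B i ∩ (F N ∩ A))) ∪ ⋃ i ∈ T, (U i ∩ (F N ∩ A)))) ≠ ⊤ := by
      apply fin_of_sub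
      refine union_subset (sdiff_subset.trans hEI) (union_subset ?_ ?_) <;>
      · exact iUnion₂_subset fun i _ => inter_subset_right.trans hEI
    have hb1 : volume.real (⋃ i ∈ T, (B i ∩ (F N ∩ A))) ≤ v / 4 := by
      calc _ ≤ ∑ i ∈ T, volume.real (B i ∩ (F N ∩ A)) := measureReal_biUnion_finset_le _ _
        _ ≤ ∑ i ∈ T, (2 / N * (1 / P)) := Finset.sum_le_sum fun i hi =>
            hB' i (Finset.mem_Ico.1 hi).1
        _ = T.card * (2 / N * (1 / P)) := by rw [Finset.sum_const, nsmul_eq_mul]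
        _ ≤ 2 * HH N * (2 / N * (1 / P)) := by gcongr
        _ = (4 * HH N) / (N * P) := by field_simp; ring
        _ ≤ v / 4 := by
          rw [div_le_div_iff₀ (by positivity) (by norm_num)]
          have h1 : 32 * p * (HH N : ℝ) ≤ 2 * s * (v * (p * P)) * s :=
            hN1.trans (by gcongr)
          have h2 : 2 * s * (v * (p * P)) * s = 2 * p * (v * (N * P)) := by rw [← hs2]; ring
          rw [h2] at h1
          have h3 : 2 * (p : ℝ) * (4 * HH N * 4) ≤ 2 * p * (v * (N * P)) := by linarith
          exact le_of_mul_le_mul_left h3 (by positivity)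
    have hb2 : volume.real (⋃ i ∈ T, (U i ∩ (F N ∩ A))) ≤ v / 4 := by
      calc _ ≤ ∑ i ∈ T, volume.real (U i ∩ (F N ∩ A)) := measureReal_biUnion_finset_le _ _
        _ ≤ ∑ i ∈ T, (v / (4 * N)) := Finset.sum_le_sum fun i hi => by
            have hi' := Finset.mem_Ico.1 hi
            refine le_trans ?_ (hU' i hi'.1 hi'.2)
            exact (measureReal_mono (inter_subset_inter_right _ hEI)
              (fin_of_sub inter_subset_right)).trans (hUm i (by omega))
        _ = T.card * (v / (4 * N)) := by rw [Finset.sum_const, nsmul_eq_mul]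
        _ ≤ N * (v / (4 * N)) := by gcongr
        _ = v / 4 := by field_simp
    have : v ≤ volume.real D + (v / 4 + v / 4) := by
      calc v ≤ _ := measureReal_mono hsub hfin
        _ ≤ _ := measureReal_union_le _ _
        _ ≤ _ := by
          gcongr
          refine (measureReal_union_le _ _).trans ?_
          gcongr
    linarith
  · intro n hn
    change _ ≤ v
    have h1 := (hcv n (by omega)).trans hv3
    have hn1 : (1 : ℝ) ≤ n := by exact_mod_cast (by omega : 1 ≤ n)
    have h2 : (N : ℝ) ≤ n := by exact_mod_cast (by omega : N ≤ n)
    have hCt : 0 ≤ C * θ ^ n := by positivity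
    have h3 : 2 * (p : ℝ) ^ 2 * n ^ 3 * (8 * (n : ℝ) ^ 2 * (C * θ ^ n)) ≤
        2 * (p : ℝ) ^ 2 * n ^ 3 * v := by
      calc _ = 16 * ((p : ℝ) ^ 2 * ((n : ℝ) ^ 5 * (C * θ ^ n))) := by ring
        _ ≤ 128 * ((p : ℝ) ^ 2 * ((n : ℝ) ^ 5 * (C * θ ^ n))) := by
          apply mul_le_mul_of_nonneg_right (by norm_num); positivity
        _ = _ := by ring
        _ ≤ _ := h1
        _ ≤ _ := by gcongr
    exact le_of_mul_le_mul_left h3 (by positivity)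
  · intro i hi
    rw [Set.disjoint_left]
    intro x hx hxi
    exact hx.2.2 (mem_biUnion (t := fun j => B j ∪ U j) hi hxi)

noncomputable def wt (a : ℝ) (n k : ℕ) : ℝ := 1 / ((n : ℝ) ^ (2 - a) * ((k : ℝ) + 1) ^ a)

lemma wt_pos (a : ℝ) {n : ℕ} (hn : 1 ≤ n) (k : ℕ) : 0 < wt a n k := by
  have : (0 : ℝ) < n := by exact_mod_cast hn
  unfold wt; positivity

lemma sum_rpow_le {a : ℝ} (ha : 0 ≤ a) (ha1 : a < 1) (n : ℕ) :
    ∑ k ∈ Finset.range n, (((k : ℝ) + 1) ^ a)⁻¹ ≤ (n : ℝ) ^ (1 - a) / (1 - a) := by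
  have h1a : 0 < 1 - a := by linarith
  induction n with
  | zero => simp [Real.zero_rpow h1a.ne']
  | succ n ih =>
    rw [Finset.sum_range_succ]
    have hx : (0 : ℝ) < (n : ℝ) + 1 := by positivity
    have hb := rpow_one_add_le_one_add_mul_self (s := -(1 / ((n : ℝ) + 1)))
      (by rw [neg_le_neg_iff, div_le_one hx]; linarith [(Nat.cast_nonneg n : (0:ℝ) ≤ n)]) h1a.le
      (by linarith : 1 - a ≤ 1)
    have e1 : (1 : ℝ) + -(1 / ((n : ℝ) + 1)) = n / (n + 1) := by field_simp; ring
    rw [e1, Real.div_rpow (by positivity) hx.le, div_le_iff₀ (by positivity)] at hb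
    have e2 : ((n : ℝ) + 1) ^ (1 - a) = (n + 1) * (((n : ℝ) + 1) ^ a)⁻¹ := by
      rw [Real.rpow_sub hx, Real.rpow_one]; rfl
    have e3 : (n : ℝ) ^ (1 - a) ≤ ((n : ℝ) + 1) ^ (1 - a) - (1 - a) * (((n : ℝ) + 1) ^ a)⁻¹ := by
      refine hb.trans (le_of_eq ?_)
      rw [e2]; field_simp; ring
    push_cast
    rw [le_div_iff₀ h1a] at ih ⊢
    linarith

lemma sum_wt {a : ℝ} (ha : 0 ≤ a) (ha1 : a < 1) {n : ℕ} (hn : 1 ≤ n) :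
    ∑ k ∈ Finset.range (n + 1), wt a n k ≤ 2 / (1 - a) / n := by
  have h1a : 0 < 1 - a := by linarith
  have hn0 : (1 : ℝ) ≤ n := by exact_mod_cast hn
  have hn1 : (0 : ℝ) < n := by linarith
  have h := sum_rpow_le ha ha1 (n + 1)
  have h2 : (((n + 1 : ℕ) : ℝ)) ^ (1 - a) ≤ 2 * (n : ℝ) ^ (1 - a) := by
    calc (((n + 1 : ℕ) : ℝ)) ^ (1 - a) ≤ (2 * n : ℝ) ^ (1 - a) := by
          apply Real.rpow_le_rpow (by positivity) _ h1a.le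
          push_cast; linarith
      _ = 2 ^ (1 - a) * (n : ℝ) ^ (1 - a) := Real.mul_rpow (by norm_num) hn1.le
      _ ≤ 2 * (n : ℝ) ^ (1 - a) := by
        gcongr
        calc (2 : ℝ) ^ (1 - a) ≤ 2 ^ (1 : ℝ) := Real.rpow_le_rpow_of_exponent_le (by norm_num) (by linarith)
          _ = 2 := by simp
  have e : (n : ℝ) ^ (2 - a) = n * (n : ℝ) ^ (1 - a) := by
    rw [show (2 - a) = 1 + (1 - a) by ring, Real.rpow_add hn1, Real.rpow_one]
  have hpos : 0 < (n : ℝ) ^ (1 - a) := by positivity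
  calc _ = (1 / (n : ℝ) ^ (2 - a)) * ∑ k ∈ Finset.range (n + 1), (((k : ℝ) + 1) ^ a)⁻¹ := by
        rw [Finset.mul_sum]; apply Finset.sum_congr rfl; intro k _; unfold wt
        rw [one_div, mul_inv, one_div]
    _ ≤ (1 / (n : ℝ) ^ (2 - a)) * (2 * (n : ℝ) ^ (1 - a) / (1 - a)) := by
        gcongr
        refine h.trans ?_
        gcongr
    _ = _ := by rw [e]; field_simp

lemma wt_le {a : ℝ} (ha : 0 ≤ a) (ha1 : a < 1) {n : ℕ} (hn : 1 ≤ n) (k : ℕ) : wt a n k ≤ 1 := by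
  have hn0 : (1 : ℝ) ≤ n := by exact_mod_cast hn
  unfold wt
  rw [div_le_one (by positivity)]
  apply one_le_mul_of_one_le_of_one_le
  · exact Real.one_le_rpow hn0 (by linarith)
  · exact Real.one_le_rpow (by linarith [(Nat.cast_nonneg k : (0:ℝ) ≤ k)]) ha

lemma wt_diag {a : ℝ} (ha : 0 ≤ a) {n : ℕ} (hn : 1 ≤ n) :
    wt a n n * (n : ℝ) ^ 2 ≤ 1 := by
  have hn0 : (0 : ℝ) < n := by exact_mod_cast hn
  unfold wt
  rw [div_mul_eq_mul_div, one_mul, div_le_one (by positivity)]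
  calc (n : ℝ) ^ 2 = (n : ℝ) ^ (2 - a) * (n : ℝ) ^ a := by
        rw [← Real.rpow_add hn0]; norm_num
    _ ≤ _ := by gcongr; linarith

lemma wt_ge {a : ℝ} (ha : 0 ≤ a) (ha1 : a < 1) {n k : ℕ} (hn : 1 ≤ n) (hk : k ≤ n) :
    1 ≤ wt a n k * ((n : ℝ) + 1) ^ 2 := by
  have hn0 : (0 : ℝ) < n := by exact_mod_cast hn
  have hk' : (k : ℝ) ≤ n := by exact_mod_cast hk
  unfold wt
  rw [div_mul_eq_mul_div, one_mul, le_div_iff₀ (by positivity), one_mul]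
  calc _ ≤ ((n : ℝ) + 1) ^ (2 - a) * ((n : ℝ) + 1) ^ a := by
        gcongr <;> linarith
    _ = _ := by rw [← Real.rpow_add (by positivity)]; norm_num

/-- separated sets are finite and of controlled cardinality. -/
lemma sep_card {ι : Type*} (T : Finset ι) (f : ι → ℝ) {σ x len : ℝ} (hσ : 0 < σ) (hlen : 0 ≤ len)
    (hsep : ∀ i ∈ T, ∀ j ∈ T, i ≠ j → σ ≤ |f i - f j|)
    (h : ∀ i ∈ T, x ≤ f i ∧ f i ≤ x + len) : (T.card : ℝ) ≤ len / σ + 1 := by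
  classical
  have h1 : T.card ≤ (Finset.Icc (0 : ℤ) ⌊len / σ⌋).card := by
    apply Finset.card_le_card_of_injOn (fun i => ⌊(f i - x) / σ⌋)
    · intro i hi
      obtain ⟨h1, h2⟩ := h i hi
      rw [Finset.mem_coe, Finset.mem_Icc]
      refine ⟨Int.floor_nonneg.2 (div_nonneg (by linarith) hσ.le), Int.floor_le_floor ?_⟩
      gcongr; linarith
    · intro i hi j hj hij
      by_contra hne
      have h2 := Int.abs_sub_lt_one_of_floor_eq_floor hij
      have h3 := hsep i hi j hj hne
      rw [← sub_div, abs_div, abs_of_pos hσ, div_lt_one hσ] at h2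
      rw [show f i - x - (f j - x) = f i - f j by ring] at h2
      linarith
  rw [Int.card_Icc] at h1
  have h0 : 0 ≤ ⌊len / σ⌋ := Int.floor_nonneg.2 (by positivity)
  have h2 : (T.card : ℤ) ≤ ⌊len / σ⌋ + 1 := by omega
  have h3 : (T.card : ℝ) ≤ (⌊len / σ⌋ : ℝ) + 1 := by exact_mod_cast h2
  linarith [Int.floor_le (len / σ)]

lemma sep_fin {ι : Type*} (Q : Set ι) (f : ι → ℝ) {σ x len : ℝ} (hσ : 0 < σ) (hlen : 0 ≤ len)
    (hsep : ∀ i ∈ Q, ∀ j ∈ Q, i ≠ j → σ ≤ |f i - f j|)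
    (h : ∀ i ∈ Q, x ≤ f i ∧ f i ≤ x + len) :
    Q.Finite ∧ (Q.ncard : ℝ) ≤ len / σ + 1 := by
  have hfin : Q.Finite := by
    by_contra hinf
    obtain ⟨T, hT, hc⟩ := Set.Infinite.exists_subset_card_eq hinf (⌊len / σ + 1⌋₊ + 1)
    have := sep_card T f hσ hlen (fun i hi j hj => hsep i (hT hi) j (hT hj)) (fun i hi => h i (hT hi))
    rw [hc] at this
    have h2 := Nat.lt_floor_add_one (len / σ + 1)
    push_cast at this
    linarith
  refine ⟨hfin, ?_⟩
  rw [Set.ncard_eq_toFinset_card Q hfin]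
  exact sep_card _ f hσ hlen (fun i hi j hj => hsep i (by simpa using hi) j (by simpa using hj))
    (fun i hi => h i (by simpa using hi))

lemma fin_meas {ι : Type*} (Q : Set ι) (hQ : Q.Finite) (X : ι → Set ℝ) {b K : ℝ} (hb : 0 ≤ b)
    (hK : (Q.ncard : ℝ) ≤ K) (hX : ∀ i ∈ Q, volume (X i) ≤ ENNReal.ofReal b) :
    volume (⋃ i ∈ Q, X i) ≤ ENNReal.ofReal (K * b) := by
  classical
  have : (⋃ i ∈ Q, X i) = ⋃ i ∈ hQ.toFinset, X i := by simp
  rw [this]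
  calc _ ≤ ∑ i ∈ hQ.toFinset, volume (X i) := measure_biUnion_finset_le _ _
    _ ≤ ∑ i ∈ hQ.toFinset, ENNReal.ofReal b := Finset.sum_le_sum fun i hi => hX i (by simpa using hi)
    _ = hQ.toFinset.card * ENNReal.ofReal b := by rw [Finset.sum_const, nsmul_eq_mul]
    _ = ENNReal.ofReal (Q.ncard * b) := by
      rw [Set.ncard_eq_toFinset_card Q hQ, ENNReal.ofReal_mul (by positivity), ENNReal.ofReal_natCast]
    _ ≤ _ := ENNReal.ofReal_le_ofReal (by gcongr)

lemma frac_sep {z z' : ℤ} {m m' : ℕ} (hm : 0 < m) (hm' : 0 < m')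
    (hz : IsCoprime z (m : ℤ)) (hz' : IsCoprime z' (m' : ℤ)) (hne : (z, m) ≠ (z', m'))
    {X Y d : ℝ} (hX : 0 < X) (hY : 0 < Y) (hd : 0 < d) (h1 : X * (m : ℝ) ^ 2 < Y)
    (h2 : X * (m' : ℝ) ^ 2 < Y) :
    X / (d * Y) ≤ |(z : ℝ) / (d * m) - (z' : ℝ) / (d * m')| := by
  have hm0 : (0 : ℝ) < m := by exact_mod_cast hm
  have hm0' : (0 : ℝ) < m' := by exact_mod_cast hm'
  have hne2 : z * m' - z' * m ≠ 0 := by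
    intro h
    apply hne
    have h : z * m' = z' * m := by linarith
    have d1 : (m : ℤ) ∣ m' := by
      apply hz.symm.dvd_of_dvd_mul_left
      rw [h]; exact dvd_mul_left _ _
    have d2 : (m' : ℤ) ∣ m := by
      apply hz'.symm.dvd_of_dvd_mul_left
      rw [← h]; exact dvd_mul_left _ _
    have e : m = m' := Nat.dvd_antisymm (Int.natCast_dvd_natCast.1 d1) (Int.natCast_dvd_natCast.1 d2)
    subst e
    have : z = z' := mul_right_cancel₀ (by exact_mod_cast hm.ne') h
    rw [this]
  have h3 : (1 : ℝ) ≤ |(z : ℝ) * m' - z' * m| := by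
    exact_mod_cast Int.one_le_abs hne2
  have e : (z : ℝ) / (d * m) - (z' : ℝ) / (d * m') = (z * m' - z' * m) / (d * m * m') := by
    field_simp
  rw [e, abs_div, abs_of_pos (by positivity : 0 < d * m * m')]
  have h4 : X * (m * m') ≤ Y := by
    nlinarith [sq_nonneg ((m : ℝ) - m'), mul_nonneg hX.le (sq_nonneg ((m : ℝ) - m'))]
  rw [div_le_div_iff₀ (by positivity) (by positivity)]
  calc X * (d * m * m') = d * (X * (m * m')) := by ring
    _ ≤ d * Y := by gcongr
    _ = 1 * (d * Y) := by ring
    _ ≤ _ := by gcongr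

/-- admissible fractions of class `(n,k)`. -/
def QQ (p n k : ℕ) : Set (ℤ × ℕ) :=
  {z | ¬ p ∣ z.2 ∧ p ^ n ≤ p ^ k * z.2 ^ 2 ∧ p ^ k * z.2 ^ 2 < p ^ (n + 1) ∧
    IsCoprime z.1 ((p ^ k * z.2 : ℕ) : ℤ)}

noncomputable def rho (p : ℕ) (a c : ℝ) (n k : ℕ) : ℝ := c * wt a n k / (p : ℝ) ^ n

def Bo (p : ℕ) (a c : ℝ) (n : ℕ) : Set ℝ :=
  ⋃ k ∈ Finset.range (n + 1), ⋃ z ∈ QQ p n k,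
    Metric.ball ((z.1 : ℝ) / ((p : ℝ) ^ k * z.2)) (rho p a c n k)

def Bt (p : ℕ) (a c : ℝ) (n : ℕ) : Set ℝ := Sat p (LL n) (Bo p a c n)

lemma Bo_open (p : ℕ) (a c : ℝ) (n : ℕ) : IsOpen (Bo p a c n) :=
  isOpen_biUnion fun _ _ => isOpen_biUnion fun _ _ => Metric.isOpen_ball

lemma sat_dist {p : ℕ} (hp : 2 ≤ p) {L : ℕ} {x y : ℝ}
    (h : ⌊(p : ℝ) ^ L * x⌋ = ⌊(p : ℝ) ^ L * y⌋) : |x - y| < 1 / (p : ℝ) ^ L := by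
  have hp0 : (0 : ℝ) < (p : ℝ) ^ L := by positivity
  have := Int.abs_sub_lt_one_of_floor_eq_floor h
  rw [← mul_sub, abs_mul, abs_of_pos hp0] at this
  rw [lt_div_iff₀ hp0]; linarith

lemma HH_pow {p : ℕ} (hp : 2 ≤ p) (n : ℕ) : ((n : ℝ) + 1) ^ 3 ≤ (p : ℝ) ^ HH n := by
  have h1 : n + 1 ≤ 2 ^ (Nat.log 2 n + 1) := lt_two_pow_log n
  have : (n + 1) ^ 3 ≤ p ^ HH n := by
    calc (n + 1) ^ 3 ≤ (2 ^ (Nat.log 2 n + 1)) ^ 3 := Nat.pow_le_pow_left h1 3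
      _ = 2 ^ HH n := by rw [← pow_mul, HH, mul_comm]
      _ ≤ p ^ HH n := Nat.pow_le_pow_left hp _
  exact_mod_cast this

lemma Bt_sub {p : ℕ} (hp : 2 ≤ p) {a c : ℝ} (ha : 0 ≤ a) (ha1 : a < 1) (hc : 0 < c) {n : ℕ}
    (hn : 1 ≤ n) (hcn : 1 ≤ c * n) {x : ℝ} (hx : x ∈ Bt p a c n) :
    ∃ k ∈ Finset.range (n + 1), ∃ z ∈ QQ p n k,
      |x - (z.1 : ℝ) / ((p : ℝ) ^ k * z.2)| < 2 * rho p a c n k := by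
  obtain ⟨y, hy, hxy⟩ := hx
  simp only [Bo, mem_iUnion] at hy
  obtain ⟨k, hk, z, hz, hy⟩ := hy
  refine ⟨k, hk, z, hz, ?_⟩
  have h1 := sat_dist hp hxy
  rw [Metric.mem_ball, Real.dist_eq] at hy
  have hpp : (0 : ℝ) < (p : ℝ) ^ n := by positivity
  have h2 : 1 / (p : ℝ) ^ LL n ≤ rho p a c n k := by
    unfold LL rho
    have hw := wt_ge ha ha1 hn (Nat.lt_succ_iff.1 (Finset.mem_range.1 hk))
    have hH := HH_pow hp n
    have hw0 := wt_pos a hn k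
    rw [pow_add, mul_comm, ← div_div]
    gcongr
    rw [div_le_iff₀ (by positivity)]
    have hn0 : (0:ℝ) < n := by exact_mod_cast hn
    calc (1 : ℝ) ≤ (c * n) * (wt a n k * ((n : ℝ) + 1) ^ 2) := one_le_mul_of_one_le_of_one_le hcn hw
      _ ≤ (c * (n + 1)) * (wt a n k * ((n : ℝ) + 1) ^ 2) := by gcongr; linarith
      _ = c * wt a n k * ((n : ℝ) + 1) ^ 3 := by ring
      _ ≤ _ := by gcongr
  calc _ = |(x - y) + (y - (z.1 : ℝ) / ((p : ℝ) ^ k * z.2))| := by ring_nf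
    _ ≤ _ := abs_add_le _ _
    _ < _ := by linarith

lemma rho_pos {p : ℕ} (hp : 2 ≤ p) {a c : ℝ} (hc : 0 < c) {n : ℕ} (hn : 1 ≤ n) (k : ℕ) :
    0 < rho p a c n k := by
  have := wt_pos a hn k
  unfold rho; positivity

lemma QQ_pos {p n k : ℕ} {z : ℤ × ℕ} (hz : z ∈ QQ p n k) : 0 < z.2 := by
  rcases Nat.eq_zero_or_pos z.2 with h | h
  · exact absurd (h ▸ dvd_zero p) hz.1
  · exact h

lemma QQ_cop {p n k : ℕ} {z : ℤ × ℕ} (hz : z ∈ QQ p n k) : IsCoprime z.1 (z.2 : ℤ) := by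
  have := hz.2.2.2
  push_cast at this
  exact this.of_mul_right_right

lemma vol_ball_real (x r : ℝ) : volume (Metric.ball x r) = ENNReal.ofReal (2 * r) := by
  rw [Real.volume_ball]

lemma Bt_local {p : ℕ} (hp : 2 ≤ p) {a c : ℝ} (ha : 0 ≤ a) (ha1 : a < 1) (hc : 0 < c)
    (hc4 : c ≤ 1 / 4) (hcp : c * (12 * p * (2 / (1 - a))) ≤ 1 / 16)
    {n : ℕ} (hn : 1 ≤ n) (hcn : 1 ≤ c * n) {j : ℕ} (hj : j ≤ n) {G : Set ℝ} (hG : Simp p j G)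
    (hG1 : G ⊆ Ico 0 1) :
    volume.real (Bt p a c n ∩ G) ≤ 1 / (16 * n) * volume.real G := by
  have hn0 : (0 : ℝ) < n := by exact_mod_cast hn
  have hp0 : (0 : ℝ) < p := by positivity
  apply vol_local_le hG _ (sat_simp _ _ _).measurable hG1 _ (by positivity)
  intro t
  rw [cell_vol hp, ← ENNReal.ofReal_mul (by positivity)]
  set h : ℝ := 1 / (p : ℝ) ^ j with hh
  have hh0 : 0 < h := by positivity
  have hhn : 1 / (p : ℝ) ^ n ≤ h := by
    rw [hh]; gcongr; exact_mod_cast (by omega : 1 ≤ p)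
  set x0 : ℝ := (t : ℝ) / (p : ℝ) ^ j with hx0
  let Q' : ℕ → Set (ℤ × ℕ) := fun k => {z | z ∈ QQ p n k ∧
    x0 - 2 * rho p a c n k ≤ (z.1 : ℝ) / ((p : ℝ) ^ k * z.2) ∧
    (z.1 : ℝ) / ((p : ℝ) ^ k * z.2) ≤ (x0 - 2 * rho p a c n k) + (h + 4 * rho p a c n k)}
  have hsub : Bt p a c n ∩ cell p j t ⊆ ⋃ k ∈ Finset.range (n + 1), ⋃ z ∈ Q' k,
      Metric.ball ((z.1 : ℝ) / ((p : ℝ) ^ k * z.2)) (2 * rho p a c n k) := by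
    rintro x ⟨hx, hxc⟩
    obtain ⟨k, hk, z, hz, hlt⟩ := Bt_sub hp ha ha1 hc hn hcn hx
    simp only [mem_iUnion]
    refine ⟨k, hk, z, ⟨hz, ?_, ?_⟩, ?_⟩
    · rw [cell_eq hp] at hxc
      have := hxc.1
      rw [abs_lt] at hlt; linarith
    · rw [cell_eq hp] at hxc
      have h2 := hxc.2
      have e : ((t : ℝ) + 1) / (p : ℝ) ^ j = x0 + h := by rw [hx0, hh]; ring
      rw [e] at h2
      rw [abs_lt] at hlt; linarith
    · rwa [Metric.mem_ball, Real.dist_eq]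
  have hk : ∀ k ∈ Finset.range (n + 1), volume (⋃ z ∈ Q' k,
      Metric.ball ((z.1 : ℝ) / ((p : ℝ) ^ k * z.2)) (2 * rho p a c n k)) ≤
      ENNReal.ofReal (12 * p * c * h * wt a n k) := by
    intro k hk
    have hr := rho_pos (a := a) hp hc hn k
    have hr4 : 4 * rho p a c n k ≤ h := by
      refine le_trans ?_ hhn
      have hw := wt_le ha ha1 hn k
      have hw0 := wt_pos a hn k
      unfold rho
      rw [mul_div_assoc', div_le_div_iff_of_pos_right (by positivity)]
      nlinarith
    obtain ⟨hf, hcard⟩ := sep_fin (Q' k) (fun z => (z.1 : ℝ) / ((p : ℝ) ^ k * z.2))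
      (σ := 1 / (p : ℝ) ^ (n + 1)) (x := x0 - 2 * rho p a c n k) (len := h + 4 * rho p a c n k)
      (by positivity) (by positivity) (by
        intro z hz z' hz' hne
        have := frac_sep (QQ_pos hz.1) (QQ_pos hz'.1) (QQ_cop hz.1) (QQ_cop hz'.1) hne
          (X := (p : ℝ) ^ k) (Y := (p : ℝ) ^ (n + 1)) (d := (p : ℝ) ^ k) (by positivity)
          (by positivity) (by positivity) (by exact_mod_cast hz.1.2.2.1)
          (by exact_mod_cast hz'.1.2.2.1)
        refine le_trans (le_of_eq ?_) this
        field_simp) (fun z hz => hz.2)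
    have := fin_meas (Q' k) hf (fun z => Metric.ball ((z.1 : ℝ) / ((p : ℝ) ^ k * z.2))
      (2 * rho p a c n k)) (b := 4 * rho p a c n k) (by positivity) hcard
      (fun z _ => by rw [vol_ball_real]; apply ENNReal.ofReal_le_ofReal; linarith)
    refine this.trans (ENNReal.ofReal_le_ofReal ?_)
    have e1 : (h + 4 * rho p a c n k) / (1 / (p : ℝ) ^ (n + 1)) + 1 ≤ 3 * h * (p : ℝ) ^ (n + 1) := by
      rw [div_div_eq_mul_div, div_one]
      have : 1 ≤ h * (p : ℝ) ^ (n + 1) := by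
        calc (1 : ℝ) = 1 / (p : ℝ) ^ n * (p : ℝ) ^ n := by field_simp
          _ ≤ h * (p : ℝ) ^ (n + 1) := by
            gcongr
            · exact_mod_cast (by omega : 1 ≤ p)
            · omega
      have h2 : (h + 4 * rho p a c n k) * (p : ℝ) ^ (n + 1) ≤ (h + h) * (p : ℝ) ^ (n + 1) := by
        gcongr
      linarith
    calc _ ≤ 3 * h * (p : ℝ) ^ (n + 1) * (4 * rho p a c n k) := by gcongr
      _ = _ := by unfold rho; rw [pow_succ]; field_simp; ring
  calc _ ≤ _ := measure_mono hsub
    _ ≤ _ := measure_biUnion_finset_le _ _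
    _ ≤ ∑ k ∈ Finset.range (n + 1), ENNReal.ofReal (12 * p * c * h * wt a n k) :=
      Finset.sum_le_sum hk
    _ = ENNReal.ofReal (∑ k ∈ Finset.range (n + 1), 12 * p * c * h * wt a n k) := by
      rw [ENNReal.ofReal_sum_of_nonneg]
      intro k _
      have := wt_pos a hn k
      positivity
    _ ≤ _ := by
      apply ENNReal.ofReal_le_ofReal
      rw [← Finset.mul_sum]
      calc _ ≤ 12 * p * c * h * (2 / (1 - a) / n) := by gcongr; exact sum_wt ha ha1 hn
        _ = (c * (12 * p * (2 / (1 - a)))) * (h / n) := by ring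
        _ ≤ 1 / 16 * (h / n) := by gcongr
        _ = _ := by field_simp

/-- forced set -/
def FF (p N : ℕ) : Set ℝ :=
  {x | ⌊(p : ℝ) ^ (N + lN p N) * x⌋ ≡ (p : ℤ) ^ lN p N + 1 [ZMOD (p : ℤ) ^ (lN p N + 1)]}

lemma FF_simp (p N : ℕ) : Simp p (N + lN p N) (FF p N) := by
  intro x y h hx
  change _ ≡ _ [ZMOD _]
  rw [← h]; exact hx

lemma lN_pos {p : ℕ} (hp : 2 ≤ p) {N : ℕ} (hN : 2 ≤ N) : 1 ≤ lN p N :=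
  Nat.clog_pos (by omega) (by nlinarith)

lemma FF_ind {p : ℕ} (hp : 2 ≤ p) {N : ℕ} (hN : 2 ≤ N) {G : Set ℝ} (hG : Simp p (N - 1) G)
    (hG1 : G ⊆ Ico 0 1) :
    1 / (p : ℝ) ^ (lN p N + 1) * volume.real G ≤ volume.real (FF p N ∩ G) := by
  apply vol_local_ge hG _ (FF_simp p N).measurable hG1 _ (by positivity)
  intro t
  have hl := lN_pos hp hN
  set l := lN p N with hl'
  have hsub : cell p (N + l) (t * (p : ℤ) ^ (l + 1) + ((p : ℤ) ^ l + 1)) ⊆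
      FF p N ∩ cell p (N - 1) t := by
    intro x hx
    refine ⟨?_, ?_⟩
    · change ⌊(p : ℝ) ^ (N + lN p N) * x⌋ ≡ _ [ZMOD _]
      rw [← hl']
      have : ⌊(p : ℝ) ^ (N + l) * x⌋ = _ := hx
      rw [this]
      exact Int.modEq_iff_dvd.2 ⟨-t, by ring⟩
    · rw [cell_eq hp] at hx ⊢
      obtain ⟨h1, h2⟩ := hx
      have hpN : (p : ℝ) ^ (N + l) = (p : ℝ) ^ (N - 1) * (p : ℝ) ^ (l + 1) := by
        rw [← pow_add]; congr 1; omega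
      have q1 : (0 : ℝ) < (p : ℝ) ^ (N - 1) := by positivity
      have q2 : (0 : ℝ) < (p : ℝ) ^ (l + 1) := by positivity
      have hpl : ((p : ℝ)) ^ l + 1 + 1 ≤ (p : ℝ) ^ (l + 1) := by
        have h2p : (2 : ℝ) ≤ p := by exact_mod_cast hp
        have : (2 : ℝ) ≤ (p : ℝ) ^ l := h2p.trans (le_self_pow₀ (by linarith) (by omega))
        rw [pow_succ]; nlinarith
      have hpl0 : (0 : ℝ) ≤ (p : ℝ) ^ l := by positivity
      push_cast at h1 h2
      rw [hpN, div_le_iff₀ (mul_pos q1 q2)] at h1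
      rw [hpN, lt_div_iff₀ (mul_pos q1 q2)] at h2
      constructor
      · rw [div_le_iff₀ q1]
        have : t * (p : ℝ) ^ (l + 1) ≤ x * (p : ℝ) ^ (N - 1) * (p : ℝ) ^ (l + 1) := by nlinarith
        exact le_of_mul_le_mul_right this q2
      · rw [lt_div_iff₀ q1]
        have : x * (p : ℝ) ^ (N - 1) * (p : ℝ) ^ (l + 1) < (t + 1) * (p : ℝ) ^ (l + 1) := by nlinarith
        exact lt_of_mul_lt_mul_right this q2.le
  calc _ = volume (cell p (N + l) (t * (p : ℤ) ^ (l + 1) + ((p : ℤ) ^ l + 1))) := by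
        rw [cell_vol hp, cell_vol hp, ← ENNReal.ofReal_mul (by positivity)]
        congr 1
        rw [div_mul_div_comm, ← pow_add, one_mul]
        congr 2; omega
    _ ≤ _ := measure_mono hsub

/-- description of the forced set inside the unit interval. -/
lemma FF_mem {p : ℕ} (hp : 2 ≤ p) {N : ℕ} (hN : 2 ≤ N) {x : ℝ} (hx : x ∈ FF p N)
    (hx1 : x ∈ Ico (0 : ℝ) 1) :
    ∃ j : ℕ, j < p ^ N ∧ ¬ p ∣ j ∧ x ∈ cell p (N + lN p N) ((p : ℤ) ^ lN p N * j + 1) := by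
  have hl := lN_pos hp hN
  have hx' : ⌊(p : ℝ) ^ (N + lN p N) * x⌋ ≡ (p : ℤ) ^ lN p N + 1 [ZMOD (p : ℤ) ^ (lN p N + 1)] := hx
  set l := lN p N with hl'
  obtain ⟨u, hu⟩ := Int.modEq_iff_dvd.1 hx'.symm
  set t := ⌊(p : ℝ) ^ (N + l) * x⌋ with ht
  have e : t = (p : ℤ) ^ l * (1 + p * u) + 1 := by
    rw [pow_succ] at hu; linarith
  have ht0 : 0 ≤ t := Int.floor_nonneg.2 (mul_nonneg (by positivity) hx1.1)
  have ht1 : t < (p : ℤ) ^ (N + l) := by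
    rw [ht, Int.floor_lt]; push_cast
    have : (0 : ℝ) < (p : ℝ) ^ (N + l) := by positivity
    nlinarith [hx1.2]
  have hpl : (2 : ℤ) ≤ (p : ℤ) ^ l := by
    have h2p : (2 : ℤ) ≤ p := by exact_mod_cast hp
    exact h2p.trans (le_self_pow₀ (by linarith) (by omega))
  have hj0 : 0 ≤ 1 + p * u := by
    by_contra hc
    have : 1 + (p : ℤ) * u ≤ -1 := by omega
    nlinarith
  obtain ⟨j, hj⟩ := Int.eq_ofNat_of_zero_le hj0
  refine ⟨j, ?_, ?_, ?_⟩
  · have : (p : ℤ) ^ l * j < (p : ℤ) ^ l * (p : ℤ) ^ N := by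
      rw [← pow_add, add_comm l N, ← hj]; linarith
    have := lt_of_mul_lt_mul_left this (by positivity)
    exact_mod_cast this
  · intro hd
    have h1 : (p : ℤ) ∣ 1 + p * u := by rw [hj]; exact_mod_cast hd
    have h2 : (p : ℤ) ∣ 1 := (Int.dvd_add_left (Dvd.intro _ rfl)).1 h1
    have h3 : p ∣ 1 := by exact_mod_cast h2
    have := Nat.le_of_dvd one_pos h3
    omega
  · change ⌊(p : ℝ) ^ (N + l) * x⌋ = _
    rw [← ht, e, hj]

lemma pow_sub_aux (p k N : ℕ) : p ^ (N - k) * p ^ k = p ^ (k - N) * p ^ N := by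
  rw [← pow_add, ← pow_add]; congr 1; omega

lemma pow_min_aux (p k N : ℕ) : p ^ (k - N) * p ^ (min k N) = p ^ k := by
  rw [← pow_add]; congr 1; omega

lemma pow_min_aux2 (p k N : ℕ) : p ^ (N - k) * p ^ (min k N) = p ^ N := by
  rw [← pow_add]; congr 1; omega

/-- counting `j` in a residue class. -/
lemma T_card {p : ℕ} (hp : p.Prime) (k N : ℕ) {z : ℤ} {m : ℕ} (hm : ¬ p ∣ m) :
    let T : Set ℕ := {j | j < p ^ N ∧ ((p ^ (N - k) : ℕ) : ℤ) ∣ z + j * ((p ^ (k - N) * m : ℕ) : ℤ)}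
    T.Finite ∧ (T.ncard : ℝ) ≤ (p : ℝ) ^ (min k N) := by
  intro T
  have hp0 : 0 < p := hp.pos
  have hpr : (0 : ℝ) < p := by exact_mod_cast hp0
  have hpN : (1 : ℝ) ≤ (p : ℝ) ^ N := one_le_pow₀ (by exact_mod_cast hp0)
  obtain ⟨h1, h2⟩ := sep_fin T (fun j => (j : ℝ)) (σ := (p : ℝ) ^ (N - k)) (x := 0)
    (len := (p : ℝ) ^ N - 1) (by positivity) (by linarith) (by
      intro j hj j' hj' hne
      have hd : ((p ^ (N - k) : ℕ) : ℤ) ∣ ((j : ℤ) - j') := by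
        have := dvd_sub hj.2 hj'.2
        rw [show z + (j : ℤ) * ((p ^ (k - N) * m : ℕ) : ℤ) - (z + j' * ((p ^ (k - N) * m : ℕ) : ℤ))
          = ((j : ℤ) - j') * ((p ^ (k - N) * m : ℕ) : ℤ) by ring] at this
        rcases le_total N k with h | h
        · rw [Nat.sub_eq_zero_of_le h]; simp
        · rw [Nat.sub_eq_zero_of_le h, pow_zero, one_mul] at this
          have hcop : IsCoprime ((p ^ (N - k) : ℕ) : ℤ) (m : ℤ) :=
            Nat.isCoprime_iff_coprime.2 (((Nat.Prime.coprime_iff_not_dvd hp).2 hm).pow_left _)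
          exact hcop.dvd_of_dvd_mul_right this
      have hne' : (j : ℤ) - j' ≠ 0 := by
        intro h; apply hne; have : (j : ℤ) = j' := by linarith
        exact_mod_cast this
      have h3 := Int.le_of_dvd (abs_pos.2 hne') ((dvd_abs _ _).2 hd)
      have h4 : ((p ^ (N - k) : ℕ) : ℝ) ≤ |(j : ℝ) - j'| := by exact_mod_cast h3
      push_cast at h4
      exact h4) (by
      intro j hj
      refine ⟨by positivity, ?_⟩
      have h5 : j + 1 ≤ p ^ N := hj.1
      have h6 : (j : ℝ) + 1 ≤ (p : ℝ) ^ N := by exact_mod_cast h5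
      show (j : ℝ) ≤ _
      linarith)
  refine ⟨h1, ?_⟩
  have h3 : (T.ncard : ℝ) < (p : ℝ) ^ (min k N) + 1 := by
    refine lt_of_le_of_lt h2 ?_
    gcongr
    rw [div_lt_iff₀ (by positivity)]
    have : (p : ℝ) ^ (min k N) * (p : ℝ) ^ (N - k) = (p : ℝ) ^ N := by
      rw [mul_comm]; exact_mod_cast pow_min_aux2 p k N
    linarith
  have h4 : T.ncard < p ^ (min k N) + 1 := by exact_mod_cast h3
  exact_mod_cast Nat.lt_succ_iff.1 h4

lemma z_ne_zero {p : ℕ} (hp : p.Prime) {a c : ℝ} (ha : 0 ≤ a) (hc : 0 < c)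
    (hc2 : c * (2 * p) ≤ 1) {n N k : ℕ} (hN : 2 ≤ N) (hk : k ≤ n)
    {r : ℤ} {m : ℕ} (hz : (r, m) ∈ QQ p n k) {x : ℝ} {j : ℕ} (hj : ¬ p ∣ j)
    (hx : |x - (r : ℝ) / ((p : ℝ) ^ k * m)| < 2 * rho p a c n k)
    (hxc : x ∈ cell p (N + lN p N) ((p : ℤ) ^ lN p N * j + 1)) :
    (p : ℤ) ^ (N - k) * r - j * ((p ^ (k - N) * m : ℕ) : ℤ) ≠ 0 := by
  intro h0
  have hm := QQ_pos hz
  obtain ⟨h1, h2, h3, h4⟩ := hz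
  simp only at h1 h2 h3 h4 hm
  have hmc : IsCoprime ((m : ℕ) : ℤ) ((p : ℤ) ^ (N - k)) := by
    have : Nat.Coprime m (p ^ (N - k)) := ((Nat.Prime.coprime_iff_not_dvd hp).2 h1).symm.pow_right _
    exact_mod_cast Nat.isCoprime_iff_coprime.2 this
  have hmr : IsCoprime ((m : ℕ) : ℤ) r := by
    push_cast at h4; exact h4.of_mul_right_right.symm
  have hd : (m : ℤ) ∣ 1 := by
    have e : (m : ℤ) ∣ (p : ℤ) ^ (N - k) * r := by
      rw [sub_eq_zero.1 h0]; push_cast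
      exact ⟨j * p ^ (k - N), by ring⟩
    exact (IsCoprime.mul_right hmc hmr).dvd_of_dvd_mul_left (by simpa using e)
  have hm1 : m = 1 := by
    have : m ∣ 1 := by exact_mod_cast hd
    exact Nat.dvd_one.1 this
  subst hm1
  have hkn : n = k := by
    have : n ≤ k := by
      have h5 : p ^ n ≤ p ^ k := by simpa using h2
      exact (Nat.pow_le_pow_iff_right hp.one_lt).1 h5
    omega
  subst hkn
  have h0' : (p : ℤ) ^ (N - n) * r = j * (p : ℤ) ^ (n - N) := by
    have := sub_eq_zero.1 h0
    push_cast at this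
    rw [this]; ring
  rcases lt_trichotomy n N with h | h | h
  · rw [Nat.sub_eq_zero_of_le h.le, pow_zero, mul_one] at h0'
    apply hj
    have : (p : ℤ) ∣ j := by
      rw [← h0']
      exact Dvd.dvd.mul_right (dvd_pow_self _ (by omega)) _
    exact_mod_cast this
  · subst h
    simp only [Nat.sub_self, pow_zero, one_mul, mul_one] at h0'
    have hp2 := hp.two_le
    have hpr : (0 : ℝ) < p := by exact_mod_cast hp.pos
    rw [cell_eq hp2] at hxc
    have hx1 := hxc.1
    have hx2 := (abs_lt.1 hx).2
    rw [h0'] at hx2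
    push_cast at hx1 hx2
    set l := lN p n
    have hPl : (p : ℝ) ^ l ≤ p * (n : ℝ) ^ 2 := by exact_mod_cast pow_lN_le p hp2 n hN
    have hn1 : 1 ≤ n := by omega
    have hw := wt_diag ha hn1
    have hw0 := wt_pos a hn1 n
    have e1 : ((p : ℝ) ^ l * j + 1) / (p : ℝ) ^ (n + l) = j / (p : ℝ) ^ n
        + 1 / (p : ℝ) ^ l / (p : ℝ) ^ n := by
      rw [pow_add]; field_simp
    have e2 : 2 * rho p a c n n ≤ 1 / (p : ℝ) ^ l / (p : ℝ) ^ n := by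
      unfold rho
      rw [mul_div_assoc']
      gcongr
      rw [le_div_iff₀ (by positivity)]
      calc 2 * (c * wt a n n) * (p : ℝ) ^ l ≤ 2 * (c * wt a n n) * (p * (n : ℝ) ^ 2) := by gcongr
        _ = (c * (2 * p)) * (wt a n n * (n : ℝ) ^ 2) := by ring
        _ ≤ 1 * 1 := by gcongr
        _ = 1 := by norm_num
    rw [e1] at hx1
    rw [mul_one] at hx2
    linarith
  · rw [Nat.sub_eq_zero_of_le h.le, pow_zero, one_mul] at h0'
    have d1 : (p : ℤ) ∣ r := by
      rw [h0']
      exact Dvd.dvd.mul_left (dvd_pow_self _ (by omega)) _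
    have d2 : (p : ℤ) ∣ ((p ^ n * 1 : ℕ) : ℤ) := by
      push_cast
      exact Dvd.dvd.mul_right (dvd_pow_self _ (by omega)) _
    have := h4.isUnit_of_dvd' d1 d2
    rw [Int.ofNat_isUnit, Nat.isUnit_iff] at this
    exact hp.one_lt.ne' this

lemma Bt_FF {p : ℕ} (hp : p.Prime) {a c : ℝ} (ha : 0 ≤ a) (ha1 : a < 1) (hc : 0 < c)
    (hc2 : c * (2 * p) ≤ 1) (hcp : c * (12 * p * (2 / (1 - a))) ≤ 1 / 16)
    {n N : ℕ} (hn : 1 ≤ n) (hcn : 1 ≤ c * n) (hN : 2 ≤ N) :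
    volume.real (Bt p a c n ∩ (FF p N ∩ Ico 0 1)) ≤ 1 / n * (1 / (p : ℝ) ^ lN p N) := by
  have hp2 := hp.two_le
  have hn0 : (0 : ℝ) < n := by exact_mod_cast hn
  have hp0 : (0 : ℝ) < p := by exact_mod_cast hp.pos
  set l := lN p N with hl
  let P' : ℕ → Set (ℤ × ℕ) := fun k => {z | 0 < z.2 ∧ ¬ p ∣ z.2 ∧ IsCoprime z.1 (z.2 : ℤ) ∧
    p ^ k * z.2 ^ 2 < p ^ (n + 1) ∧
    -((p : ℝ) ^ N * (2 * rho p a c n k)) ≤ (z.1 : ℝ) / ((p : ℝ) ^ (k - N) * z.2) ∧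
    (z.1 : ℝ) / ((p : ℝ) ^ (k - N) * z.2) ≤ -((p : ℝ) ^ N * (2 * rho p a c n k)) +
      (2 / (p : ℝ) ^ l + 2 * ((p : ℝ) ^ N * (2 * rho p a c n k)))}
  let P : ℕ → Set (ℤ × ℕ) := fun k => P' k \ {(0, 1)}
  let T : ℕ → (ℤ × ℕ) → Set ℕ := fun k z =>
    {j | j < p ^ N ∧ ((p ^ (N - k) : ℕ) : ℤ) ∣ z.1 + j * ((p ^ (k - N) * z.2 : ℕ) : ℤ)}
  let X : ℕ → (ℤ × ℕ) → ℕ → Set ℝ := fun k z j =>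
    cell p (N + l) ((p : ℤ) ^ l * j + 1) ∩
    Metric.ball ((j + (z.1 : ℝ) / ((p : ℝ) ^ (k - N) * z.2)) / (p : ℝ) ^ N) (2 * rho p a c n k)
  have hsub : Bt p a c n ∩ (FF p N ∩ Ico 0 1) ⊆ ⋃ k ∈ Finset.range (n + 1), ⋃ z ∈ P k,
      ⋃ j ∈ T k z, X k z j := by
    rintro x ⟨hx, hxF, hxI⟩
    obtain ⟨k, hk, ⟨r, m⟩, hz, hlt⟩ := Bt_sub hp2 ha ha1 hc hn hcn hx
    obtain ⟨j, hj1, hj2, hjc⟩ := FF_mem hp2 hN hxF hxI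
    have hkn : k ≤ n := Nat.lt_succ_iff.1 (Finset.mem_range.1 hk)
    simp only at hlt
    have hm := QQ_pos hz
    have hm0 : (0 : ℝ) < m := by exact_mod_cast hm
    have hne := z_ne_zero hp ha hc hc2 hN hkn hz hj2 hlt hjc
    have hcop := QQ_cop hz
    set z : ℤ := (p : ℤ) ^ (N - k) * r - j * ((p ^ (k - N) * m : ℕ) : ℤ) with hzdef
    have hzc : IsCoprime z (m : ℤ) := by
      have h1 : IsCoprime ((p : ℤ) ^ (N - k) * r) (m : ℤ) := by
        apply IsCoprime.mul_left _ hcop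
        have : Nat.Coprime (p ^ (N - k)) m := ((Nat.Prime.coprime_iff_not_dvd hp).2 hz.1).pow_left _
        exact_mod_cast Nat.isCoprime_iff_coprime.2 this
      have h2 : z = (p : ℤ) ^ (N - k) * r + (m : ℤ) * (-(j * (p : ℤ) ^ (k - N))) := by
        rw [hzdef]; push_cast; ring
      rw [h2]
      exact IsCoprime.add_mul_left_left h1 _
    have hpk : (p : ℝ) ^ (N - k) * (p : ℝ) ^ k = (p : ℝ) ^ (k - N) * (p : ℝ) ^ N := by
      exact_mod_cast pow_sub_aux p k N
    have hcen : (j : ℝ) + (z : ℝ) / ((p : ℝ) ^ (k - N) * m) =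
        (p : ℝ) ^ N * ((r : ℝ) / ((p : ℝ) ^ k * m)) := by
      rw [hzdef]; push_cast
      have q1 : (0 : ℝ) < (p : ℝ) ^ (k - N) := by positivity
      have q2 : (0 : ℝ) < (p : ℝ) ^ k := by positivity
      rw [sub_div, mul_div_cancel_right₀ _ (by positivity), mul_div_assoc', add_sub_cancel,
        div_eq_div_iff (by positivity) (by positivity)]
      calc _ = ((p : ℝ) ^ (N - k) * (p : ℝ) ^ k) * (r * m) := by ring
        _ = _ := by rw [hpk]; ring
    have hpN : (0 : ℝ) < (p : ℝ) ^ N := by positivity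
    have hlt2 : |((p : ℝ) ^ N * x - j) - (z : ℝ) / ((p : ℝ) ^ (k - N) * m)| <
        (p : ℝ) ^ N * (2 * rho p a c n k) := by
      rw [show ((p : ℝ) ^ N * x - j) - (z : ℝ) / ((p : ℝ) ^ (k - N) * m) =
        (p : ℝ) ^ N * x - (j + (z : ℝ) / ((p : ℝ) ^ (k - N) * m)) by ring, hcen, ← mul_sub, abs_mul,
        abs_of_pos hpN]
      gcongr
    have hy : 0 ≤ (p : ℝ) ^ N * x - j ∧ (p : ℝ) ^ N * x - j < 2 / (p : ℝ) ^ l := by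
      have hjc' := hjc
      rw [cell_eq hp2] at hjc'
      obtain ⟨g1, g2⟩ := hjc'
      rw [← hl] at g1 g2
      push_cast at g1 g2
      have q3 : (0 : ℝ) < (p : ℝ) ^ l := by positivity
      rw [div_le_iff₀ (by positivity), pow_add] at g1
      rw [lt_div_iff₀ (by positivity), pow_add] at g2
      constructor
      · have : (p : ℝ) ^ l * 0 ≤ (p : ℝ) ^ l * ((p : ℝ) ^ N * x - j) := by nlinarith
        exact le_of_mul_le_mul_left this q3
      · rw [lt_div_iff₀ q3]; nlinarith
    rw [abs_lt] at hlt2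
    simp only [mem_iUnion]
    refine ⟨k, hk, (z, m), ⟨⟨hm, hz.1, hzc, hz.2.2.1, ?_, ?_⟩, ?_⟩, j, ⟨hj1, ?_⟩, ⟨hjc, ?_⟩⟩
    · change _ ≤ (z : ℝ) / ((p : ℝ) ^ (k - N) * m)
      linarith
    · change (z : ℝ) / ((p : ℝ) ^ (k - N) * m) ≤ _
      linarith
    · intro h
      have : z = 0 := congrArg Prod.fst h
      exact hne this
    · change _ ∣ z + _
      rw [hzdef, sub_add_cancel]
      push_cast
      exact Dvd.intro _ rfl
    · rw [Metric.mem_ball, Real.dist_eq]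
      change |x - (j + (z : ℝ) / ((p : ℝ) ^ (k - N) * m)) / (p : ℝ) ^ N| < _
      rw [hcen, mul_div_cancel_left₀ _ hpN.ne']
      exact hlt
  have hk : ∀ k ∈ Finset.range (n + 1), volume (⋃ z ∈ P k, ⋃ j ∈ T k z, X k z j) ≤
      ENNReal.ofReal (12 * p * c * (1 / (p : ℝ) ^ l) * wt a n k) := by
    intro k hk
    have hkn : k ≤ n := Nat.lt_succ_iff.1 (Finset.mem_range.1 hk)
    have hr := rho_pos (a := a) hp2 hc hn k
    have hkmin : (p : ℝ) ^ (k - N) * (p : ℝ) ^ (min k N) = (p : ℝ) ^ k := by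
      exact_mod_cast pow_min_aux p k N
    set τ := 2 * rho p a c n k with hτ
    have hτ0 : 0 < τ := by positivity
    set len := 2 / (p : ℝ) ^ l + 2 * ((p : ℝ) ^ N * τ) with hlen
    have hlen0 : 0 ≤ len := by positivity
    obtain ⟨hf, hcard⟩ := sep_fin (P' k) (fun z => (z.1 : ℝ) / ((p : ℝ) ^ (k - N) * z.2))
      (σ := (p : ℝ) ^ k / ((p : ℝ) ^ (k - N) * (p : ℝ) ^ (n + 1)))
      (x := -((p : ℝ) ^ N * τ)) (len := len) (by positivity) hlen0 (by
        intro z hz z' hz' hne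
        exact frac_sep hz.1 hz'.1 hz.2.2.1 hz'.2.2.1 hne
          (X := (p : ℝ) ^ k) (Y := (p : ℝ) ^ (n + 1)) (d := (p : ℝ) ^ (k - N)) (by positivity)
          (by positivity) (by positivity) (by exact_mod_cast hz.2.2.2.1)
          (by exact_mod_cast hz'.2.2.2.1)) (fun z hz => hz.2.2.2.2)
    have h01 : ((0, 1) : ℤ × ℕ) ∈ P' k := by
      refine ⟨one_pos, hp.one_lt.ne' ∘ Nat.dvd_one.1, by simpa using isCoprime_one_right, ?_, ?_, ?_⟩
      · simp only [one_pow, mul_one]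
        exact Nat.pow_lt_pow_right hp.one_lt (by omega)
      · simp only [Int.cast_zero, zero_div]
        rw [neg_nonpos]; positivity
      · simp only [Int.cast_zero, zero_div]
        have q : (0 : ℝ) ≤ 2 / (p : ℝ) ^ l := by positivity
        have q2 : (0 : ℝ) ≤ (p : ℝ) ^ N * (2 * rho p a c n k) := by positivity
        linarith
    have hPfin : (P k).Finite := hf.subset sdiff_subset
    have hPcard : ((P k).ncard : ℝ) ≤ len / ((p : ℝ) ^ k / ((p : ℝ) ^ (k - N) * (p : ℝ) ^ (n + 1))) := by
      have := Set.ncard_sdiff_singleton_add_one h01 hf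
      have h2 : ((P k).ncard : ℝ) + 1 = (P' k).ncard := by exact_mod_cast this
      linarith
    set b := min (2 * τ) (1 / (p : ℝ) ^ (N + l)) with hb
    have hb0 : 0 ≤ b := by positivity
    have hinner : ∀ z ∈ P k, volume (⋃ j ∈ T k z, X k z j) ≤
        ENNReal.ofReal ((p : ℝ) ^ (min k N) * b) := by
      intro z hz
      obtain ⟨t1, t2⟩ := T_card hp k N (z := z.1) hz.1.2.1
      apply fin_meas (T k z) t1 (X k z) hb0 t2
      intro j _
      rw [hb, ENNReal.ofReal_min]
      apply le_min
      · refine (measure_mono inter_subset_right).trans (le_of_eq ?_)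
        rw [vol_ball_real]
      · refine (measure_mono inter_subset_left).trans (le_of_eq ?_)
        rw [cell_vol hp2]
    have := fin_meas (P k) hPfin (fun z => ⋃ j ∈ T k z, X k z j) (by positivity) hPcard hinner
    refine this.trans (ENNReal.ofReal_le_ofReal ?_)
    have e1 : len / ((p : ℝ) ^ k / ((p : ℝ) ^ (k - N) * (p : ℝ) ^ (n + 1))) *
        ((p : ℝ) ^ (min k N) * b) = (p : ℝ) ^ (n + 1) * (len * b) := by
      rw [← hkmin]; field_simp
    rw [e1]
    have e2 : len * b ≤ 6 * τ / (p : ℝ) ^ l := by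
      rw [hlen, add_mul]
      have b1 : b ≤ 2 * τ := min_le_left _ _
      have b2 : b ≤ 1 / (p : ℝ) ^ (N + l) := min_le_right _ _
      calc _ ≤ 2 / (p : ℝ) ^ l * (2 * τ) + 2 * ((p : ℝ) ^ N * τ) * (1 / (p : ℝ) ^ (N + l)) := by
            gcongr
        _ = _ := by rw [pow_add]; field_simp; ring
    calc _ ≤ (p : ℝ) ^ (n + 1) * (6 * τ / (p : ℝ) ^ l) := by gcongr
      _ = _ := by rw [hτ]; unfold rho; rw [pow_succ]; field_simp; ring
  have hfinal : volume (Bt p a c n ∩ (FF p N ∩ Ico 0 1)) ≤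
      ENNReal.ofReal (1 / n * (1 / (p : ℝ) ^ l)) := by
    calc _ ≤ _ := measure_mono hsub
      _ ≤ _ := measure_biUnion_finset_le _ _
      _ ≤ ∑ k ∈ Finset.range (n + 1), ENNReal.ofReal (12 * p * c * (1 / (p : ℝ) ^ l) * wt a n k) :=
        Finset.sum_le_sum hk
      _ = ENNReal.ofReal (∑ k ∈ Finset.range (n + 1), 12 * p * c * (1 / (p : ℝ) ^ l) * wt a n k) := by
        rw [ENNReal.ofReal_sum_of_nonneg]
        intro k _
        have := wt_pos a hn k
        positivity
      _ ≤ _ := by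
        apply ENNReal.ofReal_le_ofReal
        rw [← Finset.mul_sum]
        calc _ ≤ 12 * p * c * (1 / (p : ℝ) ^ l) * (2 / (1 - a) / n) := by
              gcongr; exact sum_wt ha ha1 hn
          _ = (c * (12 * p * (2 / (1 - a)))) * (1 / n * (1 / (p : ℝ) ^ l)) := by ring
          _ ≤ 1 * (1 / n * (1 / (p : ℝ) ^ l)) := by gcongr; linarith
          _ = _ := one_mul _
  exact ENNReal.toReal_le_of_le_ofReal (by positivity) hfinal

lemma fin_of_card {ι : Type*} (Q : Set ι) {K : ℝ}
    (h : ∀ T : Finset ι, (∀ i ∈ T, i ∈ Q) → (T.card : ℝ) ≤ K) :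
    Q.Finite ∧ (Q.ncard : ℝ) ≤ K := by
  have hfin : Q.Finite := by
    by_contra hinf
    obtain ⟨T, hT, hc⟩ := Set.Infinite.exists_subset_card_eq hinf (⌊K⌋₊ + 1)
    have := h T fun i hi => hT hi
    rw [hc] at this
    have h2 := Nat.lt_floor_add_one K
    push_cast at this
    linarith
  refine ⟨hfin, ?_⟩
  rw [Set.ncard_eq_toFinset_card Q hfin]
  exact h _ fun i hi => by simpa using hi

lemma small_cover {S : Set ℝ} {s : ℝ} (h : Measure.hausdorffMeasure s S = 0) {η : ℝ} (hη : 0 < η) :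
    ∃ (t : ℕ → Set ℝ) (E : ℕ → ℝ), S ⊆ ⋃ i, t i ∧ (∀ i, 0 < E i) ∧
      (∀ T : Finset ℕ, ∑ i ∈ T, E i ≤ η) ∧
      ∀ i, ∀ x ∈ t i, ∀ y ∈ t i, 0 < s → |x - y| ^ s ≤ E i := by
  rw [Measure.hausdorffMeasure_apply] at h
  have h1 : (⨅ (t : ℕ → Set ℝ) (_ : S ⊆ ⋃ n, t n) (_ : ∀ n, Metric.ediam (t n) ≤ 1),
          ∑' n, ⨆ _ : (t n).Nonempty, Metric.ediam (t n) ^ s) < ENNReal.ofReal (η / 2) := by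
    refine lt_of_le_of_lt ?_ (ENNReal.ofReal_pos.2 (by positivity))
    rw [← h]
    exact le_iSup₂ (f := fun (r : ENNReal) (_ : 0 < r) =>
      ⨅ (t : ℕ → Set ℝ) (_ : S ⊆ ⋃ n, t n) (_ : ∀ n, Metric.ediam (t n) ≤ r),
          ∑' n, ⨆ _ : (t n).Nonempty, Metric.ediam (t n) ^ s) 1 one_pos
  simp only [iInf_lt_iff] at h1
  obtain ⟨t, ht, ht1, hsum⟩ := h1
  obtain ⟨ε, hε, hεs⟩ := ENNReal.exists_pos_sum_of_countable'
    (ε := ENNReal.ofReal (η / 2)) (ENNReal.ofReal_pos.2 (by positivity)).ne' ℕ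
  set f : ℕ → ENNReal := fun n => ⨆ _ : (t n).Nonempty, Metric.ediam (t n) ^ s with hf
  have htot : ∑' n, (f n + ε n) ≤ ENNReal.ofReal η := by
    rw [ENNReal.tsum_add]
    calc _ ≤ ENNReal.ofReal (η / 2) + ENNReal.ofReal (η / 2) := add_le_add hsum.le hεs.le
      _ = ENNReal.ofReal η := by
        rw [← ENNReal.ofReal_add (by positivity) (by positivity)]; congr 1; ring
  have hfin : ∀ n, f n + ε n ≠ ⊤ := fun n =>
    (((ENNReal.le_tsum n).trans htot).trans_lt ENNReal.ofReal_lt_top).ne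
  refine ⟨t, fun n => (f n + ε n).toReal, ht, ?_, ?_, ?_⟩
  · intro i
    exact ENNReal.toReal_pos ((hε i).trans_le le_add_self).ne' (hfin i)
  · intro T
    rw [← ENNReal.toReal_sum fun i _ => hfin i]
    exact ENNReal.toReal_le_of_le_ofReal hη.le ((ENNReal.sum_le_tsum T).trans htot)
  · intro i x hx y hy hs
    have h2 : edist x y ^ s ≤ f i + ε i := by
      refine le_trans ?_ le_self_add
      refine le_trans ?_ (le_iSup (fun _ : (t i).Nonempty => Metric.ediam (t i) ^ s) ⟨x, hx⟩)
      exact ENNReal.rpow_le_rpow (Metric.edist_le_ediam_of_mem hx hy) hs.le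
    have h3 := ENNReal.toReal_mono (hfin i) h2
    rw [← ENNReal.toReal_rpow, edist_dist, ENNReal.toReal_ofReal dist_nonneg, Real.dist_eq] at h3
    exact h3

lemma cover {p : ℕ} (hp : 2 ≤ p) {S : Set ℝ} {s : ℝ} (hs : 0 < s) (hs1 : s < 1)
    (h : Measure.hausdorffMeasure s S = 0) (ns : ℕ) :
    ∃ U : ℕ → Set ℝ, (∀ n, IsOpen (U n)) ∧ (∀ x ∈ S, ∃ n ≥ ns, x ∈ U n) ∧
      ∀ n, volume.real (Sat p (LL n) (U n) ∩ Ico 0 1) ≤ 6 * p * ((p : ℝ) ^ (s - 1)) ^ n := by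
  classical
  have hp0 : (0 : ℝ) < p := by positivity
  have hp1 : (1 : ℝ) < p := by exact_mod_cast (by omega : 1 < p)
  set y : ℝ := 1 / p with hy
  have hy0 : 0 < y := by positivity
  have hy1 : y < 1 := by rw [hy, div_lt_one hp0]; exact hp1
  set η : ℝ := (y ^ ns) ^ s with hη
  have hη0 : 0 < η := by positivity
  have hη1 : η ≤ 1 := Real.rpow_le_one (by positivity) (pow_le_one₀ hy0.le hy1.le) hs.le
  obtain ⟨t, E, hSt, hE0, hEs, hEd⟩ := small_cover h hη0
  have hEη : ∀ i, E i ≤ η := fun i => by simpa using hEs {i}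
  set e : ℕ → ℝ := fun i => E i ^ (1 / s) with he
  have he0 : ∀ i, 0 < e i := fun i => Real.rpow_pos_of_pos (hE0 i) _
  have hes : ∀ i, e i ^ s = E i := fun i => by
    rw [he, ← Real.rpow_mul (hE0 i).le, one_div_mul_cancel hs.ne', Real.rpow_one]
  have hens : ∀ i, e i ≤ y ^ ns := fun i => by
    rw [← Real.rpow_le_rpow_iff (he0 i).le (by positivity) hs, hes]; exact hEη i
  let c : ℕ → ℝ := fun i => if hne : (t i).Nonempty then hne.some else 0
  have hc : ∀ i, ∀ x ∈ t i, |x - c i| ≤ e i := by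
    intro i x hx
    have hne : (t i).Nonempty := ⟨x, hx⟩
    have : c i ∈ t i := by
      simp only [c, dif_pos hne]; exact hne.some_mem
    rw [← Real.rpow_le_rpow_iff (abs_nonneg _) (he0 i).le hs, hes]
    exact hEd i x hx _ this hs
  let I : ℕ → Set ℕ := fun n => {i | y ^ (n + 1) < e i ∧ e i ≤ y ^ n}
  refine ⟨fun n => ⋃ i ∈ I n, Metric.ball (c i) (2 * y ^ n),
    fun n => isOpen_biUnion fun _ _ => Metric.isOpen_ball, ?_, ?_⟩
  · intro x hx
    obtain ⟨i, hi⟩ := mem_iUnion.1 (hSt hx)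
    obtain ⟨n, hn1, hn2⟩ := exists_nat_pow_near_of_lt_one (he0 i)
      ((hens i).trans (pow_le_one₀ hy0.le hy1.le)) hy0 hy1
    refine ⟨n, ?_, ?_⟩
    · by_contra hlt
      have h1 : y ^ ns ≤ y ^ (n + 1) := pow_le_pow_of_le_one hy0.le hy1.le (by omega)
      have := hens i
      linarith
    · simp only [mem_iUnion]
      refine ⟨i, ⟨hn1, hn2⟩, ?_⟩
      rw [Metric.mem_ball, Real.dist_eq]
      have h1 := hc i x hi
      have h2 : 0 < y ^ n := by positivity
      linarith
  · intro n
    have hyn : y ^ n = 1 / (p : ℝ) ^ n := by rw [hy, one_div_pow]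
    obtain ⟨hIf, hIc⟩ := fin_of_card (I n) (K := p * ((p : ℝ) ^ n) ^ s) (by
      intro T hT
      have h1 : ∑ i ∈ T, (y ^ (n + 1)) ^ s ≤ ∑ i ∈ T, E i := by
        apply Finset.sum_le_sum
        intro i hi
        rw [← hes i]
        exact Real.rpow_le_rpow (by positivity) (hT i hi).1.le hs.le
      rw [Finset.sum_const, nsmul_eq_mul] at h1
      have h2 : (T.card : ℝ) * (y ^ (n + 1)) ^ s ≤ 1 := h1.trans ((hEs T).trans hη1)
      have h3 : (y ^ (n + 1)) ^ s = 1 / (((p : ℝ) ^ n) ^ s * (p : ℝ) ^ s) := by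
        rw [hy, one_div_pow, Real.div_rpow (by norm_num) (by positivity), Real.one_rpow, pow_succ,
          Real.mul_rpow (by positivity) hp0.le]
      rw [h3, mul_one_div, div_le_one (by positivity)] at h2
      refine h2.trans ?_
      rw [mul_comm]
      gcongr
      calc (p : ℝ) ^ s ≤ (p : ℝ) ^ (1 : ℝ) := Real.rpow_le_rpow_of_exponent_le hp1.le hs1.le
        _ = p := Real.rpow_one _)
    have hsub : Sat p (LL n) (⋃ i ∈ I n, Metric.ball (c i) (2 * y ^ n)) ∩ Ico 0 1 ⊆
        ⋃ i ∈ I n, Metric.ball (c i) (3 * y ^ n) := by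
      rintro x ⟨⟨x', hx', hxx⟩, _⟩
      simp only [mem_iUnion] at hx' ⊢
      obtain ⟨i, hi, hx'⟩ := hx'
      refine ⟨i, hi, ?_⟩
      have h1 := sat_dist hp hxx
      have h2 : 1 / (p : ℝ) ^ LL n ≤ y ^ n := by
        rw [hyn]; gcongr
        · exact hp1.le
        · unfold LL; omega
      rw [Metric.mem_ball, Real.dist_eq] at hx' ⊢
      calc |x - c i| = |(x - x') + (x' - c i)| := by ring_nf
        _ ≤ _ := abs_add_le _ _
        _ < _ := by linarith
    have := fin_meas (I n) hIf (fun i => Metric.ball (c i) (3 * y ^ n)) (b := 6 * y ^ n)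
      (by positivity) hIc (fun i _ => by
        rw [vol_ball_real]; apply ENNReal.ofReal_le_ofReal; linarith)
    refine ENNReal.toReal_le_of_le_ofReal (by positivity) (((measure_mono hsub).trans this).trans
      (le_of_eq ?_))
    congr 1
    rw [hyn, Real.rpow_sub hp0, Real.rpow_one, div_pow, ← Real.rpow_natCast ((p : ℝ) ^ s),
      ← Real.rpow_mul hp0.le, mul_comm s, Real.rpow_mul hp0.le, Real.rpow_natCast]
    ring

lemma exists_limit {p ns : ℕ} (hp : 2 ≤ p) {B U F : ℕ → Set ℝ} {C θ : ℝ}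
    (hC : 0 ≤ C) (hθ : 0 < θ) (hθ1 : θ < 1)
    (hns : 2 ≤ ns) (hH : ∀ n ≥ ns, 2 * HH n + 2 ≤ n)
    (hB : ∀ n, Simp p (LL n) (B n)) (hU : ∀ n, Simp p (LL n) (U n))
    (hloc : ∀ n ≥ ns, ∀ j ≤ n, ∀ G, Simp p j G → G ⊆ Ico 0 1 →
      volume.real (B n ∩ G) ≤ 1 / (16 * n) * volume.real G)
    (hUm : ∀ n ≥ ns, volume.real (U n ∩ Ico 0 1) ≤ C * θ ^ n)
    (hF : ∀ N, Simp p (N + lN p N) (F N))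
    (hFind : ∀ N ≥ ns, ∀ G, Simp p (N - 1) G → G ⊆ Ico 0 1 →
      1 / (p : ℝ) ^ (lN p N + 1) * volume.real G ≤ volume.real (F N ∩ G))
    (hBF : ∀ n ≥ ns, ∀ N ≥ ns,
      volume.real (B n ∩ (F N ∩ Ico 0 1)) ≤ 1 / n * (1 / (p : ℝ) ^ (lN p N)))
    (hcov : ∀ n ≥ ns, 8 * (n : ℝ) ^ 2 * (C * θ ^ n) ≤ 1)
    (Bo Uo : ℕ → Set ℝ) (hBo : ∀ n, IsOpen (Bo n)) (hUo : ∀ n, IsOpen (Uo n))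
    (hBs : ∀ n, Bo n ⊆ B n) (hUs : ∀ n, Uo n ⊆ U n) :
    ∃ x : ℝ, (∀ n ≥ ns, x ∉ Bo n ∧ x ∉ Uo n) ∧
      ∀ N0, ∃ N ≥ N0, x ∈ closure (F N ∩ Ico 0 1) := by
  let Sg := {t : Set ℝ × ℕ × ℕ // St p ns B U C θ t.1 t.2.1 t.2.2}
  have hstep : ∀ (σ : Sg) (N0 : ℕ), ∃ N ≥ N0, ∃ τ : Sg, τ.1.1 ⊆ σ.1.1 ∧ τ.1.1 ⊆ F N ∧
      σ.1.2.2 < τ.1.2.2 ∧ ∀ i ∈ Ico σ.1.2.2 τ.1.2.2, Disjoint τ.1.1 (B i ∪ U i) := by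
    rintro ⟨⟨E, l, M⟩, S⟩ N0
    obtain ⟨N, hN, E', l', M', S', h1, h2, h3, h4⟩ := transition hp hC hθ hθ1 hns hH hB hU hloc hUm
      hF hFind hBF S N0
    exact ⟨N, hN, ⟨(E', l', M'), S'⟩, h1, h2, h3, h4⟩
  choose Nf hNf step hst1 hst2 hst3 hst4 using hstep
  have hvol : volume.real (Ico (0 : ℝ) 1) = 1 := by simp
  have S0 : St p ns B U C θ (Ico 0 1) ns ns := by
    refine ⟨subset_rfl, ?_, le_rfl, le_rfl, by rw [hvol]; norm_num, ?_, ?_⟩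
    · have h0 : Simp p 0 (Ico 0 1) := by
        intro x y hxy hx
        simp only [pow_zero, one_mul] at hxy
        have : ⌊x⌋ = 0 := Int.floor_eq_zero_iff.2 hx
        exact Int.floor_eq_zero_iff.1 (hxy ▸ this)
      exact h0.mono hp (Nat.zero_le _)
    · simp
    · intro n hn; rw [hvol]; exact hcov n hn
  let X : ℕ → Sg := fun i => Nat.rec ⟨(Ico 0 1, ns, ns), S0⟩ (fun i σ => step σ i) i
  have hXs : ∀ i, X (i + 1) = step (X i) i := fun i => rfl
  have hMi : ∀ i, ns + i ≤ (X i).1.2.2 := by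
    intro i
    induction i with
    | zero => exact le_rfl
    | succ i ih =>
      have := hst3 (X i) i
      rw [← hXs] at this; omega
  have hdis : ∀ i, ∀ n ∈ Ico ns (X i).1.2.2, Disjoint (X i).1.1 (B n ∪ U n) := by
    intro i
    induction i with
    | zero =>
      intro n hn
      have h1 : ns ≤ n := hn.1
      have h2 : n < ns := hn.2
      omega
    | succ i ih =>
      intro n hn
      by_cases h : n < (X i).1.2.2
      · exact (ih n ⟨hn.1, h⟩).mono_left (hst1 (X i) i)
      · exact hst4 (X i) i n ⟨not_lt.1 h, hn.2⟩
  have hI : ∀ i, (X i).1.1 ⊆ Ico 0 1 := fun i => (X i).2.sub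
  obtain ⟨x, hx⟩ := IsCompact.nonempty_iInter_of_sequence_nonempty_isCompact_isClosed
    (fun i => closure (X i).1.1) (fun i => closure_mono (hst1 (X i) i)) (fun i => by
      apply Set.Nonempty.closure
      by_contra hne
      rw [Set.not_nonempty_iff_eq_empty] at hne
      have := (X i).2.pos
      rw [hne] at this
      simp at this)
    (by
      apply IsCompact.of_isClosed_subset isCompact_Icc isClosed_closure
      exact closure_minimal ((hI 0).trans Ico_subset_Icc_self) isClosed_Icc)
    (fun i => isClosed_closure)
  rw [mem_iInter] at hx
  refine ⟨x, ?_, ?_⟩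
  · intro n hn
    have h := hdis (n + 1) n ⟨hn, by have := hMi (n + 1); omega⟩
    rw [disjoint_union_right] at h
    exact ⟨fun hxB => Set.disjoint_left.1 ((h.1.mono_right (hBs n)).closure_left (hBo n)) (hx (n + 1)) hxB,
      fun hxU => Set.disjoint_left.1 ((h.2.mono_right (hUs n)).closure_left (hUo n)) (hx (n + 1)) hxU⟩
  · intro N0
    refine ⟨Nf (X N0) N0, hNf _ _, ?_⟩
    exact closure_mono (subset_inter (hst2 (X N0) N0) (hI (N0 + 1))) (hx (N0 + 1))

lemma FF_closure {p : ℕ} (hp : 2 ≤ p) {N : ℕ} (hN : 2 ≤ N) {x : ℝ}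
    (hx : x ∈ closure (FF p N ∩ Ico 0 1)) : nint ((p ^ N : ℕ) * x) ≤ 3 / (N : ℝ) ^ 2 := by
  have hp0 : (0 : ℝ) < p := by positivity
  have hN0 : (0 : ℝ) < N := by positivity
  obtain ⟨y, ⟨hyF, hyI⟩, hxy⟩ := Metric.mem_closure_iff.1 hx (1 / (p : ℝ) ^ (N + lN p N))
    (by positivity)
  obtain ⟨j, _, _, hj⟩ := FF_mem hp hN hyF hyI
  rw [cell_eq hp] at hj
  obtain ⟨g1, g2⟩ := hj
  have hle : (N : ℝ) ^ 2 ≤ (p : ℝ) ^ lN p N := by exact_mod_cast le_pow_lN p hp N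
  set l := lN p N
  push_cast at g1 g2
  have q3 : (0 : ℝ) < (p : ℝ) ^ l := by positivity
  have q4 : (0 : ℝ) < (p : ℝ) ^ N := by positivity
  rw [div_le_iff₀ (by positivity), pow_add] at g1
  rw [lt_div_iff₀ (by positivity), pow_add] at g2
  rw [Real.dist_eq, lt_div_iff₀ (by positivity), pow_add] at hxy
  have h1 : nint ((p ^ N : ℕ) * x) ≤ |(p : ℝ) ^ N * x - (j : ℤ)| := by
    unfold nint; push_cast; exact round_le _ _
  refine h1.trans ?_
  have h2 : |(p : ℝ) ^ N * x - (j : ℤ)| * (p : ℝ) ^ l ≤ 3 := by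
    have e : |(p : ℝ) ^ N * x - (j : ℤ)| * (p : ℝ) ^ l =
        |(x - y) * ((p : ℝ) ^ N * (p : ℝ) ^ l) + (y * ((p : ℝ) ^ N * (p : ℝ) ^ l) - (p : ℝ) ^ l * j)| := by
      rw [← abs_of_pos q3, ← abs_mul, abs_of_pos q3]
      congr 1; push_cast; ring
    rw [e]
    refine (abs_add_le _ _).trans ?_
    rw [abs_mul, abs_of_pos (by positivity : 0 < (p : ℝ) ^ N * (p : ℝ) ^ l)]
    have : |y * ((p : ℝ) ^ N * (p : ℝ) ^ l) - (p : ℝ) ^ l * j| ≤ 2 := by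
      rw [abs_le]; constructor <;> linarith
    linarith
  rw [le_div_iff₀ (by positivity)]
  refine le_trans ?_ h2
  gcongr

lemma lower_core {p : ℕ} (hp : p.Prime) {a c x : ℝ} (ha : 0 ≤ a) (ha1 : a < 1) {q k m n : ℕ}
    (hq : q = p ^ k * m) (hm : 1 ≤ m) (hn : 1 ≤ n) (hpn : p ^ n ≤ p ^ k * m ^ 2)
    (h : (m : ℝ) * (Real.log q) ^ (2 - a) * nint (q * x) * (Real.log (2 * (p : ℝ) ^ k)) ^ a
      < c * (Real.log 2 / 2) ^ 2) : nint (q * x) / q < rho p a c n k := by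
  have hp2 := hp.two_le
  have hp0 : (0 : ℝ) < p := by positivity
  have hl2 : 0 < Real.log 2 := Real.log_pos (by norm_num)
  have hlp : Real.log 2 ≤ Real.log p := Real.log_le_log (by norm_num) (by exact_mod_cast hp2)
  have hm0 : (0 : ℝ) < m := by positivity
  have hn0 : (0 : ℝ) < n := by positivity
  have hqR : (q : ℝ) = (p : ℝ) ^ k * m := by rw [hq]; push_cast; rfl
  have hq0 : (0 : ℝ) < q := by rw [hqR]; positivity
  set β := Real.log 2 / 2 with hβ
  have hβ0 : 0 < β := by positivity
  have hpnR : (p : ℝ) ^ n ≤ (p : ℝ) ^ k * (m : ℝ) ^ 2 := by exact_mod_cast hpn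
  have h1 : β * n ≤ Real.log q := by
    have e1 : (p : ℝ) ^ n ≤ (q : ℝ) ^ 2 := by
      refine hpnR.trans ?_
      rw [hqR, mul_pow]
      gcongr
      exact le_self_pow₀ (one_le_pow₀ (by exact_mod_cast hp.one_le)) (by norm_num)
    have e2 := Real.log_le_log (by positivity) e1
    rw [Real.log_pow, Real.log_pow] at e2
    push_cast at e2
    have : (n : ℝ) * Real.log 2 ≤ n * Real.log p := by gcongr
    rw [hβ]; linarith
  have h2 : β * ((k : ℝ) + 1) ≤ Real.log (2 * (p : ℝ) ^ k) := by
    rw [Real.log_mul (by norm_num) (by positivity), Real.log_pow]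
    have : (k : ℝ) * Real.log 2 ≤ k * Real.log p := by gcongr
    rw [hβ]; nlinarith [mul_nonneg (Nat.cast_nonneg k : (0 : ℝ) ≤ k) hl2.le]
  have hni : 0 ≤ nint (q * x) := abs_nonneg _
  have h3 : (β * n) ^ (2 - a) ≤ (Real.log q) ^ (2 - a) :=
    Real.rpow_le_rpow (by positivity) h1 (by linarith)
  have h4 : (β * ((k : ℝ) + 1)) ^ a ≤ (Real.log (2 * (p : ℝ) ^ k)) ^ a :=
    Real.rpow_le_rpow (by positivity) h2 ha
  have h5 : (m : ℝ) * (β * n) ^ (2 - a) * nint (q * x) * (β * ((k : ℝ) + 1)) ^ a < c * β ^ 2 := by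
    refine lt_of_le_of_lt ?_ h
    have : (0 : ℝ) ≤ Real.log q := le_trans (by positivity) h1
    gcongr
  have h6 : β ^ (2 - a) * β ^ a = β ^ 2 := by
    rw [← Real.rpow_add hβ0]; norm_num
  rw [Real.mul_rpow hβ0.le hn0.le, Real.mul_rpow hβ0.le (by positivity)] at h5
  have h7 : (m : ℝ) * nint (q * x) * ((n : ℝ) ^ (2 - a) * ((k : ℝ) + 1) ^ a) < c := by
    have : (m : ℝ) * nint (q * x) * ((n : ℝ) ^ (2 - a) * ((k : ℝ) + 1) ^ a) * β ^ 2 < c * β ^ 2 := by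
      rw [← h6] at h5 ⊢
      refine lt_of_eq_of_lt ?_ h5
      ring
    exact lt_of_mul_lt_mul_right this (by positivity)
  set W := (n : ℝ) ^ (2 - a) * ((k : ℝ) + 1) ^ a with hW
  have hW0 : 0 < W := by positivity
  unfold rho wt
  rw [← hW, lt_div_iff₀ (by positivity), mul_one_div, lt_div_iff₀ hW0]
  refine lt_of_le_of_lt ?_ h7
  have : nint (q * x) / q * (p : ℝ) ^ n ≤ m * nint (q * x) := by
    rw [div_mul_eq_mul_div, div_le_iff₀ hq0, hqR]
    calc _ ≤ nint ((p : ℝ) ^ k * m * x) * ((p : ℝ) ^ k * (m : ℝ) ^ 2) := by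
          gcongr
          exact abs_nonneg _
      _ = _ := by ring
  gcongr

lemma rho_mono {p : ℕ} (hp : 2 ≤ p) {a c : ℝ} (ha : 0 ≤ a) (ha1 : a < 1) (hc : 0 < c)
    {n n' k k' : ℕ} (hn : 1 ≤ n) (h : n ≤ n') (hk : k ≤ k') : rho p a c n' k' ≤ rho p a c n k := by
  have hn0 : (0 : ℝ) < n := by positivity
  have hp1 : (1 : ℝ) ≤ p := by exact_mod_cast (by omega : 1 ≤ p)
  have h1 : (n : ℝ) ≤ n' := by exact_mod_cast h
  have h2 : (k : ℝ) ≤ k' := by exact_mod_cast hk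
  unfold rho wt
  have : 0 ≤ 2 - a := by linarith
  gcongr

lemma nint_pos {x : ℝ} (hx : Irrational x) {q : ℕ} (hq : 1 ≤ q) : 0 < nint (q * x) := by
  unfold nint
  rw [abs_pos, sub_ne_zero]
  have : Irrational ((q : ℝ) * x) := hx.natCast_mul (by omega)
  exact this.ne_int _

lemma nint_delta {x : ℝ} (hx : Irrational x) (Q : ℕ) :
    ∃ δ > 0, ∀ q : ℕ, 1 ≤ q → q < Q → δ ≤ nint (q * x) := by
  induction Q with
  | zero => exact ⟨1, one_pos, fun q _ h => by omega⟩
  | succ Q ih =>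
    obtain ⟨δ, h0, h⟩ := ih
    rcases Nat.eq_zero_or_pos Q with rfl | hQ
    · exact ⟨1, one_pos, fun q _ h => by omega⟩
    refine ⟨min δ (nint (Q * x)), lt_min h0 (nint_pos hx hQ), fun q h1 h2 => ?_⟩
    rcases Nat.lt_succ_iff_lt_or_eq.1 h2 with h3 | rfl
    · exact (min_le_left _ _).trans (h q h1 h3)
    · exact min_le_right _ _

lemma uq_eq {p : ℕ} (hp : p.Prime) (a x : ℝ) {q k m : ℕ} (hq : q = p ^ k * m) (hm : ¬ p ∣ m) :
    (q : ℝ) * (Real.log q) ^ (2 - a) * nint (q * x) * pabs p q * (Real.log (2 / pabs p q)) ^ a =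
    (m : ℝ) * (Real.log q) ^ (2 - a) * nint (q * x) * (Real.log (2 * (p : ℝ) ^ k)) ^ a := by
  haveI := Fact.mk hp
  have hm0 : m ≠ 0 := by rintro rfl; simp at hm
  have hp0 : (p : ℝ) ≠ 0 := by exact_mod_cast hp.ne_zero
  have hv : padicValNat p q = k := by
    rw [hq, padicValNat.mul (pow_ne_zero _ hp.ne_zero) hm0, padicValNat.prime_pow,
      padicValNat.eq_zero_of_not_dvd hm, add_zero]
  have hpa : pabs p q = ((p : ℝ) ^ k)⁻¹ := by
    unfold pabs; rw [hv, zpow_neg, zpow_natCast]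
  rw [hpa, div_inv_eq_mul]
  have hqR : (q : ℝ) = (p : ℝ) ^ k * m := by rw [hq]; push_cast; rfl
  have : (q : ℝ) * ((p : ℝ) ^ k)⁻¹ = m := by rw [hqR]; field_simp
  calc _ = ((q : ℝ) * ((p : ℝ) ^ k)⁻¹) * (Real.log q) ^ (2 - a) * nint (q * x) *
      (Real.log (2 * (p : ℝ) ^ k)) ^ a := by ring
    _ = _ := by rw [this]

lemma upper_core {p : ℕ} (hp : p.Prime) {a x : ℝ} (ha : 0 ≤ a) (ha1 : a < 1) {N : ℕ} (hN : 1 ≤ N)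
    (h : nint ((p ^ N : ℕ) * x) ≤ 3 / (N : ℝ) ^ 2) :
    ((p ^ N : ℕ) : ℝ) * (Real.log (p ^ N : ℕ)) ^ (2 - a) * nint ((p ^ N : ℕ) * x) * pabs p (p ^ N) *
      (Real.log (2 / pabs p (p ^ N))) ^ a ≤ 3 * (2 * Real.log p) ^ 2 := by
  have hp2 := hp.two_le
  have hp0 : (0 : ℝ) < p := by positivity
  have hN0 : (0 : ℝ) < N := by positivity
  have hN1 : (1 : ℝ) ≤ N := by exact_mod_cast hN
  have hl2 : 0 < Real.log 2 := Real.log_pos (by norm_num)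
  have hlp : Real.log 2 ≤ Real.log p := Real.log_le_log (by norm_num) (by exact_mod_cast hp2)
  have hlp0 : 0 < Real.log p := hl2.trans_le hlp
  rw [uq_eq hp a x (mul_one (p ^ N)).symm (by simpa using hp.one_lt.ne')]
  have h1 : (Real.log (p ^ N : ℕ)) ^ (2 - a) ≤ ((2 * Real.log p) * N) ^ (2 - a) := by
    apply Real.rpow_le_rpow
    · push_cast; rw [Real.log_pow]; positivity
    · push_cast; rw [Real.log_pow]; nlinarith
    · linarith
  have h2 : (Real.log (2 * (p : ℝ) ^ N)) ^ a ≤ ((2 * Real.log p) * N) ^ a := by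
    have e : Real.log (2 * (p : ℝ) ^ N) = Real.log 2 + N * Real.log p := by
      rw [Real.log_mul (by norm_num) (by positivity), Real.log_pow]
    apply Real.rpow_le_rpow
    · rw [e]; positivity
    · rw [e]; nlinarith
    · exact ha
  have h3 : 0 ≤ nint ((p ^ N : ℕ) * x) := abs_nonneg _
  have h4 : ((2 * Real.log p) * N) ^ (2 - a) * ((2 * Real.log p) * N) ^ a
      = ((2 * Real.log p) * N) ^ 2 := by
    rw [← Real.rpow_add (by positivity)]; norm_num
  have h5 : 0 ≤ Real.log (2 * (p : ℝ) ^ N) := by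
    rw [Real.log_mul (by norm_num) (by positivity), Real.log_pow]; positivity
  calc _ ≤ ((1 : ℕ) : ℝ) * ((2 * Real.log p) * N) ^ (2 - a) * (3 / (N : ℝ) ^ 2) *
        ((2 * Real.log p) * N) ^ a := by
        gcongr
    _ = (3 / (N : ℝ) ^ 2) * (((2 * Real.log p) * N) ^ (2 - a) * ((2 * Real.log p) * N) ^ a) := by
        push_cast; ring
    _ = _ := by rw [h4]; field_simp

lemma lower_all {p : ℕ} (hp : p.Prime) {a c x : ℝ} (ha : 0 ≤ a) (ha1 : a < 1) (hc : 0 < c)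
    (hx : Irrational x) {ns : ℕ} (hns : 1 ≤ ns) (hB : ∀ n ≥ ns, x ∉ Bo p a c n) :
    ∀ᶠ q : ℕ in atTop, c * (Real.log 2 / 2) ^ 2 ≤ (q : ℝ) * (Real.log q) ^ (2 - a) * nint (q * x) *
      pabs p q * (Real.log (2 / pabs p q)) ^ a := by
  obtain ⟨δ, hδ, hd⟩ := nint_delta hx (p ^ ns)
  have hp2 := hp.two_le
  obtain ⟨Q, hQ⟩ := exists_nat_gt ((p : ℝ) ^ ns / δ)
  filter_upwards [eventually_ge_atTop (Q + 1)] with q hq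
  by_contra hlt
  rw [not_le] at hlt
  have hq1 : 1 ≤ q := by omega
  obtain ⟨k, m, hm, hqe⟩ := Nat.exists_eq_pow_mul_and_not_dvd (n := q) (by omega) p hp.ne_one
  rw [uq_eq hp a x hqe hm] at hlt
  have hm1 : 1 ≤ m := by
    rcases Nat.eq_zero_or_pos m with rfl | h
    · simp at hm
    · exact h
  set r := round ((q : ℝ) * x) with hr
  -- reduce
  obtain ⟨g, hg0, r0, q0, hrg, hqg, hcop⟩ : ∃ g : ℕ, 0 < g ∧ ∃ (r0 : ℤ) (q0 : ℕ), r = r0 * g ∧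
      q = q0 * g ∧ IsCoprime r0 (q0 : ℤ) := by
    have hgpos : 0 < Int.gcd r q := Int.gcd_pos_of_ne_zero_right _ (by exact_mod_cast (by omega))
    refine ⟨Int.gcd r q, hgpos, r / Int.gcd r q, q / Int.gcd r q, ?_, ?_, ?_⟩
    · exact (Int.ediv_mul_cancel (Int.gcd_dvd_left ..)).symm
    · refine (Nat.div_mul_cancel ?_).symm
      exact_mod_cast (Int.gcd_dvd_right r q)
    · rw [Int.isCoprime_iff_gcd_eq_one]
      have := Int.gcd_div_gcd_div_gcd (i := r) (j := q) hgpos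
      push_cast
      exact this
  have hq01 : 1 ≤ q0 := by
    rcases Nat.eq_zero_or_pos q0 with rfl | h
    · omega
    · exact h
  obtain ⟨k0, m0, hm0, hq0e⟩ := Nat.exists_eq_pow_mul_and_not_dvd (n := q0) (by omega) p hp.ne_one
  have hm01 : 1 ≤ m0 := by
    rcases Nat.eq_zero_or_pos m0 with rfl | h
    · simp at hm0
    · exact h
  have hdv : q0 ∣ q := ⟨g, hqg⟩
  rw [hq0e, hqe] at hdv
  have hk : k0 ≤ k := by
    have h1 : p ^ k0 ∣ p ^ k * m := (dvd_mul_right _ _).trans hdv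
    have h2 : (p ^ k0).Coprime m := Nat.Coprime.pow_left _ ((hp.coprime_iff_not_dvd).2 hm)
    exact (Nat.pow_dvd_pow_iff_le_right hp.one_lt).1 (h2.dvd_of_dvd_mul_right h1)
  have hmm : m0 ≤ m := by
    have h1 : m0 ∣ p ^ k * m := (dvd_mul_left _ _).trans hdv
    have h2 : m0.Coprime (p ^ k) := (Nat.Coprime.pow_left _ ((hp.coprime_iff_not_dvd).2 hm0)).symm
    exact Nat.le_of_dvd hm1 (h2.dvd_of_dvd_mul_left h1)
  set n0 := Nat.log p (p ^ k0 * m0 ^ 2) with hn0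
  set n := Nat.log p (p ^ k * m ^ 2) with hn
  have hpk : ∀ i, 1 ≤ p ^ i := fun i => Nat.one_le_pow _ _ hp.pos
  have hnn : n0 ≤ n := by
    apply Nat.log_mono_right
    exact Nat.mul_le_mul (Nat.pow_le_pow_right hp.pos hk) (Nat.pow_le_pow_left hmm 2)
  have hb0 : p ^ n0 ≤ p ^ k0 * m0 ^ 2 := Nat.pow_log_le_self p (by positivity)
  have hb1 : p ^ k0 * m0 ^ 2 < p ^ (n0 + 1) := Nat.lt_pow_succ_log_self hp.one_lt _
  have hb2 : p ^ n ≤ p ^ k * m ^ 2 := Nat.pow_log_le_self p (by positivity)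
  have hqR : (q : ℝ) = q0 * g := by rw [hqg]; push_cast; rfl
  have hrR : (r : ℝ) = r0 * g := by rw [hrg]; push_cast; rfl
  have hgR : (0 : ℝ) < g := by exact_mod_cast hg0
  have hq0R : (0 : ℝ) < q0 := by exact_mod_cast hq01
  have hqRp : (0 : ℝ) < q := by exact_mod_cast hq1
  have hdist : |x - r0 / q0| = nint (q * x) / q := by
    unfold nint
    rw [← hr, eq_div_iff hqRp.ne', ← abs_of_pos hqRp, ← abs_mul, abs_of_pos hqRp]
    congr 1
    rw [hrR, hqR]; field_simp
  by_cases hcase : ns ≤ n0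
  · have h1 := lower_core hp ha ha1 hqe hm1 (by omega) hb2 hlt
    have h2 := rho_mono hp2 ha ha1 hc (by omega : 1 ≤ n0) hnn hk
    apply hB n0 hcase
    unfold Bo
    simp only [mem_iUnion]
    refine ⟨k0, ?_, (r0, m0), ⟨hm0, hb0, hb1, ?_⟩, ?_⟩
    · rw [Finset.mem_range]
      have : k0 ≤ n0 := Nat.le_log_of_pow_le hp.one_lt (Nat.le_mul_of_pos_right _ (by positivity))
      omega
    · show IsCoprime r0 ((p ^ k0 * m0 : ℕ) : ℤ)
      rw [← hq0e]; exact hcop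
    · rw [Metric.mem_ball, Real.dist_eq]
      have : ((p : ℝ) ^ k0 * m0) = q0 := by rw [hq0e]; push_cast; rfl
      show |x - r0 / ((p : ℝ) ^ k0 * m0)| < _
      rw [this, hdist]
      exact h1.trans_le h2
  · have hlt0 : q0 < p ^ ns := by
      have e1 : q0 ≤ p ^ k0 * m0 ^ 2 := by
        rw [hq0e]; exact Nat.mul_le_mul_left _ (Nat.le_self_pow (by norm_num) _)
      have e2 : p ^ (n0 + 1) ≤ p ^ ns := Nat.pow_le_pow_right hp.pos (by omega)
      omega
    have h1 := hd q0 hq01 hlt0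
    have h2 : nint (q0 * x) ≤ |(q0 : ℝ) * x - r0| := round_le _ _
    have h3 : |(q0 : ℝ) * x - r0| = q0 * |x - r0 / q0| := by
      rw [← abs_of_pos hq0R, ← abs_mul, abs_of_pos hq0R]
      congr 1; field_simp
    have h4 : nint (q * x) ≤ 1 := by
      have := abs_sub_round ((q : ℝ) * x)
      unfold nint; linarith
    rw [h3, hdist] at h2
    have h5 : (q0 : ℝ) ≤ (p : ℝ) ^ ns := by exact_mod_cast hlt0.le
    have h6 : (q0 : ℝ) * (nint (q * x) / q) ≤ (p : ℝ) ^ ns * (1 / q) := by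
      gcongr
      exact div_nonneg (abs_nonneg _) hqRp.le
    have h7 : (p : ℝ) ^ ns < Q * δ := (div_lt_iff₀ hδ).1 hQ
    have h8 : (Q : ℝ) ≤ q := by exact_mod_cast (by omega : Q ≤ q)
    have h9 : δ ≤ (p : ℝ) ^ ns * (1 / q) := h1.trans (h2.trans h6)
    rw [mul_one_div, le_div_iff₀ hqRp] at h9
    nlinarith

lemma liminf_mem {p : ℕ} (hp : p.Prime) {a c x : ℝ} (ha : 0 ≤ a) (ha1 : a < 1) (hc : 0 < c)
    (hx : Irrational x) {ns : ℕ} (hns : 1 ≤ ns) (hB : ∀ n ≥ ns, x ∉ Bo p a c n)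
    (hF : ∀ N0 : ℕ, ∃ N ≥ N0, nint ((p ^ N : ℕ) * x) ≤ 3 / (N : ℝ) ^ 2) :
    0 < atTop.liminf (fun q : ℕ => (q : ℝ) * (Real.log q) ^ (2 - a) * nint (q * x) * pabs p q *
      (Real.log (2 / pabs p q)) ^ a) := by
  have hl := lower_all hp ha ha1 hc hx hns hB
  have hl2 : 0 < Real.log 2 := Real.log_pos (by norm_num)
  refine lt_of_lt_of_le (by positivity : 0 < c * (Real.log 2 / 2) ^ 2) ?_
  refine Filter.le_liminf_of_le ?_ hl
  apply Filter.IsCoboundedUnder.of_frequently_le (a := 3 * (2 * Real.log p) ^ 2)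
  rw [Filter.frequently_atTop]
  intro q
  obtain ⟨N, hN, h⟩ := hF (q + 1)
  refine ⟨p ^ N, ?_, upper_core hp ha ha1 (by omega) h⟩
  have : N < p ^ N := Nat.lt_pow_self hp.one_lt
  omega

theorem stmt_9 (a : ℝ) (ha : 0 ≤ a) (ha1 : a < 1) (p : ℕ) (hp : p.Prime) : dimH {α : ℝ | 0 < atTop.liminf (fun q : ℕ => (q : ℝ) * (Real.log q) ^ (2 - a) * nint (q * α) * pabs p q * (Real.log (2 / pabs p q)) ^ a)} = 1 := by
  set S := {α : ℝ | 0 < atTop.liminf (fun q : ℕ => (q : ℝ) * (Real.log q) ^ (2 - a) * nint (q * α) * pabs p q * (Real.log (2 / pabs p q)) ^ a)} with hS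
  apply le_antisymm
  · rw [← Real.dimH_univ]; exact dimH_mono (subset_univ _)
  by_contra hlt
  rw [not_le] at hlt
  have hp2 := hp.two_le
  have hp0 : (0 : ℝ) < p := by positivity
  have hp1 : (1 : ℝ) < p := by exact_mod_cast hp.one_lt
  obtain ⟨s, hs, hs1'⟩ := ENNReal.lt_iff_exists_nnreal_btwn.1 hlt
  have hs1 : (s : ℝ) < 1 := by exact_mod_cast hs1'
  have hs0 : (0 : ℝ) < s := by
    have : (0 : ENNReal) < s := lt_of_le_of_lt zero_le hs
    exact_mod_cast this
  have hS' : Measure.hausdorffMeasure (s : ℝ) (S ∪ Set.range ((↑) : ℚ → ℝ)) = 0 := by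
    apply hausdorffMeasure_of_dimH_lt
    rw [dimH_union, dimH_countable (countable_range _)]
    exact max_lt hs (lt_of_le_of_lt zero_le hs)
  set D := (p : ℝ) * (2 / (1 - a)) with hD
  have h1a : 0 < 1 - a := by linarith
  have hD2 : 2 * (p : ℝ) ≤ D := by
    rw [hD, mul_comm]
    gcongr
    rw [le_div_iff₀ h1a]; linarith
  have hDpos : 0 < D := by linarith
  set c := 1 / (192 * D) with hc
  have hc0 : 0 < c := by positivity
  have hcD : c * (192 * D) = 1 := by rw [hc]; field_simp
  have hcp : c * (12 * p * (2 / (1 - a))) ≤ 1 / 16 := by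
    have : c * (12 * p * (2 / (1 - a))) = c * (192 * D) / 16 := by rw [hD]; ring
    rw [this, hcD]
  have hc2 : c * (2 * p) ≤ 1 := by nlinarith
  have hc4 : c ≤ 1 / 4 := by nlinarith
  set θ := (p : ℝ) ^ ((s : ℝ) - 1) with hθ
  have hθ0 : 0 < θ := by positivity
  have hθ1 : θ < 1 := Real.rpow_lt_one_of_one_lt_of_neg hp1 (by linarith)
  obtain ⟨I0, hI0⟩ := ev_small (48 * p) 2 hθ0 hθ1 one_pos
  obtain ⟨H0, hH0⟩ := eventually_atTop.1 HH_half
  obtain ⟨n1, hn1⟩ := exists_nat_gt (1 / c)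
  set ns := I0 + H0 + n1 + 2 with hns
  have hcn : ∀ n ≥ ns, 1 ≤ c * n := by
    intro n hn
    have h1 : (n1 : ℝ) ≤ n := by exact_mod_cast (by omega : n1 ≤ n)
    have h2 := (div_lt_iff₀ hc0).1 (hn1.trans_le h1)
    linarith
  obtain ⟨U, hUo, hUc, hUm⟩ := cover hp2 hs0 hs1 hS' ns
  obtain ⟨x, hx1, hx2⟩ := exists_limit (p := p) (ns := ns) hp2 (B := Bt p a c)
    (U := fun n => Sat p (LL n) (U n)) (F := FF p) (C := 6 * p) (θ := θ) (by positivity) hθ0 hθ1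
    (by omega) (fun n hn => hH0 n (by omega)) (fun n => sat_simp p _ _) (fun n => sat_simp p _ _)
    (fun n hn j hj G hG hG1 => Bt_local hp2 ha ha1 hc0 hc4 hcp (by omega) (hcn n hn) hj hG hG1)
    (fun n _ => hUm n) (fun N => FF_simp p N)
    (fun N hN G hG hG1 => FF_ind hp2 (by omega) hG hG1)
    (fun n hn N hN => Bt_FF hp ha ha1 hc0 hc2 hcp (by omega) (hcn n hn) (by omega))
    (fun n hn => by have := hI0 n (by omega); linarith)
    (Bo p a c) U (fun n => Bo_open p a c n) hUo (fun n => subset_sat p _ _)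
    (fun n => subset_sat p _ _)
  have hxn : x ∉ S ∪ Set.range ((↑) : ℚ → ℝ) := by
    intro h
    obtain ⟨n, hn, hxU⟩ := hUc x h
    exact (hx1 n hn).2 hxU
  have hirr : Irrational x := fun h => hxn (Or.inr h)
  apply hxn
  left
  refine liminf_mem hp ha ha1 hc0 hirr (by omega : 1 ≤ ns) (fun n hn => (hx1 n hn).1) ?_
  intro N0
  obtain ⟨N, hN, h⟩ := hx2 (N0 + 2)
  exact ⟨N, by omega, FF_closure hp2 (by omega) h⟩
end

section
/- For almost every pair (α, β) of real numbers (with respect to Lebesgue measure on ℝ²), liminf_{q→∞} q·(log q)²·‖qα‖·‖qβ‖ = 0. -/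
open Filter

open MeasureTheory

lemma ks_aux {Ω : Type*} [MeasurableSpace Ω] (μ : Measure Ω) [IsFiniteMeasure μ]
    (E : ℕ → Set Ω) (hE : ∀ n, MeasurableSet (E n)) (F : Finset ℕ) (U : Set Ω)
    (hU : MeasurableSet U) (hEU : ∀ n ∈ F, E n ⊆ U) (t : ℝ) :
    2 * t * ∑ n ∈ F, μ.real (E n) - t ^ 2 * μ.real U ≤
      ∑ m ∈ F, ∑ n ∈ F, μ.real (E m ∩ E n) := by
  have hi : ∀ s : Set Ω, MeasurableSet s → Integrable (s.indicator (fun _ => (1:ℝ))) μ :=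
    fun s hs => (integrable_const (1:ℝ)).indicator hs
  have hv : ∀ s : Set Ω, MeasurableSet s → ∫ x, s.indicator (fun _ => (1:ℝ)) x ∂μ = μ.real s := by
    intro s hs
    rw [integral_indicator hs]; simp
  have key : ∀ x, 2 * t * ∑ n ∈ F, (E n).indicator (fun _ => (1:ℝ)) x
      - t ^ 2 * U.indicator (fun _ => (1:ℝ)) x ≤
      ∑ m ∈ F, ∑ n ∈ F, (E m ∩ E n).indicator (fun _ => (1:ℝ)) x := by
    intro x
    have h1 : ∀ m n, (E m ∩ E n).indicator (fun _ => (1:ℝ)) x =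
        (E m).indicator (fun _ => (1:ℝ)) x * (E n).indicator (fun _ => (1:ℝ)) x := by
      intro m n
      by_cases hm : x ∈ E m <;> by_cases hn : x ∈ E n <;> simp [hm, hn]
    simp_rw [h1, ← Finset.mul_sum, ← Finset.sum_mul]
    by_cases hx : x ∈ U
    · simp only [Set.indicator_of_mem hx]
      nlinarith [sq_nonneg (∑ n ∈ F, (E n).indicator (fun _ => (1:ℝ)) x - t)]
    · have : ∑ n ∈ F, (E n).indicator (fun _ => (1:ℝ)) x = 0 := by
        apply Finset.sum_eq_zero
        intro n hn
        exact Set.indicator_of_notMem (fun h => hx (hEU n hn h)) _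
      simp [this, hx]
  have hI1 : Integrable (fun x => ∑ n ∈ F, (E n).indicator (fun _ => (1:ℝ)) x) μ :=
    integrable_finsetSum _ (fun n _ => hi _ (hE n))
  have hI2 : Integrable (fun x => ∑ m ∈ F, ∑ n ∈ F, (E m ∩ E n).indicator (fun _ => (1:ℝ)) x) μ :=
    integrable_finsetSum _ (fun m _ => integrable_finsetSum _
      (fun n _ => hi _ ((hE m).inter (hE n))))
  have h := integral_mono ((hI1.const_mul (2 * t)).sub ((hi U hU).const_mul (t^2))) hI2 key
  have e1 : ∫ x, (∑ m ∈ F, ∑ n ∈ F, (E m ∩ E n).indicator (fun _ => (1:ℝ)) x) ∂μ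
      = ∑ m ∈ F, ∑ n ∈ F, μ.real (E m ∩ E n) := by
    rw [integral_finsetSum _ (fun m _ => integrable_finsetSum _
      (fun n _ => hi _ ((hE m).inter (hE n))))]
    refine Finset.sum_congr rfl fun m _ => ?_
    rw [integral_finsetSum _ (fun n _ => hi _ ((hE m).inter (hE n)))]
    exact Finset.sum_congr rfl fun n _ => hv _ ((hE m).inter (hE n))
  have e2 : ∫ x, (2 * t * ∑ n ∈ F, (E n).indicator (fun _ => (1:ℝ)) x
      - t ^ 2 * U.indicator (fun _ => (1:ℝ)) x) ∂μ
      = 2 * t * ∑ n ∈ F, μ.real (E n) - t ^ 2 * μ.real U := by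
    rw [integral_sub (hI1.const_mul (2 * t)) ((hi U hU).const_mul (t^2)),
      integral_const_mul, integral_const_mul, hv U hU,
      integral_finsetSum _ (fun n _ => hi _ (hE n))]
    congr 2
    exact Finset.sum_congr rfl fun n _ => hv _ (hE n)
  rw [e1] at h
  rw [← e2]
  exact h

lemma kochen_stone {Ω : Type*} [MeasurableSpace Ω] (μ : Measure Ω) [IsFiniteMeasure μ]
    (E : ℕ → Set Ω) (hE : ∀ n, MeasurableSet (E n)) (w : ℕ → ℝ) (hw : ∀ n, 0 ≤ w n)
    (C c : ℝ) (hC : 0 < C) (hc : 0 < c)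
    (h1 : ∀ n, μ.real (E n) ≤ C * w n)
    (h2 : ∀ m n, m ≠ n → μ.real (E m ∩ E n) ≤ C * (w m * w n))
    (h3 : ∀ T : ℝ, ∃ N : ℕ, T ≤ ∑ n ∈ Finset.range N, w n ∧
      c * ∑ n ∈ Finset.range N, w n ≤ ∑ n ∈ Finset.range N, μ.real (E n)) :
    ENNReal.ofReal (c ^ 2 / (8 * C)) ≤ μ {x | ∃ᶠ n in atTop, x ∈ E n} := by
  have hset : {x | ∃ᶠ n in atTop, x ∈ E n} = ⋂ m : ℕ, ⋃ n ∈ {n : ℕ | m ≤ n}, E n := by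
    ext x
    simp [frequently_atTop]
  have hUm : ∀ m : ℕ, MeasurableSet (⋃ n ∈ {n : ℕ | m ≤ n}, E n) := fun m =>
    MeasurableSet.biUnion (Set.to_countable _) (fun n _ => hE n)
  have hanti : Antitone fun m : ℕ => ⋃ n ∈ {n : ℕ | m ≤ n}, E n := by
    intro a b hab
    exact Set.biUnion_subset_biUnion_left (fun n hn => le_trans hab hn)
  rw [hset]
  refine ge_of_tendsto (tendsto_measure_iInter_atTop (fun m => (hUm m).nullMeasurableSet) hanti
    ⟨0, measure_ne_top _ _⟩) (Eventually.of_forall fun m => ?_)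
  refine ENNReal.ofReal_le_of_le_toReal ?_
  change _ ≤ μ.real _
  set u := μ.real (⋃ n ∈ {n : ℕ | m ≤ n}, E n) with hu
  obtain ⟨N, hN1, hN2⟩ := h3 (max 1 (2 * C * (∑ n ∈ Finset.range m, w n) / c))
  set W := ∑ n ∈ Finset.range N, w n
  set Wm := ∑ n ∈ Finset.range m, w n
  have hW1 : 1 ≤ W := le_trans (le_max_left _ _) hN1
  have hW2 : 2 * C * Wm ≤ W * c := by
    rw [← div_le_iff₀ hc]; exact le_trans (le_max_right _ _) hN1
  set F := Finset.range N \ Finset.range m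
  have hk := ks_aux μ E hE F (⋃ n ∈ {n : ℕ | m ≤ n}, E n) (hUm m) (by
    intro n hn
    have : m ≤ n := by simpa [F] using (Finset.mem_sdiff.1 hn).2
    exact Set.subset_biUnion_of_mem (u := E) (show n ∈ {n : ℕ | m ≤ n} from this)) (4 * C / c * W)
  rw [← hu] at hk
  have hM : c / 2 * W ≤ ∑ n ∈ F, μ.real (E n) := by
    have a1 : ∑ n ∈ Finset.range N, μ.real (E n) ≤
        ∑ n ∈ F, μ.real (E n) + ∑ n ∈ Finset.range m, μ.real (E n) := by
      rw [← Finset.sum_union Finset.sdiff_disjoint]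
      apply Finset.sum_le_sum_of_subset_of_nonneg
      · intro n hn; simp only [Finset.mem_union, Finset.mem_sdiff]; tauto
      · intros; exact measureReal_nonneg
    have a2 : ∑ n ∈ Finset.range m, μ.real (E n) ≤ C * Wm := by
      rw [Finset.mul_sum]; exact Finset.sum_le_sum fun n _ => h1 n
    nlinarith
  have hWF : ∑ n ∈ F, w n ≤ W :=
    Finset.sum_le_sum_of_subset_of_nonneg Finset.sdiff_subset (fun n _ _ => hw n)
  have hWF0 : 0 ≤ ∑ n ∈ F, w n := Finset.sum_nonneg fun n _ => hw n
  have hQ : ∑ m ∈ F, ∑ n ∈ F, μ.real (E m ∩ E n) ≤ 2 * C * W ^ 2 := by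
    have b1 : ∀ a ∈ F, ∑ n ∈ F, μ.real (E a ∩ E n) ≤ C * w a * (∑ n ∈ F, w n) + C * w a := by
      intro a ha
      have : ∀ n ∈ F, μ.real (E a ∩ E n) ≤ C * w a * w n + if n = a then C * w a else 0 := by
        intro n _
        split_ifs with hna
        · subst hna
          rw [Set.inter_self]
          have := h1 n
          have := mul_nonneg (mul_nonneg hC.le (hw n)) (hw n)
          linarith
        · have := h2 a n (Ne.symm hna)
          linarith
      refine (Finset.sum_le_sum this).trans ?_
      rw [Finset.sum_add_distrib, Finset.sum_ite_eq' F a, if_pos ha, ← Finset.mul_sum]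
    refine (Finset.sum_le_sum b1).trans ?_
    rw [Finset.sum_add_distrib, ← Finset.sum_mul, ← Finset.mul_sum]
    have : (∑ n ∈ F, w n) * (∑ n ∈ F, w n) ≤ W * W := by gcongr
    have : W ≤ W * W := by nlinarith
    nlinarith
  have hk2 : 2 * (4 * C / c * W) * (c / 2 * W) - (4 * C / c * W) ^ 2 * u ≤ 2 * C * W ^ 2 := by
    have : 2 * (4 * C / c * W) * (c / 2 * W) ≤ 2 * (4 * C / c * W) * ∑ n ∈ F, μ.real (E n) := by
      gcongr
    linarith
  have e : 2 * (4 * C / c * W) * (c / 2 * W) = 4 * C * W ^ 2 := by field_simp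
  rw [e] at hk2
  have hWW : 0 < C * W ^ 2 := by positivity
  have e3 : (4 * C / c * W) ^ 2 * u = (C * W ^ 2) * (16 * C / c ^ 2 * u) := by ring
  rw [e3] at hk2
  have h5 : 2 ≤ 16 * C / c ^ 2 * u := by
    by_contra hcon
    push Not at hcon
    nlinarith
  rw [div_le_iff₀ (by positivity)]
  have : 16 * C / c ^ 2 * u * c ^ 2 = 16 * C * u := by field_simp
  nlinarith [mul_le_mul_of_nonneg_right h5 (sq_nonneg c)]

lemma count_pairs (q r : ℕ) (hq : 0 < q) (X : ℝ) (hX : 0 ≤ X) (P : Finset (ℕ × ℕ))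
    (hP : ∀ p ∈ P, p.1 < q ∧ (p.1 * r : ℤ) - p.2 * q ≠ 0 ∧
      |((p.1 * r : ℤ) - p.2 * q : ℝ)| < X) : (P.card : ℝ) ≤ 2 * X := by
  obtain ⟨d, q', r', hd, hcop, hq', hr'⟩ := Nat.exists_coprime' (m := q) (n := r)
    (Nat.gcd_pos_of_pos_left _ hq)
  have hq'0 : 0 < q' := Nat.pos_of_ne_zero (by rintro rfl; simp at hq'; omega)
  have hdR : (0:ℝ) < d := by exact_mod_cast hd
  set M : ℕ := ⌊X / d⌋₊
  have hcard : P.card ≤ (((Finset.Icc (-(M:ℤ)) M).erase 0) ×ˢ Finset.range d).card := by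
    refine Finset.card_le_card_of_injOn
      (fun p => ((p.1 * r' : ℤ) - p.2 * q', p.1 / q')) ?_ ?_
    · intro p hp
      obtain ⟨h1, h2, h3⟩ := hP p hp
      have e : ((p.1 * r : ℤ) - p.2 * q) = d * ((p.1 * r' : ℤ) - p.2 * q') := by
        rw [hq', hr']; push_cast; ring
      have e' : ((p.1 * r : ℤ) - p.2 * q : ℝ) = d * (((p.1 * r' : ℤ) - p.2 * q' : ℤ) : ℝ) := by
        have := congrArg (Int.cast : ℤ → ℝ) e
        push_cast at this ⊢
        exact this
      simp only [Finset.coe_product, Set.mem_prod, Finset.mem_coe, Finset.mem_erase,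
        Finset.mem_Icc, Finset.mem_range]
      refine ⟨⟨?_, ?_⟩, ?_⟩
      · intro h0
        rw [e, h0] at h2
        simp at h2
      · rw [← abs_le]
        rw [e', abs_mul, abs_of_pos hdR, mul_comm, ← lt_div_iff₀ hdR, ← Int.cast_abs] at h3
        set z := |((p.1 * r' : ℤ) - p.2 * q')|
        have hz : 0 ≤ z := abs_nonneg _
        have : z.toNat ≤ M := by
          apply Nat.le_floor
          have : ((z.toNat : ℤ) : ℝ) = z := by rw [Int.toNat_of_nonneg hz]
          rw [← Int.cast_natCast, this]
          exact h3.le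
        omega
      · rw [Nat.div_lt_iff_lt_mul hq'0]
        rw [hq'] at h1
        linarith [mul_comm d q']
    · intro p hp p2 hp2 hpp
      simp only [Prod.mk.injEq] at hpp
      obtain ⟨g1, g2⟩ := hpp
      have hdvd : (q' : ℤ) ∣ ((p.1 : ℤ) - p2.1) * r' := ⟨(p.2 : ℤ) - p2.2, by linarith⟩
      have hdvd2 : (q' : ℤ) ∣ ((p.1 : ℤ) - p2.1) :=
        (Nat.isCoprime_iff_coprime.2 hcop).dvd_of_dvd_mul_right hdvd
      have hmod : p2.1 ≡ p.1 [MOD q'] := (Nat.modEq_iff_dvd).2 hdvd2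
      have ha : p.1 = p2.1 := by
        rw [← Nat.div_add_mod p.1 q', ← Nat.div_add_mod p2.1 q', g2]
        rw [show p2.1 % q' = p.1 % q' from hmod]
      have hb : p.2 = p2.2 := by
        rw [ha] at g1
        have : (p.2 : ℤ) * q' = p2.2 * q' := by linarith
        have := mul_right_cancel₀ (by exact_mod_cast hq'0.ne') this
        exact_mod_cast this
      exact Prod.ext ha hb
  have hc2 : (((Finset.Icc (-(M:ℤ)) M).erase 0) ×ˢ Finset.range d).card = 2 * M * d := by
    rw [Finset.card_product, Finset.card_erase_of_mem (by simp), Finset.card_range, Int.card_Icc]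
    congr 1
    omega
  rw [hc2] at hcard
  have hM : (M : ℝ) ≤ X / d := Nat.floor_le (by positivity)
  rw [le_div_iff₀ hdR] at hM
  have : (P.card : ℝ) ≤ 2 * M * d := by exact_mod_cast hcard
  linarith

/-- reals in the unit interval close to a reduced fraction with denominator `q` -/
def Cs (q : ℕ) (δ : ℝ) : Set ℝ :=
  ⋃ a ∈ (Finset.range q).filter (fun a => q.Coprime a), Set.Ioo (((a:ℝ) - δ) / q) ((a + δ) / q)

lemma Cs_measurable (q : ℕ) (δ : ℝ) : MeasurableSet (Cs q δ) :=
  Finset.measurableSet_biUnion _ fun _ _ => measurableSet_Ioo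

lemma Cs_mono (q : ℕ) {δ δ' : ℝ} (h : δ ≤ δ') : Cs q δ ⊆ Cs q δ' := by
  refine Set.iUnion₂_mono fun a _ => Set.Ioo_subset_Ioo ?_ ?_ <;> gcongr

lemma mem_Cs {q : ℕ} {δ x : ℝ} (hq : 0 < q) (h : x ∈ Cs q δ) :
    ∃ a : ℕ, a < q ∧ q.Coprime a ∧ |q * x - a| < δ := by
  simp only [Cs, Set.mem_iUnion, Finset.mem_filter, Finset.mem_range, Set.mem_Ioo] at h
  obtain ⟨a, ⟨h1, h2⟩, h3, h4⟩ := h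
  have hq' : (0:ℝ) < q := by exact_mod_cast hq
  rw [div_lt_iff₀ hq'] at h3
  rw [lt_div_iff₀ hq'] at h4
  exact ⟨a, h1, h2, by rw [abs_lt]; constructor <;> linarith⟩

lemma Cs_subset {q : ℕ} (hq : 2 ≤ q) {δ : ℝ} (hδ : δ ≤ 1) : Cs q δ ⊆ Set.Ioc 0 1 := by
  intro x hx
  obtain ⟨a, h1, h2, h3⟩ := mem_Cs (by omega) hx
  have ha : 1 ≤ a := by
    rcases Nat.eq_zero_or_pos a with rfl | h
    · simp at h2; omega
    · exact h
  rw [abs_lt] at h3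
  have hq' : (0:ℝ) < q := by exact_mod_cast (by omega : 0 < q)
  have ha' : (1:ℝ) ≤ a := by exact_mod_cast ha
  have ha2 : (a:ℝ) + 1 ≤ q := by exact_mod_cast h1
  constructor
  · by_contra hcon
    push Not at hcon
    nlinarith
  · by_contra hcon
    push Not at hcon
    nlinarith

lemma nint_lt_of_mem_Cs {q : ℕ} (hq : 0 < q) {δ x : ℝ} (h : x ∈ Cs q δ) : nint (q * x) < δ := by
  obtain ⟨a, _, _, h3⟩ := mem_Cs hq h
  exact lt_of_le_of_lt (by simpa [nint] using round_le (q * x) (a : ℤ)) h3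

lemma Cs_vol {q : ℕ} (hq : 0 < q) {δ : ℝ} (h0 : 0 ≤ δ) (hδ : δ ≤ 1 / 2) :
    volume.real (Cs q δ) = 2 * δ * (q.totient / q) := by
  have hq' : (0:ℝ) < q := by exact_mod_cast hq
  unfold Cs
  rw [measureReal_biUnion_finset (h := fun b _ => by rw [Real.volume_Ioo]; exact ENNReal.ofReal_ne_top)]
  · have : ∀ a ∈ (Finset.range q).filter (fun a => q.Coprime a),
        volume.real (Set.Ioo (((a:ℝ) - δ) / q) ((a + δ) / q)) = 2 * δ / q := by
      intro a _
      rw [Real.volume_real_Ioo_of_le (by gcongr; linarith)]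
      ring
    rw [Finset.sum_congr rfl this, Finset.sum_const, ← Nat.totient_eq_card_coprime, nsmul_eq_mul]
    ring
  · intro a _ b _ hab
    refine Set.disjoint_left.2 ?_
    rintro x ⟨h1, h2⟩ ⟨h3, h4⟩
    rw [div_lt_iff₀ hq'] at h1 h3
    rw [lt_div_iff₀ hq'] at h2 h4
    apply hab
    have g1 : (a:ℝ) < b + 1 := by linarith
    have g2 : (b:ℝ) < a + 1 := by linarith
    have g1' : a < b + 1 := by exact_mod_cast g1
    have g2' : b < a + 1 := by exact_mod_cast g2
    omega
  · intros; exact measurableSet_Ioo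

lemma Cs_overlap {q r : ℕ} (hq : 0 < q) (hr : 0 < r) (hqr : q ≠ r) {δ δ' : ℝ} (h0 : 0 ≤ δ)
    (h0' : 0 ≤ δ') : volume.real (Cs q δ ∩ Cs r δ') ≤ 8 * δ * δ' := by
  classical
  have hq' : (0:ℝ) < q := by exact_mod_cast hq
  have hr' : (0:ℝ) < r := by exact_mod_cast hr
  set P : Finset (ℕ × ℕ) := (((Finset.range q).filter (fun a => q.Coprime a)) ×ˢ
    ((Finset.range r).filter (fun a => r.Coprime a))).filter
      (fun p => |((p.1 * r : ℤ) - p.2 * q : ℝ)| < δ * r + δ' * q) with hP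
  set m : ℝ := min (2 * δ / q) (2 * δ' / r) with hm
  have hsub : Cs q δ ∩ Cs r δ' ⊆ ⋃ p ∈ P, (Set.Ioo (((p.1:ℝ) - δ) / q) ((p.1 + δ) / q) ∩
      Set.Ioo (((p.2:ℝ) - δ') / r) ((p.2 + δ') / r)) := by
    rintro x ⟨hx1, hx2⟩
    simp only [Cs, Set.mem_iUnion] at hx1 hx2
    obtain ⟨a, ha, hxa⟩ := hx1
    obtain ⟨b, hb, hxb⟩ := hx2
    simp only [Set.mem_iUnion]
    refine ⟨(a, b), ?_, hxa, hxb⟩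
    rw [hP, Finset.mem_filter, Finset.mem_product]
    refine ⟨⟨ha, hb⟩, ?_⟩
    obtain ⟨h1, h2⟩ := hxa
    obtain ⟨h3, h4⟩ := hxb
    rw [div_lt_iff₀ hq'] at h1
    rw [lt_div_iff₀ hq'] at h2
    rw [div_lt_iff₀ hr'] at h3
    rw [lt_div_iff₀ hr'] at h4
    push_cast
    rw [abs_lt]
    constructor <;> nlinarith
  have hcard : (P.card : ℝ) ≤ 2 * (δ * r + δ' * q) := by
    refine count_pairs q r hq _ (by positivity) P ?_
    intro p hp
    rw [hP, Finset.mem_filter, Finset.mem_product, Finset.mem_filter, Finset.mem_filter,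
      Finset.mem_range, Finset.mem_range] at hp
    obtain ⟨⟨⟨h1, h2⟩, h3, h4⟩, h5⟩ := hp
    refine ⟨h1, ?_, h5⟩
    intro h
    have h6 : p.1 * r = p.2 * q := by
      have : (p.1 * r : ℤ) = p.2 * q := by linarith
      exact_mod_cast this
    apply hqr
    apply Nat.dvd_antisymm
    · exact h2.dvd_of_dvd_mul_left ⟨p.2, by rw [h6]; ring⟩
    · exact h4.dvd_of_dvd_mul_left ⟨p.1, by rw [← h6]; ring⟩
  have hm0 : 0 ≤ m := by positivity
  calc volume.real (Cs q δ ∩ Cs r δ') ≤ volume.real (⋃ p ∈ P,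
        (Set.Ioo (((p.1:ℝ) - δ) / q) ((p.1 + δ) / q) ∩
        Set.Ioo (((p.2:ℝ) - δ') / r) ((p.2 + δ') / r))) := by
        refine measureReal_mono hsub ?_
        refine (lt_of_le_of_lt (measure_biUnion_finset_le _ _) ?_).ne
        refine ENNReal.sum_lt_top.2 fun p _ => ?_
        exact lt_of_le_of_lt (measure_mono Set.inter_subset_left) (by simp)
    _ ≤ ∑ p ∈ P, volume.real (Set.Ioo (((p.1:ℝ) - δ) / q) ((p.1 + δ) / q) ∩
        Set.Ioo (((p.2:ℝ) - δ') / r) ((p.2 + δ') / r)) := measureReal_biUnion_finset_le _ _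
    _ ≤ ∑ p ∈ P, m := by
        refine Finset.sum_le_sum fun p _ => le_min ?_ ?_
        · refine (measureReal_mono Set.inter_subset_left (by simp)).trans ?_
          rw [Real.volume_real_Ioo_of_le (by gcongr; linarith)]
          apply le_of_eq; ring
        · refine (measureReal_mono Set.inter_subset_right (by simp)).trans ?_
          rw [Real.volume_real_Ioo_of_le (by gcongr; linarith)]
          apply le_of_eq; ring
    _ = P.card * m := by rw [Finset.sum_const, nsmul_eq_mul]
    _ ≤ 2 * (δ * r + δ' * q) * m := by gcongr
    _ = 2 * (δ * r) * m + 2 * (δ' * q) * m := by ring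
    _ ≤ 2 * (δ * r) * (2 * δ' / r) + 2 * (δ' * q) * (2 * δ / q) := by
        gcongr
        · exact min_le_right _ _
        · exact min_le_left _ _
    _ = 8 * δ * δ' := by field_simp; ring

lemma sum_inv_sq (N : ℕ) : ∑ d ∈ Finset.Ioc 1 N, (1:ℝ) / (d:ℝ) ^ 2 ≤ 3 / 4 := by
  rcases Nat.lt_or_ge N 2 with h | h
  · have : Finset.Ioc 1 N = ∅ := by ext x; simp; omega
    rw [this]; norm_num
  · have : ∑ d ∈ Finset.Ioc 1 N, (1:ℝ) / (d:ℝ) ^ 2 + 1 / (N:ℝ) ≤ 3 / 4 := by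
      induction N, h using Nat.le_induction with
      | base => simp [show Finset.Ioc 1 2 = {2} by rfl]; norm_num
      | succ n hn ih =>
        rw [← Finset.insert_Ioc_right_eq_Ioc_add_one (by omega), Finset.sum_insert (by simp)]
        have hn' : (0:ℝ) < n := by exact_mod_cast (by omega : 0 < n)
        have : (1:ℝ) / ((n + 1 : ℕ):ℝ) ^ 2 + 1 / ((n+1:ℕ):ℝ) ≤ 1 / n := by
          push_cast
          rw [← sub_nonneg]
          have : (1:ℝ) / n - (1 / ((n:ℝ) + 1) ^ 2 + 1 / ((n:ℝ)+1)) = 1 / (n * (n+1)^2) := by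
            field_simp; ring
          rw [this]; positivity
        linarith
    have h0 : (0:ℝ) ≤ 1 / (N:ℝ) := by positivity
    linarith

lemma totient_sum (N : ℕ) : (N:ℝ) ^ 2 / 8 ≤ ∑ q ∈ Finset.Ioc 0 N, (q.totient : ℝ) := by
  classical
  set A : Finset (ℕ × ℕ) := (Finset.Ioc 0 N).biUnion
    (fun q => ({q} : Finset ℕ) ×ˢ (Finset.Ico 1 (1 + q)).filter (fun a => q.Coprime a)) with hA
  set B : Finset (ℕ × ℕ) := (Finset.Ioc 1 N).biUnion
    (fun d => (Finset.Ioc 0 N).filter (fun a => d ∣ a) ×ˢ (Finset.Ioc 0 N).filter (fun a => d ∣ a))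
    with hB
  have hsub : Finset.Ioc 0 N ×ˢ Finset.Ioc 0 N ⊆ (A ∪ A.image Prod.swap) ∪ B := by
    rintro ⟨a, b⟩ hab
    simp only [Finset.mem_product, Finset.mem_Ioc] at hab
    simp only [Finset.mem_union]
    by_cases hc : a.Coprime b
    · left
      rcases le_total b a with h | h
      · left
        simp only [hA, Finset.mem_biUnion, Finset.mem_product, Finset.mem_filter,
          Finset.mem_singleton, Finset.mem_Ico, Finset.mem_Ioc]
        exact ⟨a, by omega, rfl, by omega, hc⟩
      · right
        simp only [hA, Finset.mem_image, Finset.mem_biUnion, Finset.mem_product, Finset.mem_filter,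
          Finset.mem_singleton, Finset.mem_Ico, Finset.mem_Ioc]
        exact ⟨(b, a), ⟨b, by omega, rfl, by simp; omega, hc.symm⟩, rfl⟩
    · right
      simp only [hB, Finset.mem_biUnion, Finset.mem_product, Finset.mem_filter, Finset.mem_Ioc]
      have h0 : 0 < a.gcd b := Nat.gcd_pos_of_pos_left _ hab.1.1
      have h1 : a.gcd b ≠ 1 := hc
      have h2 : a.gcd b ≤ a := Nat.gcd_le_left _ hab.1.1
      exact ⟨a.gcd b, by omega, ⟨hab.1, Nat.gcd_dvd_left _ _⟩, hab.2, Nat.gcd_dvd_right _ _⟩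
  have hAc : A.card ≤ ∑ q ∈ Finset.Ioc 0 N, q.totient := by
    refine Finset.card_biUnion_le.trans (le_of_eq (Finset.sum_congr rfl fun q _ => ?_))
    rw [Finset.card_product, Finset.card_singleton, one_mul, Nat.filter_coprime_Ico_eq_totient]
  have hBc : B.card ≤ ∑ d ∈ Finset.Ioc 1 N, (N / d) * (N / d) := by
    refine Finset.card_biUnion_le.trans (le_of_eq (Finset.sum_congr rfl fun q _ => ?_))
    rw [Finset.card_product, Nat.Ioc_filter_dvd_card_eq_div]
  have h1 := Finset.card_le_card hsub
  have h2 := Finset.card_union_le (A ∪ A.image Prod.swap) B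
  have h3 := Finset.card_union_le A (A.image Prod.swap)
  have h4 : (A.image Prod.swap).card ≤ A.card := Finset.card_image_le
  rw [Finset.card_product, Nat.card_Ioc] at h1
  have h5 : N * N ≤ 2 * ∑ q ∈ Finset.Ioc 0 N, q.totient + ∑ d ∈ Finset.Ioc 1 N, (N / d) * (N / d) := by
    simp only [Nat.sub_zero] at h1
    omega
  have h6 : (N:ℝ) * N ≤ 2 * ∑ q ∈ Finset.Ioc 0 N, (q.totient : ℝ) +
      ∑ d ∈ Finset.Ioc 1 N, ((N / d : ℕ) : ℝ) * ((N / d : ℕ) : ℝ) := by exact_mod_cast h5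
  have h7 : ∑ d ∈ Finset.Ioc 1 N, ((N / d : ℕ) : ℝ) * ((N / d : ℕ) : ℝ) ≤ (N:ℝ) ^ 2 * (3 / 4) := by
    calc ∑ d ∈ Finset.Ioc 1 N, ((N / d : ℕ) : ℝ) * ((N / d : ℕ) : ℝ) ≤ ∑ d ∈ Finset.Ioc 1 N, (N:ℝ) ^ 2 * (1 / (d:ℝ) ^ 2) := by
          refine Finset.sum_le_sum fun d _ => ?_
          have : ((N / d : ℕ) : ℝ) ≤ N / d := Nat.cast_div_le
          calc _ ≤ ((N:ℝ) / d) * (N / d) := by gcongr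
            _ = _ := by ring
      _ = (N:ℝ) ^ 2 * ∑ d ∈ Finset.Ioc 1 N, (1 / (d:ℝ) ^ 2) := by rw [Finset.mul_sum]
      _ ≤ _ := by gcongr; exact sum_inv_sq N
  nlinarith

lemma block_totient (k : ℕ) :
    (4:ℝ) ^ k / 48 ≤ ∑ q ∈ Finset.Ico (4 ^ k + 1 : ℕ) (4 ^ (k + 1) + 1), ((q.totient : ℝ) / (q : ℝ)) ^ 2 := by
  set B := Finset.Ico (4 ^ k + 1 : ℕ) (4 ^ (k + 1) + 1) with hB
  have hp : (0:ℝ) < 4 ^ k := by positivity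
  have hle : 4 ^ k ≤ 4 ^ (k + 1) := Nat.pow_le_pow_right (by norm_num) (by omega)
  have hsplit : Finset.Ioc 0 (4 ^ (k+1)) = Finset.Ioc 0 (4 ^ k) ∪ B := by
    ext x; simp [hB]; omega
  have h1 := totient_sum (4 ^ (k + 1))
  rw [hsplit, Finset.sum_union (by
    rw [Finset.disjoint_left]; intro x; simp [hB]; omega)] at h1
  have h2 : ∑ q ∈ Finset.Ioc 0 (4 ^ k), (q.totient : ℝ) ≤ 4 ^ k * 4 ^ k := by
    calc _ ≤ ∑ q ∈ Finset.Ioc 0 (4 ^ k), (4:ℝ) ^ k := by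
          refine Finset.sum_le_sum fun q hq => ?_
          have : q.totient ≤ 4 ^ k := (Nat.totient_le q).trans (Finset.mem_Ioc.1 hq).2
          exact_mod_cast this
      _ = _ := by simp
  have h3 : (4:ℝ) ^ k * 4 ^ k ≤ ∑ q ∈ B, (q.totient : ℝ) := by
    push_cast at h1
    rw [show (4:ℝ) ^ (k + 1) = 4 * 4 ^ k by ring] at h1
    nlinarith
  have h4 : ∑ q ∈ B, (q.totient : ℝ) ≤ ∑ q ∈ B, ((q.totient : ℝ) / q) * (4 * 4 ^ k) := by
    refine Finset.sum_le_sum fun q hq => ?_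
    rw [hB, Finset.mem_Ico] at hq
    have hq0 : (0:ℝ) < q := by exact_mod_cast (by omega : 0 < q)
    have hq1 : (q:ℝ) ≤ 4 * 4 ^ k := by
      have : q ≤ 4 * 4 ^ k := by rw [pow_succ] at hq; omega
      exact_mod_cast this
    rw [div_mul_eq_mul_div, le_div_iff₀ hq0]
    gcongr
  rw [← Finset.sum_mul] at h4
  have h5 : (4:ℝ) ^ k / 4 ≤ ∑ q ∈ B, ((q.totient : ℝ) / q) := by
    by_contra hcon
    push Not at hcon
    nlinarith
  have h6 := sq_sum_le_card_mul_sum_sq (s := B) (f := fun q : ℕ => ((q.totient : ℝ) / q))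
  have hc : (B.card : ℝ) = 3 * 4 ^ k := by
    have : B.card = 3 * 4 ^ k := by rw [hB, Nat.card_Ico, pow_succ]; omega
    rw [this]; push_cast; ring
  rw [hc] at h6
  have h7 : ((4:ℝ) ^ k / 4) ^ 2 ≤ (∑ q ∈ B, ((q.totient : ℝ) / q)) ^ 2 := by gcongr
  have h8 := h7.trans h6
  by_contra hcon
  push Not at hcon
  nlinarith

/-- Lebesgue measure on the unit interval -/
noncomputable def nuI : Measure ℝ := volume.restrict (Set.Ioc 0 1)

instance nuI_fin : IsFiniteMeasure nuI := by unfold nuI; infer_instance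

lemma nuI_real {s : Set ℝ} (h : s ⊆ Set.Ioc 0 1) : nuI.real s = volume.real s := by
  unfold nuI Measure.real
  rw [Measure.restrict_eq_self _ h]

/-- block index -/
def kk (q : ℕ) : ℕ := Nat.log 4 (q - 1)

/-- width in the first coordinate -/
noncomputable def dl (i : ℕ) : ℝ := (1 / 2) ^ (i + 1)

/-- width in the second coordinate -/
noncomputable def et (ε : ℝ) (k i : ℕ) : ℝ := ε / (4 ^ k * (k : ℝ) ^ 2) * 2 ^ (i + 1)

/-- weights -/
noncomputable def ww (ε : ℝ) (q : ℕ) : ℝ := ε / (4 ^ (kk q) * (kk q : ℝ))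

/-- hyperbolic-type neighbourhoods of rational points -/
def EE (ε : ℝ) (q : ℕ) : Set (ℝ × ℝ) :=
  ⋃ i ∈ Finset.range (kk q), (Cs q (dl i) \ Cs q (dl (i + 1))) ×ˢ Cs q (et ε (kk q) i)

lemma kk_eq {k q : ℕ} (h : q ∈ Finset.Ico (4 ^ k + 1) (4 ^ (k + 1) + 1)) : kk q = k := by
  rw [Finset.mem_Ico] at h
  unfold kk
  have : 0 < 4 ^ k := by positivity
  apply Nat.log_eq_of_pow_le_of_lt_pow <;> omega

lemma five_le {q : ℕ} (h : 0 < kk q) : 5 ≤ q := by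
  unfold kk at h
  have := (Nat.log_pos_iff.1 h).1
  omega

lemma dl_pos (i : ℕ) : 0 < dl i := by unfold dl; positivity

lemma dl_succ (i : ℕ) : dl (i + 1) = dl i / 2 := by unfold dl; rw [pow_succ]; ring

lemma dl_le (i : ℕ) : dl i ≤ 1 / 2 := by
  unfold dl
  rw [pow_succ]
  have : ((1:ℝ) / 2) ^ i ≤ 1 := pow_le_one₀ (by norm_num) (by norm_num)
  linarith

lemma dl_anti : Antitone dl := by
  apply antitone_nat_of_succ_le
  intro n
  rw [dl_succ]
  linarith [dl_pos n]

lemma et_nonneg {ε : ℝ} (h : 0 < ε) (k i : ℕ) : 0 ≤ et ε k i := by unfold et; positivity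

lemma dl_mul_et (ε : ℝ) (k i : ℕ) : dl i * et ε k i = ε / (4 ^ k * (k : ℝ) ^ 2) := by
  unfold dl et
  rw [mul_left_comm, ← mul_pow]
  norm_num

lemma et_le {ε : ℝ} (h : 0 < ε) (h1 : ε ≤ 1) {k i : ℕ} (hi : i < k) : et ε k i ≤ 1 / 2 := by
  unfold et
  have hk : (1:ℝ) ≤ k := by exact_mod_cast (by omega : 1 ≤ k)
  have hk2 : (1:ℝ) ≤ (k:ℝ) ^ 2 := one_le_pow₀ hk
  have h4 : (4:ℝ) ^ k = 2 ^ k * 2 ^ k := by rw [← mul_pow]; norm_num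
  have h2 : (2:ℝ) ^ (i + 1) ≤ 2 ^ k := pow_le_pow_right₀ (by norm_num) (by omega)
  have h3 : (2:ℝ) ≤ 2 ^ k := by
    calc (2:ℝ) = 2 ^ 1 := by norm_num
      _ ≤ 2 ^ k := pow_le_pow_right₀ (by norm_num) (by omega)
  rw [div_mul_eq_mul_div, div_le_iff₀ (by positivity), h4]
  have a1 : ε * 2 ^ (i + 1) ≤ 1 * 2 ^ k := by gcongr
  have a2 : (2:ℝ) ^ k * 2 ≤ 2 ^ k * 2 ^ k := by gcongr
  have a3 : (2:ℝ) ^ k * 2 ^ k * 1 ≤ 2 ^ k * 2 ^ k * (k:ℝ) ^ 2 := by gcongr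
  linarith

lemma EE_measurable (ε : ℝ) (q : ℕ) : MeasurableSet (EE ε q) :=
  Finset.measurableSet_biUnion _ fun _ _ =>
    ((Cs_measurable _ _).diff (Cs_measurable _ _)).prod (Cs_measurable _ _)

lemma ww_eq (ε : ℝ) (q : ℕ) : (kk q : ℝ) * (ε / (4 ^ (kk q) * (kk q : ℝ) ^ 2)) = ww ε q := by
  unfold ww
  rcases Nat.eq_zero_or_pos (kk q) with h | h
  · simp [h]
  · have : (0:ℝ) < kk q := by exact_mod_cast h
    field_simp

lemma ww_nonneg {ε : ℝ} (h : 0 < ε) (q : ℕ) : 0 ≤ ww ε q := by unfold ww; positivity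

lemma EE_meas {ε : ℝ} (h : 0 < ε) (h1 : ε ≤ 1) (q : ℕ) :
    (nuI.prod nuI).real (EE ε q) = 2 * ww ε q * ((q.totient : ℝ) / (q : ℝ)) ^ 2 := by
  unfold EE
  rw [measureReal_biUnion_finset]
  · have : ∀ i ∈ Finset.range (kk q), (nuI.prod nuI).real
        ((Cs q (dl i) \ Cs q (dl (i + 1))) ×ˢ Cs q (et ε (kk q) i)) =
        2 * (ε / (4 ^ (kk q) * (kk q : ℝ) ^ 2)) * ((q.totient : ℝ) / (q : ℝ)) ^ 2 := by
      intro i hi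
      rw [Finset.mem_range] at hi
      have hq := five_le (by omega : 0 < kk q)
      rw [measureReal_prod_prod, measureReal_sdiff (Cs_mono _ (dl_anti (Nat.le_succ i)))
        (Cs_measurable _ _), nuI_real (Cs_subset (by omega) (by linarith [dl_le i])),
        nuI_real (Cs_subset (by omega) (by linarith [dl_le (i+1)])),
        nuI_real (Cs_subset (by omega) (by linarith [et_le h h1 hi])),
        Cs_vol (by omega) (dl_pos i).le (dl_le i), Cs_vol (by omega) (dl_pos _).le (dl_le _),
        Cs_vol (by omega) (et_nonneg h _ _) (et_le h h1 hi), dl_succ, ← dl_mul_et ε (kk q) i]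
      ring
    rw [Finset.sum_congr rfl this, Finset.sum_const, Finset.card_range, nsmul_eq_mul, ← ww_eq]
    ring
  · have : ∀ i j, i < j → Disjoint
        ((Cs q (dl i) \ Cs q (dl (i + 1))) ×ˢ Cs q (et ε (kk q) i))
        ((Cs q (dl j) \ Cs q (dl (j + 1))) ×ˢ Cs q (et ε (kk q) j)) := by
      intro i j hij
      rw [Set.disjoint_left]
      rintro x ⟨⟨_, hx⟩, _⟩ ⟨⟨hx', _⟩, _⟩
      exact hx (Cs_mono q (dl_anti hij) hx')
    intro i _ j _ hij
    rcases lt_or_gt_of_ne hij with hh | hh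
    · exact this i j hh
    · exact (this j i hh).symm
  · intro i _
    exact ((Cs_measurable _ _).diff (Cs_measurable _ _)).prod (Cs_measurable _ _)

lemma EE_overlap {ε : ℝ} (h : 0 < ε) (h1 : ε ≤ 1) (q r : ℕ) (hqr : q ≠ r) :
    (nuI.prod nuI).real (EE ε q ∩ EE ε r) ≤ 64 * (ww ε q * ww ε r) := by
  have hsub : EE ε q ∩ EE ε r ⊆ ⋃ i ∈ Finset.range (kk q), ⋃ j ∈ Finset.range (kk r),
      (Cs q (dl i) ∩ Cs r (dl j)) ×ˢ (Cs q (et ε (kk q) i) ∩ Cs r (et ε (kk r) j)) := by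
    rintro x ⟨hx, hy⟩
    simp only [EE, Set.mem_iUnion] at hx hy ⊢
    obtain ⟨i, hi, hxi⟩ := hx
    obtain ⟨j, hj, hxj⟩ := hy
    exact ⟨i, hi, j, hj, ⟨hxi.1.1, hxj.1.1⟩, hxi.2, hxj.2⟩
  calc _ ≤ (nuI.prod nuI).real (⋃ i ∈ Finset.range (kk q), ⋃ j ∈ Finset.range (kk r),
      (Cs q (dl i) ∩ Cs r (dl j)) ×ˢ (Cs q (et ε (kk q) i) ∩ Cs r (et ε (kk r) j))) :=
        measureReal_mono hsub (measure_ne_top _ _)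
    _ ≤ ∑ i ∈ Finset.range (kk q), ∑ j ∈ Finset.range (kk r), (nuI.prod nuI).real
      ((Cs q (dl i) ∩ Cs r (dl j)) ×ˢ (Cs q (et ε (kk q) i) ∩ Cs r (et ε (kk r) j))) :=
        (measureReal_biUnion_finset_le _ _).trans
          (Finset.sum_le_sum fun i _ => measureReal_biUnion_finset_le _ _)
    _ ≤ ∑ i ∈ Finset.range (kk q), ∑ j ∈ Finset.range (kk r),
        64 * ((ε / (4 ^ (kk q) * (kk q : ℝ) ^ 2)) * (ε / (4 ^ (kk r) * (kk r : ℝ) ^ 2))) := by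
        refine Finset.sum_le_sum fun i hi => Finset.sum_le_sum fun j hj => ?_
        rw [Finset.mem_range] at hi hj
        have hq := five_le (by omega : 0 < kk q)
        have hr := five_le (by omega : 0 < kk r)
        rw [measureReal_prod_prod,
          nuI_real (Set.inter_subset_left.trans (Cs_subset (by omega) (by linarith [dl_le i]))),
          nuI_real (Set.inter_subset_left.trans (Cs_subset (by omega)
            (by linarith [et_le h h1 hi])))]
        have o1 := Cs_overlap (by omega : 0 < q) (by omega : 0 < r) hqr (dl_pos i).le (dl_pos j).le
        have o2 := Cs_overlap (by omega : 0 < q) (by omega : 0 < r) hqr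
          (et_nonneg h (kk q) i) (et_nonneg h (kk r) j)
        refine (mul_le_mul o1 o2 measureReal_nonneg
          (by have := dl_pos i; have := dl_pos j; positivity)).trans (le_of_eq ?_)
        rw [← dl_mul_et ε (kk q) i, ← dl_mul_et ε (kk r) j]
        ring
    _ = 64 * (ww ε q * ww ε r) := by
        simp only [Finset.sum_const, Finset.card_range, nsmul_eq_mul]
        rw [← ww_eq, ← ww_eq]
        ring

lemma ww_sum (ε : ℝ) (K : ℕ) : ∑ q ∈ Finset.range (4 ^ (K + 1) + 1), ww ε q =
    3 * ε * ∑ k ∈ Finset.range K, 1 / ((k : ℝ) + 1) := by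
  induction K with
  | zero =>
    simp only [Finset.range_zero, Finset.sum_empty, mul_zero]
    apply Finset.sum_eq_zero
    intro q hq
    rw [Finset.mem_range] at hq
    have : kk q = 0 := Nat.log_eq_zero_iff.2 (Or.inl (by omega))
    simp [ww, this]
  | succ K ih =>
    have hle : 4 ^ (K + 1) + 1 ≤ 4 ^ (K + 1 + 1) + 1 := by rw [pow_succ 4 (K+1)]; omega
    rw [← Finset.sum_range_add_sum_Ico _ hle, ih, Finset.sum_range_succ, mul_add]
    congr 1
    have : ∀ q ∈ Finset.Ico (4 ^ (K + 1) + 1) (4 ^ (K + 1 + 1) + 1), ww ε q =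
        ε / (4 ^ (K + 1) * ((K:ℝ) + 1)) := by
      intro q hq
      rw [ww, kk_eq hq]; push_cast; rfl
    rw [Finset.sum_congr rfl this, Finset.sum_const, Nat.card_Ico, nsmul_eq_mul]
    have : 4 ^ (K + 1 + 1) + 1 - (4 ^ (K + 1) + 1) = 3 * 4 ^ (K + 1) := by
      rw [pow_succ 4 (K+1)]; omega
    rw [this]
    push_cast
    have : (0:ℝ) < (K:ℝ) + 1 := by positivity
    field_simp

lemma EE_sum {ε : ℝ} (h : 0 < ε) (h1 : ε ≤ 1) (K : ℕ) :
    ε / 24 * ∑ k ∈ Finset.range K, 1 / ((k : ℝ) + 1) ≤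
    ∑ q ∈ Finset.range (4 ^ (K + 1) + 1), (nuI.prod nuI).real (EE ε q) := by
  induction K with
  | zero =>
    simp only [Finset.range_zero, Finset.sum_empty, mul_zero]
    exact Finset.sum_nonneg fun _ _ => measureReal_nonneg
  | succ K ih =>
    have hle : 4 ^ (K + 1) + 1 ≤ 4 ^ (K + 1 + 1) + 1 := by rw [pow_succ 4 (K+1)]; omega
    rw [← Finset.sum_range_add_sum_Ico _ hle, Finset.sum_range_succ, mul_add]
    refine add_le_add ih ?_
    have : ∀ q ∈ Finset.Ico (4 ^ (K + 1) + 1) (4 ^ (K + 1 + 1) + 1),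
        (nuI.prod nuI).real (EE ε q) =
        2 * (ε / (4 ^ (K + 1) * ((K:ℝ) + 1))) * ((q.totient : ℝ) / (q : ℝ)) ^ 2 := by
      intro q hq
      rw [EE_meas h h1, ww, kk_eq hq]; push_cast; rfl
    rw [Finset.sum_congr rfl this, ← Finset.mul_sum]
    have hb := block_totient (K + 1)
    have hp : 0 ≤ 2 * (ε / (4 ^ (K + 1) * ((K:ℝ) + 1))) := by positivity
    refine le_trans (le_of_eq ?_) (mul_le_mul_of_nonneg_left hb hp)
    have : (0:ℝ) < (K:ℝ) + 1 := by positivity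
    field_simp
    norm_num

lemma EE_limsup {ε : ℝ} (h : 0 < ε) (h1 : ε ≤ 1) :
    ENNReal.ofReal ((1 / 72) ^ 2 / (8 * 64)) ≤
      (nuI.prod nuI) {x | ∃ᶠ q in atTop, x ∈ EE ε q} := by
  refine kochen_stone _ (EE ε) (EE_measurable ε) (ww ε) (ww_nonneg h) 64 (1 / 72)
    (by norm_num) (by norm_num) ?_ (EE_overlap h h1) ?_
  · intro q
    rw [EE_meas h h1]
    have hw := ww_nonneg h q
    have : ((q.totient : ℝ) / (q : ℝ)) ^ 2 ≤ 1 := by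
      apply pow_le_one₀ (by positivity)
      apply div_le_one_of_le₀ _ (by positivity)
      exact_mod_cast Nat.totient_le q
    nlinarith
  · intro T
    have ht := Real.tendsto_sum_range_one_div_nat_succ_atTop
    obtain ⟨K, hK⟩ := (ht.eventually_ge_atTop (T / (3 * ε))).exists
    refine ⟨4 ^ (K + 1) + 1, ?_, ?_⟩
    · rw [ww_sum]
      rw [div_le_iff₀ (by positivity)] at hK
      linarith
    · rw [ww_sum]
      refine le_trans (le_of_eq ?_) (EE_sum h h1 K)
      ring

lemma EE_value {ε : ℝ} (h : 0 < ε) {q : ℕ} {x : ℝ × ℝ} (hx : x ∈ EE ε q) :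
    (q : ℝ) * (Real.log q) ^ 2 * nint (q * x.1) * nint (q * x.2) < 64 * ε := by
  simp only [EE, Set.mem_iUnion, Finset.mem_range] at hx
  obtain ⟨i, hi, ⟨hx1, _⟩, hx2⟩ := hx
  have hq := five_le (by omega : 0 < kk q)
  have n1 := nint_lt_of_mem_Cs (by omega) hx1
  have n2 := nint_lt_of_mem_Cs (by omega) hx2
  set k := kk q with hk
  have hk1 : 1 ≤ k := by omega
  have hkR : (1:ℝ) ≤ k := by exact_mod_cast hk1
  have hqk : q ≤ 4 ^ (k + 1) := by
    have := Nat.lt_pow_succ_log_self (b := 4) (by norm_num) (q - 1)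
    change q - 1 < 4 ^ (k + 1) at this
    omega
  have hqR : (q:ℝ) ≤ 4 * 4 ^ k := by
    have : (q:ℝ) ≤ 4 ^ (k + 1) := by exact_mod_cast hqk
    rw [pow_succ] at this; linarith
  have hq1 : (1:ℝ) ≤ q := by exact_mod_cast (by omega : 1 ≤ q)
  have hl0 : 0 ≤ Real.log q := Real.log_nonneg hq1
  have hl4 : Real.log 4 ≤ 2 := by
    have : Real.log 4 = 2 * Real.log 2 := by
      rw [show (4:ℝ) = 2 ^ 2 by norm_num, Real.log_pow]; norm_num
    have := Real.log_two_lt_d9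
    linarith
  have hl : Real.log q ≤ 4 * k := by
    calc Real.log q ≤ Real.log (4 ^ (k + 1)) :=
          Real.log_le_log (by linarith) (by exact_mod_cast hqk)
      _ = (k + 1 : ℕ) * Real.log 4 := by rw [Real.log_pow]
      _ ≤ (k + 1 : ℕ) * 2 := by gcongr
      _ ≤ 4 * k := by push_cast; linarith
  have hn : nint (q * x.1) * nint (q * x.2) < ε / (4 ^ k * (k : ℝ) ^ 2) := by
    rw [← dl_mul_et ε k i]
    exact mul_lt_mul'' n1 n2 (abs_nonneg _) (abs_nonneg _)
  have hpos : (0:ℝ) < 4 * 4 ^ k * (4 * k) ^ 2 := by positivity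
  have hn0 : 0 ≤ nint (q * x.1) * nint (q * x.2) := mul_nonneg (abs_nonneg _) (abs_nonneg _)
  calc (q : ℝ) * (Real.log q) ^ 2 * nint (q * x.1) * nint (q * x.2)
      = (q : ℝ) * (Real.log q) ^ 2 * (nint (q * x.1) * nint (q * x.2)) := by ring
    _ ≤ (4 * 4 ^ k * (4 * k) ^ 2) * (nint (q * x.1) * nint (q * x.2)) := by gcongr
    _ < (4 * 4 ^ k * (4 * k) ^ 2) * (ε / (4 ^ k * (k : ℝ) ^ 2)) := by gcongr
    _ = 64 * ε := by field_simp; norm_num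

/-- the two-dimensional torus -/
abbrev TT : Type := UnitAddCircle × UnitAddCircle

/-- multiplicative approximation quality on the torus -/
noncomputable def FT (q : ℕ) (p : TT) : ℝ := (q : ℝ) * (Real.log q) ^ 2 * ‖q • p.1‖ * ‖q • p.2‖

/-- the set of multiplicatively well approximable points -/
def AT : Set TT := {p | ∀ n : ℕ, ∃ᶠ q in atTop, FT q p < 1 / ((n : ℝ) + 1)}

lemma FT_cont (q : ℕ) : Continuous (FT q) := by unfold FT; fun_prop

lemma AT_measurable : MeasurableSet AT := by
  have : AT = ⋂ n : ℕ, ⋂ m : ℕ, ⋃ q ∈ {q : ℕ | m ≤ q}, {p | FT q p < 1 / ((n : ℝ) + 1)} := by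
    ext p
    simp [AT, frequently_atTop]
  rw [this]
  refine MeasurableSet.iInter fun n => MeasurableSet.iInter fun m =>
    MeasurableSet.biUnion (Set.to_countable _) fun q _ => ?_
  exact (isOpen_lt (FT_cont q) continuous_const).measurableSet

lemma FT_nonneg (q : ℕ) (p : TT) : 0 ≤ FT q p := by unfold FT; positivity

lemma FT_mul {b q : ℕ} (hb : 0 < b) (hq : b ≤ q) {g : TT} (hg : b • g = 0) (p : TT) :
    FT (b * q) (g + p) ≤ 4 * (b : ℝ) ^ 3 * FT q p := by
  have h1 : (b * q) • (g + p).1 = b • (q • p.1) := by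
    have : b • g.1 = 0 := congrArg Prod.fst hg
    rw [Prod.fst_add, smul_add, mul_comm b q, mul_smul, this, smul_zero, zero_add, mul_comm,
      mul_smul]
  have h2 : (b * q) • (g + p).2 = b • (q • p.2) := by
    have : b • g.2 = 0 := congrArg Prod.snd hg
    rw [Prod.snd_add, smul_add, mul_comm b q, mul_smul, this, smul_zero, zero_add, mul_comm,
      mul_smul]
  have hbR : (0:ℝ) < b := by exact_mod_cast hb
  have hb1 : (1:ℝ) ≤ b := by exact_mod_cast hb
  have hqR : (b:ℝ) ≤ q := by exact_mod_cast hq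
  have hl : Real.log (b * q) ≤ 2 * Real.log q := by
    rw [Real.log_mul (by positivity) (by linarith)]
    have := Real.log_le_log hbR hqR
    linarith
  have hl0 : 0 ≤ Real.log (b * q) := Real.log_nonneg (by nlinarith)
  unfold FT
  rw [h1, h2]
  have n1 : ‖b • (q • p.1)‖ ≤ b * ‖q • p.1‖ := norm_nsmul_le
  have n2 : ‖b • (q • p.2)‖ ≤ b * ‖q • p.2‖ := norm_nsmul_le
  push_cast
  calc (b:ℝ) * q * Real.log (b * q) ^ 2 * ‖b • (q • p.1)‖ * ‖b • (q • p.2)‖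
      ≤ (b:ℝ) * q * (2 * Real.log q) ^ 2 * (b * ‖q • p.1‖) * (b * ‖q • p.2‖) := by gcongr
    _ = _ := by ring

lemma AT_add {b : ℕ} (hb : 0 < b) {g : TT} (hg : b • g = 0) {p : TT} (hp : p ∈ AT) :
    g + p ∈ AT := by
  intro n
  have hbR : (0:ℝ) < b := by exact_mod_cast hb
  obtain ⟨m, hm⟩ := exists_nat_one_div_lt (show (0:ℝ) < 1 / ((n:ℝ) + 1) / (4 * (b : ℝ) ^ 3) by
    positivity)
  have := hp m
  rw [frequently_atTop] at this ⊢
  intro N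
  obtain ⟨q, hq, hF⟩ := this (max N b)
  have hqb : b ≤ q := le_trans (le_max_right _ _) hq
  have hqN : N ≤ q := le_trans (le_max_left _ _) hq
  refine ⟨b * q, le_trans hqN (Nat.le_mul_of_pos_left _ hb), ?_⟩
  refine lt_of_le_of_lt (FT_mul hb hqb hg p) ?_
  have := hF.trans hm
  rw [lt_div_iff₀ (by positivity)] at this
  linarith

lemma dense_torsion : Dense {x : UnitAddCircle | ∃ b : ℕ, 0 < b ∧ b • x = 0} := by
  have h : DenseRange (fun r : ℚ => ((r : ℝ) : UnitAddCircle)) :=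
    (QuotientAddGroup.mk_surjective.denseRange).comp (Rat.denseRange_cast)
      (AddCircle.continuous_mk' 1)
  refine h.mono ?_
  rintro _ ⟨r, rfl⟩
  refine ⟨r.den, r.den_pos, ?_⟩
  change ((r.den • (r:ℝ) : ℝ) : UnitAddCircle) = 0
  rw [AddCircle.coe_eq_zero_iff]
  refine ⟨r.num, ?_⟩
  have : (r : ℝ) * r.den = r.num := by exact_mod_cast Rat.mul_den_eq_num r
  rw [zsmul_eq_mul, nsmul_eq_mul, mul_one, ← this, mul_comm]

instance TT_inv : (volume : Measure TT).IsAddLeftInvariant :=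
  inferInstanceAs ((volume : Measure UnitAddCircle).prod
    (volume : Measure UnitAddCircle)).IsAddLeftInvariant

lemma ergodic_self {G : Type*} [AddGroup G] [MeasurableSpace G] [MeasurableAdd₂ G]
    [MeasurableNeg G] (μ : Measure G) [SFinite μ] [μ.IsAddLeftInvariant] : ErgodicVAdd G G μ :=
  inferInstance

instance TT_erg : ErgodicVAdd TT TT (volume : Measure TT) := ergodic_self _

lemma AT_const : EventuallyConst AT (ae (volume : Measure TT)) := by
  refine aeconst_of_dense_setOfPred_preimage_vadd_eq (M := TT) AT_measurable.nullMeasurableSet ?_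
  refine (dense_torsion.prod dense_torsion).mono ?_
  rintro ⟨x, y⟩ ⟨⟨b, hb, hx⟩, c, hc, hy⟩
  have hg : (b * c) • ((x, y) : TT) = 0 := by
    simp only at hx hy
    ext
    · simp only [Prod.smul_fst, Prod.fst_zero]
      rw [mul_comm, mul_smul, hx, smul_zero]
    · simp only [Prod.smul_snd, Prod.snd_zero]
      rw [mul_smul, hy, smul_zero]
  have hbc : 0 < b * c := Nat.mul_pos hb hc
  simp only [Set.mem_ofPred_eq]
  ext p
  simp only [Set.mem_preimage, vadd_eq_add]
  constructor
  · intro h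
    have := AT_add hbc (g := -(x, y)) (by rw [smul_neg, hg, neg_zero]) h
    rwa [neg_add_cancel_left] at this
  · exact fun h => AT_add hbc hg h

/-- projection from the plane to the torus -/
def pj (x : ℝ × ℝ) : TT := ((x.1 : UnitAddCircle), (x.2 : UnitAddCircle))

lemma pj_mp (s t : ℝ) : MeasurePreserving pj
    ((volume.restrict (Set.Ioc s (s + 1))).prod (volume.restrict (Set.Ioc t (t + 1)))) volume :=
  (UnitAddCircle.measurePreserving_mk s).prod (UnitAddCircle.measurePreserving_mk t)

lemma FT_pj (q : ℕ) (x : ℝ × ℝ) :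
    FT q (pj x) = (q : ℝ) * (Real.log q) ^ 2 * nint (q * x.1) * nint (q * x.2) := by
  unfold FT pj nint
  simp only [← AddCircle.coe_nsmul, nsmul_eq_mul]
  rw [UnitAddCircle.norm_eq, UnitAddCircle.norm_eq]

lemma AT_pos : (volume : Measure TT) AT ≠ 0 := by
  have hmp : MeasurePreserving pj (nuI.prod nuI) volume := by
    have := pj_mp 0 0
    simp only [zero_add] at this
    exact this
  rw [← hmp.measure_preimage AT_measurable.nullMeasurableSet]
  set S : ℕ → Set (ℝ × ℝ) := fun n => pj ⁻¹' {p | ∃ᶠ q in atTop, FT q p < 1 / ((n : ℝ) + 1)} with hS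
  have hSA : pj ⁻¹' AT = ⋂ n, S n := by
    ext x; simp [AT, hS]
  have hSm : ∀ n, MeasurableSet (S n) := by
    intro n
    refine hmp.measurable ?_
    have : {p | ∃ᶠ q in atTop, FT q p < 1 / ((n : ℝ) + 1)} =
        ⋂ m : ℕ, ⋃ q ∈ {q : ℕ | m ≤ q}, {p | FT q p < 1 / ((n : ℝ) + 1)} := by
      ext p
      simp [frequently_atTop]
    rw [this]
    refine MeasurableSet.iInter fun m =>
      MeasurableSet.biUnion (Set.to_countable _) fun q _ => ?_
    exact (isOpen_lt (FT_cont q) continuous_const).measurableSet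
  have hanti : Antitone S := by
    intro a b hab x hx
    refine Frequently.mono (show ∃ᶠ q in atTop, FT q (pj x) < 1 / ((b : ℝ) + 1) from hx) ?_
    intro q hq
    refine lt_of_lt_of_le hq ?_
    have : (a:ℝ) ≤ b := by exact_mod_cast hab
    gcongr
  have hlow : ENNReal.ofReal ((1 / 72) ^ 2 / (8 * 64)) ≤ (nuI.prod nuI) (⋂ n, S n) := by
    refine ge_of_tendsto (tendsto_measure_iInter_atTop (fun m => (hSm m).nullMeasurableSet) hanti
      ⟨0, measure_ne_top _ _⟩) (Eventually.of_forall fun n => ?_)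
    have hn : (0:ℝ) < (n:ℝ) + 1 := by positivity
    have h0 : (0:ℝ) < 1 / ((n : ℝ) + 1) / 64 := by positivity
    have h1 : (1:ℝ) / ((n : ℝ) + 1) / 64 ≤ 1 := by
      rw [div_div, div_le_one (by positivity)]
      have : (0:ℝ) ≤ n := by positivity
      linarith
    refine (EE_limsup h0 h1).trans (measure_mono ?_)
    intro x hx
    refine Frequently.mono (show ∃ᶠ q in atTop, x ∈ EE _ q from hx) ?_
    intro q hq
    have := EE_value h0 hq
    rw [FT_pj]
    linarith
  rw [hSA]
  refine (lt_of_lt_of_le ?_ hlow).ne'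
  rw [ENNReal.ofReal_pos]
  norm_num

lemma AT_ae : ∀ᵐ p ∂(volume : Measure TT), p ∈ AT := by
  rcases eventuallyConst_set.1 AT_const with h | h
  · exact h
  · exfalso
    exact AT_pos (measure_eq_zero_iff_ae_notMem.2 h)

lemma plane_ae : ∀ᵐ x : ℝ × ℝ ∂volume, pj x ∈ AT := by
  have h : ∀ m n : ℤ, ∀ᵐ x ∂((volume : Measure (ℝ × ℝ)).restrict
      (Set.Ioc (m:ℝ) (m + 1) ×ˢ Set.Ioc (n:ℝ) (n + 1))), pj x ∈ AT := by
    intro m n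
    have := (pj_mp m n).quasiMeasurePreserving.ae AT_ae
    rw [Measure.prod_restrict] at this
    exact this
  have h2 : (⋃ z : ℤ × ℤ, Set.Ioc (z.1:ℝ) (z.1 + 1) ×ˢ Set.Ioc (z.2:ℝ) (z.2 + 1)) =
      (Set.univ : Set (ℝ × ℝ)) := by
    rw [Set.eq_univ_iff_forall]
    rintro ⟨x, y⟩
    have hx : x ∈ ⋃ n : ℤ, Set.Ioc (n:ℝ) (n + 1) := by rw [iUnion_Ioc_intCast]; trivial
    have hy : y ∈ ⋃ n : ℤ, Set.Ioc (n:ℝ) (n + 1) := by rw [iUnion_Ioc_intCast]; trivial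
    rw [Set.mem_iUnion] at hx hy ⊢
    obtain ⟨m, hm⟩ := hx
    obtain ⟨n, hn⟩ := hy
    exact ⟨(m, n), hm, hn⟩
  rw [← Measure.restrict_univ (μ := (volume : Measure (ℝ × ℝ))), ← h2, ae_restrict_iUnion_iff]
  exact fun z => h z.1 z.2

theorem stmt_15 :
    ∀ᵐ pr : ℝ × ℝ ∂(MeasureTheory.volume),
      atTop.liminf (fun q : ℕ =>
        (q : ℝ) * (Real.log q) ^ 2 * nint (q * pr.1) * nint (q * pr.2)) = 0 := by
  filter_upwards [plane_ae] with x hx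
  simp_rw [← FT_pj]
  have hb : IsBoundedUnder (· ≥ ·) atTop (fun q : ℕ => FT q (pj x)) :=
    isBoundedUnder_of ⟨0, fun q => FT_nonneg q _⟩
  have hle : ∀ n : ℕ, ∃ᶠ q in atTop, FT q (pj x) ≤ 1 / ((n : ℝ) + 1) :=
    fun n => (hx n).mono fun q hq => le_of_lt hq
  apply le_antisymm
  · refine le_of_forall_pos_le_add fun ε hε => ?_
    obtain ⟨n, hn⟩ := exists_nat_one_div_lt hε
    have := liminf_le_of_frequently_le (hle n) hb
    linarith
  · exact le_liminf_of_le (IsCoboundedUnder.of_frequently_le (hle 0))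
      (Eventually.of_forall fun q => FT_nonneg q _)
end
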